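/- Let Ω ⊂ ℝ² be a bounded, open, connected set with Lipschitz boundary, let C ⊂ Ω be a finite set of points, and let u ∈ W^{1,1}(Ω;S¹). Then 𝒜(u, Ω ∖ C) ≤ ∫_Ω √(1 + |∇u|²) dx + ‖Det(∇u)‖_{flat,α,Ω∖C}, where ‖Det(∇u)‖_{flat,α,Ω∖C} := sup{ ⟨Det(∇u),φ⟩ : φ : cl(Ω) → ℝ Lipschitz with φ = 0 on ∂Ω ∪ C, ‖φ‖_∞ ≤ 1, lip(φ) ≤ 2 }. -/

import Mathlib

open MeasureTheory Metric Filter Set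
open scoped ENNReal NNReal Topology Classical

noncomputable section

abbrev R2 := EuclideanSpace ℝ (Fin 2)

/-- `Ω ⊂ ℝ²` has Lipschitz boundary: near every boundary point, after a rigid motion,
`Ω` coincides with the open region strictly above the graph of a Lipschitz function. -/
def HasLipschitzBoundary (Ω : Set R2) : Prop :=
  ∀ p ∈ frontier Ω, ∃ r : ℝ, 0 < r ∧ ∃ (f : R2 ≃ᵢ R2) (γ : ℝ → ℝ) (L : ℝ≥0),
    LipschitzWith L γ ∧ ∀ x ∈ Metric.ball p r, (x ∈ Ω ↔ γ (f x 0) < f x 1)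

/-- `G` is the weak (distributional) gradient of `u` on `Ω`:
`∫_Ω u_i ∂_j φ = -∫_Ω G_{ij} φ` for all test functions `φ ∈ C_c^∞(Ω)`. -/
def IsWeakGradient (Ω : Set R2) (u : R2 → R2) (G : R2 → Matrix (Fin 2) (Fin 2) ℝ) : Prop :=
  ∀ φ : R2 → ℝ, ContDiff ℝ (⊤ : ℕ∞) φ → HasCompactSupport φ → tsupport φ ⊆ Ω →
    ∀ i j : Fin 2,
      (∫ x in Ω, u x i * fderiv ℝ φ x (EuclideanSpace.single j 1)) =
        - ∫ x in Ω, G x i j * φ x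

/-- `u ∈ W^{1,1}(Ω;ℝ²)` with weak gradient `G`. -/
def MemW11 (Ω : Set R2) (u : R2 → R2) (G : R2 → Matrix (Fin 2) (Fin 2) ℝ) : Prop :=
  IntegrableOn u Ω ∧ (∀ i j : Fin 2, IntegrableOn (fun x => G x i j) Ω) ∧
    IsWeakGradient Ω u G

/-- `|u| = 1` a.e. in `Ω`. -/
def SphereValued (Ω : Set R2) (u : R2 → R2) : Prop :=
  ∀ᵐ x ∂(volume.restrict Ω), ‖u x‖ = 1

/-- Frobenius norm of a `2×2` matrix. -/
def frob (M : Matrix (Fin 2) (Fin 2) ℝ) : ℝ :=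
  Real.sqrt (∑ i, ∑ j, (M i j) ^ 2)

/-- Jacobian matrix of a map `v : ℝ² → ℝ²`. -/
def jacobianMatrix (v : R2 → R2) (x : R2) : Matrix (Fin 2) (Fin 2) ℝ :=
  Matrix.of fun i j => fderiv ℝ v x (EuclideanSpace.single j 1) i

/-- Classical graph area `A(v,A) = ∫_A √(1 + |∇v|² + (Jv)²)` of a `C¹` map. -/
def classicalArea (A : Set R2) (v : R2 → R2) : ℝ≥0∞ :=
  ∫⁻ x in A, ENNReal.ofReal
    (Real.sqrt (1 + (∑ i, ∑ j, (jacobianMatrix v x i j) ^ 2) + (jacobianMatrix v x).det ^ 2))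

/-- `L¹`-relaxed area functional `𝒜(u,A)`. -/
def relaxedArea (u : R2 → R2) (A : Set R2) : ℝ≥0∞ :=
  sInf { a : ℝ≥0∞ | ∃ v : ℕ → R2 → R2,
    (∀ k, ContDiffOn ℝ 1 (v k) A) ∧
    (∀ k, IntegrableOn (fun x => v k x - u x) A) ∧
    Tendsto (fun k => ∫ x in A, ‖v k x - u x‖) atTop (nhds 0) ∧
    a = Filter.liminf (fun k => classicalArea A (v k)) atTop }

/-- `λ_u = (1/2)(u₁ ∇^⊥u₂ − u₂ ∇^⊥u₁)`, computed from the weak gradient `G`. -/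
def lambdaVec (u : R2 → R2) (G : R2 → Matrix (Fin 2) (Fin 2) ℝ) (x : R2) : Fin 2 → ℝ :=
  ![ (1 / 2) * (-(u x 0) * G x 1 1 + u x 1 * G x 0 1),
     (1 / 2) * (u x 0 * G x 1 0 - u x 1 * G x 0 0) ]

/-- Distributional Jacobian pairing `⟨Det(∇u), φ⟩ = ∫_Ω λ_u · ∇φ`. -/
def detPairing (Ω : Set R2) (u : R2 → R2) (G : R2 → Matrix (Fin 2) (Fin 2) ℝ)
    (φ : R2 → ℝ) : ℝ :=
  ∫ x in Ω, ∑ j, lambdaVec u G x j * fderiv ℝ φ x (EuclideanSpace.single j 1)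

/-- `φ ∈ Lip₀(Ω)`: Lipschitz on `cl(Ω)` and vanishing on `∂Ω`. -/
def MemLip0 (Ω : Set R2) (φ : R2 → ℝ) : Prop :=
  (∃ L : ℝ≥0, LipschitzOnWith L φ (closure Ω)) ∧ ∀ p ∈ frontier Ω, φ p = 0

/-- Admissible test functions for the flat norm: Lipschitz constant `≤ L` on `cl(Ω)`,
vanishing on `Z`, and bounded by `1` on `cl(Ω)`. -/
def FlatAdmissible (Ω Z : Set R2) (L : ℝ≥0) (φ : R2 → ℝ) : Prop :=
  LipschitzOnWith L φ (closure Ω) ∧ (∀ p ∈ Z, φ p = 0) ∧ ∀ p ∈ closure Ω, |φ p| ≤ 1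

/-- Flat norm of a functional `F`, with vanishing condition on the set `Z`. -/
def flatNormOn (Ω Z : Set R2) (L : ℝ≥0) (F : (R2 → ℝ) → ℝ) : ℝ≥0∞ :=
  ⨆ φ ∈ {φ : R2 → ℝ | FlatAdmissible Ω Z L φ}, ENNReal.ofReal (F φ)

/-- Flat norm of a functional `F` on `Lip₀(Ω)`; `L = 2` gives `‖·‖_{flat,α}` (α = 1/2),
`L = 1` gives `‖·‖_flat`. -/
def flatNorm (Ω : Set R2) (L : ℝ≥0) (F : (R2 → ℝ) → ℝ) : ℝ≥0∞ :=
  flatNormOn Ω (frontier Ω) L F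

/-- `d̄_Ω(x,y) = min{|x−y|, dist(x,∂Ω) + dist(y,∂Ω)}`. -/
def dbar (Ω : Set R2) (x y : R2) : ℝ :=
  min (dist x y) (Metric.infDist x (frontier Ω) + Metric.infDist y (frontier Ω))

/-- Countably subadditive interior envelope `𝒜**(u,V)` (relative to `Ω`). -/
def envA (u : R2 → R2) (Ω V : Set R2) : ℝ≥0∞ :=
  sInf { a : ℝ≥0∞ | ∃ A : ℕ → Set R2,
    (∀ k, IsOpen (A k) ∧ A k ⊆ Ω) ∧ V ⊆ ⋃ k, A k ∧ a = ∑' k, relaxedArea u (A k) }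

/-- Property `(P_f)` for a finite family of pairs of points of `cl(Ω)`. -/
def SatisfiesPf (Ω : Set R2) {n : ℕ} (x y : Fin n → R2) : Prop :=
  (∀ k, (x k ∈ Ω ∧ y k ∈ frontier Ω ∧ dist (x k) (y k) = Metric.infDist (x k) (frontier Ω)) ∨
        (y k ∈ Ω ∧ x k ∈ frontier Ω ∧ dist (x k) (y k) = Metric.infDist (y k) (frontier Ω))) ∧
  ∀ i j, x i ∈ Ω → y j ∈ Ω → x i ≠ y j

/-- The points of the family `x, y` lying in `Ω` are distinct and three by three
not collinear. -/
def InteriorPointsGeneric (Ω : Set R2) {n : ℕ} (x y : Fin n → R2) : Prop :=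
  (∀ a b : Fin n ⊕ Fin n, Sum.elim x y a ∈ Ω → Sum.elim x y b ∈ Ω → a ≠ b →
    Sum.elim x y a ≠ Sum.elim x y b) ∧
  ∀ a b c : Fin n ⊕ Fin n, Sum.elim x y a ∈ Ω → Sum.elim x y b ∈ Ω → Sum.elim x y c ∈ Ω →
    a ≠ b → a ≠ c → b ≠ c →
    ¬ Collinear ℝ ({Sum.elim x y a, Sum.elim x y b, Sum.elim x y c} : Set R2)

/-- `ι(w₁,w₂) = (w₁,−w₂)`. -/
def conjPt (w : R2) : R2 := (WithLp.equiv 2 (Fin 2 → ℝ)).symm ![w 0, -(w 1)]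

/-- `u` is a (positive/negative) vortex around the points of the family lying in `Ω`:
the closed discs of radii `ρ` are contained in `Ω` and pairwise disjoint,
`u(z) = (z−x_i)/|z−x_i|` on `B_{ρ}(x_i)` and `u(z) = ι((z−y_j)/|z−y_j|)` on `B_{ρ}(y_j)`. -/
def VortexAt (Ω : Set R2) (u : R2 → R2) {n : ℕ} (x y : Fin n → R2)
    (ρ : Fin n ⊕ Fin n → ℝ) : Prop :=
  (∀ a, Sum.elim x y a ∈ Ω → Metric.closedBall (Sum.elim x y a) (ρ a) ⊆ Ω) ∧
  (∀ a b, a ≠ b → Sum.elim x y a ∈ Ω → Sum.elim x y b ∈ Ω →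
    Disjoint (Metric.closedBall (Sum.elim x y a) (ρ a))
      (Metric.closedBall (Sum.elim x y b) (ρ b))) ∧
  (∀ i, x i ∈ Ω → ∀ᵐ z ∂(volume.restrict (Metric.ball (x i) (ρ (Sum.inl i)))),
    u z = ‖z - x i‖⁻¹ • (z - x i)) ∧
  (∀ i, y i ∈ Ω → ∀ᵐ z ∂(volume.restrict (Metric.ball (y i) (ρ (Sum.inr i)))),
    u z = conjPt (‖z - y i‖⁻¹ • (z - y i)))

/-- The energy `E(I_P, I_D, τ)` of a partition `{I_Dᶜ, I_D}` of `I` and an injection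
`τ : I_D → I`. -/
def energy (Ω : Set R2) {n : ℕ} (x y : Fin n → R2) (ID : Finset (Fin n))
    (τ : Fin n → Fin n) : ℝ≥0∞ :=
  ((IDᶜ.filter fun k => x k ∈ Ω).card : ℝ≥0∞) +
  (((Finset.univ \ ID.image τ).filter fun j => y j ∈ Ω).card : ℝ≥0∞) +
  2 * ∑ k ∈ ID, μH[1] (segment ℝ (y (τ k)) (x k) ∩ Ω)

/-! ### Common notions -/

/-- Identification of the plane with `ℂ`. -/
def cx : R2 ≃ₗᵢ[ℝ] ℂ := Complex.orthonormalBasisOneI.repr.symm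

lemma cx_apply (x : R2) : cx x = ⟨x 0, x 1⟩ := by
  unfold cx
  apply Complex.orthonormalBasisOneI.repr.injective
  rw [LinearIsometryEquiv.apply_symm_apply]
  ext i
  fin_cases i <;> simp [Complex.orthonormalBasisOneI_repr_apply]

lemma cx_re (x : R2) : (cx x).re = x 0 := by rw [cx_apply]
lemma cx_im (x : R2) : (cx x).im = x 1 := by rw [cx_apply]

/-- The standard basis vectors. -/
abbrev ee (j : Fin 2) : R2 := EuclideanSpace.single j (1 : ℝ)

lemma cx_ee0 : cx (ee 0) = 1 := by
  apply Complex.ext <;> simp [cx_re, cx_im, ee]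

lemma cx_ee1 : cx (ee 1) = Complex.I := by
  apply Complex.ext <;> simp [cx_re, cx_im, ee]

/-- The angular current `j(A) = Im (dA / A)`, as a complex number. -/
def jf (A : R2 → ℂ) (x : R2) : ℂ :=
  ⟨(fderiv ℝ A x (ee 0) / A x).im, (fderiv ℝ A x (ee 1) / A x).im⟩

/-- normalization -/
def uv (z : ℂ) : ℂ := z / (‖z‖ : ℂ)

/-- identity or conjugation -/
def sg (s : Bool) (z : ℂ) : ℂ := if s then z else (starRingEnd ℂ) z

/-- real sign -/
def sr (s : Bool) : ℝ := if s then 1 else -1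

/-- (unnormalized) vortex of sign `s` at `p` -/
def vx (s : Bool) (p x : R2) : ℂ := sg s (cx x - cx p)

/-- current of the positive vortex at `p` -/
def jv (p x : R2) : ℂ := Complex.I / (starRingEnd ℂ) (cx x - cx p)

/-- the weak current of `u` -/
def wf (u : R2 → R2) (G : R2 → Matrix (Fin 2) (Fin 2) ℝ) (x : R2) : ℂ :=
  ⟨u x 0 * G x 1 0 - u x 1 * G x 0 0, u x 0 * G x 1 1 - u x 1 * G x 0 1⟩

/-- `A`, with current `a`, can be approximated on `U` by smooth unit maps at cost `c`. -/
def CostLE (U : Set R2) (A a : R2 → ℂ) (c : ℝ) : Prop :=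
  ∀ ε : ℝ, 0 < ε → ∃ A' : R2 → ℂ, ContDiffOn ℝ 1 A' U ∧ (∀ x ∈ U, ‖A' x‖ = 1) ∧
    ∫⁻ x in U, ‖A' x - A x‖ₑ ≤ ENNReal.ofReal ε ∧
    ∫⁻ x in U, ‖jf A' x - a x‖ₑ ≤ ENNReal.ofReal (c + ε)

lemma norm_uv_le (z : ℂ) : ‖uv z‖ ≤ 1 := by
  unfold uv
  by_cases h : z = 0
  · simp [h]
  · rw [norm_div, Complex.norm_real, norm_norm, div_self (norm_ne_zero_iff.2 h)]

lemma norm_uv {z : ℂ} (h : z ≠ 0) : ‖uv z‖ = 1 := by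
  unfold uv
  rw [norm_div, Complex.norm_real, norm_norm, div_self (norm_ne_zero_iff.2 h)]

lemma norm_sg (s : Bool) (z : ℂ) : ‖sg s z‖ = ‖z‖ := by
  unfold sg; cases s <;> simp

lemma sg_eq_zero {s : Bool} {z : ℂ} : sg s z = 0 ↔ z = 0 := by
  rw [← norm_eq_zero, norm_sg, norm_eq_zero]

lemma vx_eq_zero {s : Bool} {p x : R2} : vx s p x = 0 ↔ x = p := by
  unfold vx; rw [sg_eq_zero, sub_eq_zero, cx.injective.eq_iff]

lemma norm_vx (s : Bool) (p x : R2) : ‖vx s p x‖ = ‖x - p‖ := by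
  unfold vx; rw [norm_sg, ← map_sub, LinearIsometryEquiv.norm_map]

lemma uv_mul (z w : ℂ) : uv (z * w) = uv z * uv w := by
  unfold uv; rw [norm_mul]; push_cast; ring

lemma uv_of_norm_one {z : ℂ} (h : ‖z‖ = 1) : uv z = z := by
  unfold uv; rw [h]; simp

lemma abs_sr (s : Bool) : |sr s| = 1 := by cases s <;> simp [sr]

lemma measurable_uv : Measurable uv := by
  unfold uv; fun_prop

lemma continuous_sg (s : Bool) : Continuous (sg s) := by
  unfold sg; cases s
  · simpa using Complex.continuous_conj
  · simpa using continuous_id'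

lemma continuous_vx (s : Bool) (p : R2) : Continuous (vx s p) :=
  (continuous_sg s).comp (cx.continuous.sub continuous_const)

lemma contDiff_sg (s : Bool) {n : WithTop ℕ∞} : ContDiff ℝ n (sg s) := by
  cases s
  · have : sg false = fun z => Complex.conjCLE z := by ext z; simp [sg]
    rw [this]; exact Complex.conjCLE.contDiff
  · have : sg true = fun z => z := by ext z; simp [sg]
    rw [this]; exact contDiff_id

lemma contDiff_vx (s : Bool) (p : R2) {n : WithTop ℕ∞} : ContDiff ℝ n (vx s p) :=
  (contDiff_sg s).comp (cx.contDiff.sub contDiff_const)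

lemma measurable_jv (p : R2) : Measurable (jv p) := by
  unfold jv
  have h : Measurable (fun x : R2 => cx x - cx p) := (cx.continuous.sub continuous_const).measurable
  have h2 : Measurable (fun x : R2 => (starRingEnd ℂ) (cx x - cx p)) :=
    (Complex.continuous_conj.measurable).comp h
  exact measurable_const.div h2

lemma norm_jv (p x : R2) : ‖jv p x‖ = ‖x - p‖⁻¹ := by
  unfold jv
  rw [norm_div, Complex.norm_I, RCLike.norm_conj, ← map_sub, LinearIsometryEquiv.norm_map, one_div]

lemma measurable_mk {α : Type*} [MeasurableSpace α] {f g : α → ℝ} (hf : Measurable f)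
    (hg : Measurable g) : Measurable (fun x => (⟨f x, g x⟩ : ℂ)) := by
  have : (fun x => (⟨f x, g x⟩ : ℂ)) = fun x => (f x : ℂ) + (g x : ℂ) * Complex.I := by
    ext x; exact Complex.mk_eq_add_mul_I _ _
  rw [this]; fun_prop

lemma aemeasurable_mk {α : Type*} [MeasurableSpace α] {μ : Measure α} {f g : α → ℝ}
    (hf : AEMeasurable f μ)
    (hg : AEMeasurable g μ) : AEMeasurable (fun x => (⟨f x, g x⟩ : ℂ)) μ := by
  have : (fun x => (⟨f x, g x⟩ : ℂ)) = fun x => (f x : ℂ) + (g x : ℂ) * Complex.I := by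
    ext x; exact Complex.mk_eq_add_mul_I _ _
  rw [this]; fun_prop

lemma aemeasurable_jf {A : R2 → ℂ} {μ : Measure R2} (hA : AEMeasurable A μ) :
    AEMeasurable (jf A) μ := by
  unfold jf
  have h (j : Fin 2) : Measurable (fun x => fderiv ℝ A x (ee j)) :=
    measurable_fderiv_apply_const ℝ A (ee j)
  apply aemeasurable_mk
  · exact Complex.measurable_im.comp_aemeasurable ((h 0).aemeasurable.div hA)
  · exact Complex.measurable_im.comp_aemeasurable ((h 1).aemeasurable.div hA)

lemma jf_mul {A B : R2 → ℂ} {x : R2} (hA : DifferentiableAt ℝ A x) (hB : DifferentiableAt ℝ B x)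
    (h0 : A x ≠ 0) (h1 : B x ≠ 0) : jf (fun y => A y * B y) x = jf A x + jf B x := by
  have key (v : R2) : fderiv ℝ (fun y => A y * B y) x v / (A x * B x) =
      fderiv ℝ A x v / A x + fderiv ℝ B x v / B x := by
    rw [fderiv_fun_mul hA hB]
    simp only [add_apply, smul_apply, smul_eq_mul]
    field_simp
    ring
  unfold jf
  apply Complex.ext <;> simp only [key, Complex.add_im, Complex.add_re]

lemma jf_congr {A B : R2 → ℂ} {x : R2} (h : A =ᶠ[𝓝 x] B) : jf A x = jf B x := by
  unfold jf; rw [h.fderiv_eq, h.eq_of_nhds]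

lemma hasFDerivAt_vx_true (p x : R2) :
    HasFDerivAt (vx true p) (cx.toContinuousLinearEquiv : R2 →L[ℝ] ℂ) x := by
  have : vx true p = fun x => cx x - cx p := by ext x; simp [vx, sg]
  rw [this]
  exact (cx.toContinuousLinearEquiv.hasFDerivAt).sub_const _

lemma hasFDerivAt_vx_false (p x : R2) :
    HasFDerivAt (vx false p) ((Complex.conjCLE : ℂ →L[ℝ] ℂ).comp
      (cx.toContinuousLinearEquiv : R2 →L[ℝ] ℂ)) x := by
  have : vx false p = fun x => Complex.conjCLE (vx true p x) := by ext x; simp [vx, sg]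
  rw [this]
  exact Complex.conjCLE.hasFDerivAt.comp x (hasFDerivAt_vx_true p x)

lemma jf_vx (s : Bool) (p x : R2) : jf (vx s p) x = sr s * jv p x := by
  unfold jf jv
  cases s
  · rw [(hasFDerivAt_vx_false p x).fderiv]
    simp only [vx, sg, sr]
    apply Complex.ext <;>
    simp [cx_ee0, cx_ee1, Complex.div_re, Complex.div_im, Complex.normSq_apply] <;> ring
  · rw [(hasFDerivAt_vx_true p x).fderiv]
    simp only [vx, sg, sr]
    apply Complex.ext <;>
    simp [cx_ee0, cx_ee1, Complex.div_re, Complex.div_im, Complex.normSq_apply] <;> ring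

/-- multiplying by a positive real function does not change the current -/
lemma jf_uv {A : R2 → ℂ} {x : R2} (hA : ContDiffAt ℝ 1 A x) (h0 : A x ≠ 0) :
    jf (fun y => uv (A y)) x = jf A x := by
  have hd : DifferentiableAt ℝ A x := hA.differentiableAt (by norm_num)
  have hn : DifferentiableAt ℝ (fun y => ((‖A y‖⁻¹ : ℝ) : ℂ)) x := by
    have h1 : DifferentiableAt ℝ (fun y => ‖A y‖⁻¹) x :=
      (hd.norm ℝ h0).inv (norm_ne_zero_iff.2 h0)
    exact (Complex.ofRealCLM.differentiableAt).comp x h1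
  have hz : jf (fun y => ((‖A y‖⁻¹ : ℝ) : ℂ)) x = 0 := by
    have h1 : DifferentiableAt ℝ (fun y => ‖A y‖⁻¹) x :=
      (hd.norm ℝ h0).inv (norm_ne_zero_iff.2 h0)
    have h2 : HasFDerivAt (fun y => ((‖A y‖⁻¹ : ℝ) : ℂ)) (Complex.ofRealCLM.comp
      (fderiv ℝ (fun y => ‖A y‖⁻¹) x)) x := Complex.ofRealCLM.hasFDerivAt.comp x h1.hasFDerivAt
    unfold jf
    rw [h2.fderiv]
    apply Complex.ext
    · simp only [ContinuousLinearMap.comp_apply, Complex.ofRealCLM_apply]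
      rw [← Complex.ofReal_div, Complex.ofReal_im]; rfl
    · simp only [ContinuousLinearMap.comp_apply, Complex.ofRealCLM_apply]
      rw [← Complex.ofReal_div, Complex.ofReal_im]; rfl
  have he : (fun y => uv (A y)) = fun y => A y * ((‖A y‖⁻¹ : ℝ) : ℂ) := by
    ext y; unfold uv; push_cast; rw [div_eq_mul_inv]
  rw [he, jf_mul hd hn h0, hz, add_zero]
  exact_mod_cast inv_ne_zero (norm_ne_zero_iff.2 h0)

lemma contDiffAt_uv {A : R2 → ℂ} {x : R2} {n : WithTop ℕ∞} (hA : ContDiffAt ℝ n A x) (h0 : A x ≠ 0) :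
    ContDiffAt ℝ n (fun y => uv (A y)) x := by
  have he : (fun y => uv (A y)) = fun y => A y * ((‖A y‖⁻¹ : ℝ) : ℂ) := by
    ext y; unfold uv; push_cast; rw [div_eq_mul_inv]
  rw [he]
  have h1 : ContDiffAt ℝ n (fun y => ‖A y‖⁻¹) x := (hA.norm ℝ h0).inv (norm_ne_zero_iff.2 h0)
  exact hA.mul (Complex.ofRealCLM.contDiff.contDiffAt.comp x h1)


/-! ### Radial integrals -/

lemma vol_ball_one : (volume : Measure R2).real (ball 0 1) = Real.pi := by
  rw [Measure.real, EuclideanSpace.volume_ball]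
  simp [Real.sq_sqrt Real.pi_pos.le]
  rw [one_add_one_eq_two, Real.Gamma_two, div_one, ENNReal.toReal_ofReal Real.pi_pos.le]

lemma lint_inv_ball (p : R2) {ρ : ℝ} (hρ : 0 < ρ) :
    ∫⁻ x in ball p ρ, ENNReal.ofReal (‖x - p‖⁻¹) = ENNReal.ofReal (2 * Real.pi * ρ) := by
  have htr : ∫⁻ x in ball p ρ, ENNReal.ofReal (‖x - p‖⁻¹) =
      ∫⁻ x in ball (0 : R2) ρ, ENNReal.ofReal (‖x‖⁻¹) := by
    rw [← lintegral_indicator measurableSet_ball, ← lintegral_indicator measurableSet_ball]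
    refine Eq.trans ?_ (lintegral_sub_right_eq_self _ p)
    apply lintegral_congr
    intro x
    simp only [indicator, mem_ball, dist_eq_norm, sub_zero]
  have hIntg : IntegrableOn (fun x : R2 => (fun r : ℝ => r⁻¹) ‖x‖) (ball (0 : R2) ρ) volume := by
    rw [integrableOn_fun_norm_addHaar]
    have : IntegrableOn (fun _ : ℝ => (1 : ℝ)) (Ioo 0 ρ) := by
      apply integrableOn_const; simp; simp
    refine this.congr_fun ?_ measurableSet_Ioo
    intro y hy
    simp [finrank_euclideanSpace, mul_inv_cancel₀ hy.1.ne']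
  rw [htr, ← ofReal_integral_eq_lintegral_ofReal hIntg
    (Eventually.of_forall fun x => inv_nonneg.2 (norm_nonneg x))]
  congr 1
  have h1 : ∫ x in ball (0 : R2) ρ, ‖x‖⁻¹ =
      ∫ x : R2, (fun r : ℝ => (Iio ρ).indicator (fun r => r⁻¹) r) ‖x‖ := by
    rw [← integral_indicator measurableSet_ball]
    apply integral_congr_ae
    filter_upwards with x
    simp [indicator]
  have h2 : ∀ y ∈ Ioi (0 : ℝ), y ^ (2 - 1) • (Iio ρ).indicator (fun r => r⁻¹) y =
      (Ioo 0 ρ).indicator (fun _ => (1 : ℝ)) y := by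
    intro y hy
    have hy' : (0 : ℝ) < y := hy
    by_cases h : y < ρ <;> simp [h, hy', hy'.ne']
  rw [show (∫ x in ball (0 : R2) ρ, (fun r : ℝ => r⁻¹) ‖x‖) = _ from h1, integral_fun_norm_addHaar,
    vol_ball_one, finrank_euclideanSpace, Fintype.card_fin,
    setIntegral_congr_fun measurableSet_Ioi h2, integral_indicator measurableSet_Ioo,
    Measure.restrict_restrict measurableSet_Ioo, inter_eq_left.2 (fun x hx => hx.1)]
  simp [max_eq_left hρ.le]
  ring

lemma lint_inv_lt_top (p : R2) {U : Set R2} (hU : Bornology.IsBounded U) :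
    ∫⁻ x in U, ENNReal.ofReal (‖x - p‖⁻¹) < ∞ := by
  obtain ⟨R, hR⟩ := hU.subset_ball p
  calc ∫⁻ x in U, ENNReal.ofReal (‖x - p‖⁻¹) ≤ ∫⁻ x in ball p (max R 1), ENNReal.ofReal (‖x - p‖⁻¹) :=
        lintegral_mono_set (hR.trans (ball_subset_ball (le_max_left _ _)))
    _ < ∞ := by rw [lint_inv_ball p (by positivity)]; exact ENNReal.ofReal_lt_top

/-! ### The standard dipole -/

/-- `r = √(y²+ε²)` -/
def rr (ε y : ℝ) : ℝ := Real.sqrt (y ^ 2 + ε ^ 2)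

/-- angular aperture -/
def Aa (ε d t y : ℝ) : ℝ := Real.arctan ((d - t) / rr ε y) + Real.arctan (t / rr ε y)

/-- regularized phase -/
def Th (ε d t y : ℝ) : ℝ := y / rr ε y * Aa ε d t y

lemma rr_pos {ε : ℝ} (hε : 0 < ε) (y : ℝ) : 0 < rr ε y := Real.sqrt_pos.2 (by positivity)

lemma rr_sq {ε : ℝ} (y : ℝ) : rr ε y ^ 2 = y ^ 2 + ε ^ 2 := Real.sq_sqrt (by positivity)

lemma Aa_nonneg {ε d : ℝ} (hε : 0 < ε) (hd : 0 < d) (t y : ℝ) : 0 ≤ Aa ε d t y := by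
  have hr := rr_pos hε y
  unfold Aa
  have : Real.arctan (-(t / rr ε y)) ≤ Real.arctan ((d - t) / rr ε y) := by
    apply Real.arctan_mono
    rw [← neg_div]
    gcongr
    linarith
  rw [Real.arctan_neg] at this
  linarith

lemma Aa_le_pi (ε d t y : ℝ) : Aa ε d t y ≤ Real.pi := by
  unfold Aa
  linarith [Real.arctan_lt_pi_div_two ((d - t) / rr ε y), Real.arctan_lt_pi_div_two (t / rr ε y)]

/-- decay of the aperture away from the segment -/
lemma Aa_le_far {ε d τ : ℝ} (hε : 0 < ε) (hd : 0 < d) (hτ : 0 < τ) (t y : ℝ)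
    (ht : t ≤ -τ ∨ d + τ ≤ t) : Aa ε d t y ≤ d * rr ε y / τ ^ 2 := by
  have hr := rr_pos hε y
  have hneg : (d - t) * t ≤ - τ ^ 2 := by
    rcases ht with h | h <;> nlinarith
  have hprod : (d - t) / rr ε y * (t / rr ε y) < 1 := by
    have : (d - t) / rr ε y * (t / rr ε y) ≤ 0 := by
      rw [div_mul_div_comm]
      apply div_nonpos_of_nonpos_of_nonneg <;> nlinarith
    linarith
  unfold Aa
  rw [Real.arctan_add hprod]
  have h0 : ∀ s : ℝ, 0 ≤ s → Real.arctan s ≤ s := by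
    intro s hs
    have := Real.le_tan (Real.arctan_nonneg.2 hs) (Real.arctan_lt_pi_div_two s)
    rwa [Real.tan_arctan] at this
  have e : ((d - t) / rr ε y + t / rr ε y) / (1 - (d - t) / rr ε y * (t / rr ε y)) =
      d * rr ε y / (rr ε y ^ 2 - (d - t) * t) := by
    have h1 : rr ε y ^ 2 - (d - t) * t ≠ 0 := by nlinarith
    have h2 : 1 - (d - t) / rr ε y * (t / rr ε y) ≠ 0 := by linarith
    field_simp
    ring
  rw [e]
  have hden : τ ^ 2 ≤ rr ε y ^ 2 - (d - t) * t := by nlinarith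
  refine (h0 _ ?_).trans ?_
  · apply div_nonneg (by positivity); nlinarith
  · gcongr

lemma hasDerivAt_rr {ε : ℝ} (hε : 0 < ε) (y : ℝ) : HasDerivAt (rr ε) (y / rr ε y) y := by
  unfold rr
  have h : HasDerivAt (fun y : ℝ => y ^ 2 + ε ^ 2) (2 * y) y := by
    simpa using (hasDerivAt_pow 2 y).add_const (ε ^ 2)
  convert! h.sqrt (by positivity) using 1
  rw [mul_div_mul_left _ _ two_ne_zero]

lemma hasDerivAt_y_div_rr {ε : ℝ} (hε : 0 < ε) (y : ℝ) :
    HasDerivAt (fun y => y / rr ε y) (ε ^ 2 / rr ε y ^ 3) y := by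
  have hr := rr_pos hε y
  convert! (hasDerivAt_id y).div (hasDerivAt_rr hε y) hr.ne' using 1
  have := rr_sq (ε := ε) y
  simp only [id]
  field_simp
  linarith

/-- the singular part of the gradient of the phase -/
def Ss (ε d t y : ℝ) : ℝ := ε ^ 2 / rr ε y ^ 3 * Aa ε d t y

/-- tangential derivative -/
def F1 (ε d t y : ℝ) : ℝ := y * (1 / (rr ε y ^ 2 + t ^ 2) - 1 / (rr ε y ^ 2 + (d - t) ^ 2))

/-- regular part of the normal derivative -/
def F2 (ε d t y : ℝ) : ℝ := y ^ 2 / rr ε y ^ 2 *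
  (-(d - t) / (rr ε y ^ 2 + (d - t) ^ 2) - t / (rr ε y ^ 2 + t ^ 2))

lemma hasFDerivAt_Th {ε d : ℝ} (hε : 0 < ε) {T Y : R2 → ℝ} {T' Y' : R2 →L[ℝ] ℝ} {x : R2}
    (hT : HasFDerivAt T T' x) (hY : HasFDerivAt Y Y' x) :
    HasFDerivAt (fun x => Th ε d (T x) (Y x))
      (F1 ε d (T x) (Y x) • T' + (F2 ε d (T x) (Y x) + Ss ε d (T x) (Y x)) • Y') x := by
  have hr := rr_pos hε (Y x)
  have hrr : HasFDerivAt (fun x => rr ε (Y x)) ((Y x / rr ε (Y x)) • Y') x :=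
    (hasDerivAt_rr hε (Y x)).comp_hasFDerivAt x hY
  have hyr : HasFDerivAt (fun x => Y x / rr ε (Y x)) ((ε ^ 2 / rr ε (Y x) ^ 3) • Y') x :=
    (hasDerivAt_y_div_rr hε (Y x)).comp_hasFDerivAt x hY
  have hinv : HasFDerivAt (fun x => (rr ε (Y x))⁻¹) (-((rr ε (Y x) ^ 2)⁻¹) • ((Y x / rr ε (Y x)) • Y')) x :=
    (hasDerivAt_inv hr.ne').comp_hasFDerivAt x hrr
  have h1 : HasFDerivAt (fun x => Real.arctan ((d - T x) * (rr ε (Y x))⁻¹)) _ x :=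
    ((hT.const_sub d).mul hinv).arctan
  have h2 : HasFDerivAt (fun x => Real.arctan (T x * (rr ε (Y x))⁻¹)) _ x :=
    (hT.mul hinv).arctan
  have h3 := hyr.mul (h1.add h2)
  have he : (fun x => Th ε d (T x) (Y x)) = ((fun x => Y x / rr ε (Y x)) *
    ((fun x => Real.arctan ((d - T x) * (rr ε (Y x))⁻¹)) +
      fun x => Real.arctan (T x * (rr ε (Y x))⁻¹))) := by
    ext x; simp [Th, Aa, div_eq_mul_inv]
  rw [he]
  refine h3.congr_fderiv ?_
  ext v
  simp only [add_apply, smul_apply, smul_eq_mul, neg_apply, Pi.add_apply, Pi.mul_apply]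
  have e1 : (d - T x) * (rr ε (Y x))⁻¹ = (d - T x) / rr ε (Y x) := by rw [div_eq_mul_inv]
  have e2 : (T x) * (rr ε (Y x))⁻¹ = (T x) / rr ε (Y x) := by rw [div_eq_mul_inv]
  unfold F1 F2 Ss Aa
  rw [e1, e2]
  generalize Real.arctan ((d - T x) / rr ε (Y x)) = a1
  generalize Real.arctan (T x / rr ε (Y x)) = a2
  generalize rr ε (Y x) = r at *
  have hq1 : r ^ 2 + (d - T x) ^ 2 ≠ 0 := by positivity
  have hq2 : r ^ 2 + T x ^ 2 ≠ 0 := by positivity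
  field_simp
  ring

lemma contDiff_Th {ε d : ℝ} (hε : 0 < ε) {T Y : R2 → ℝ} {n : WithTop ℕ∞} (hT : ContDiff ℝ n T)
    (hY : ContDiff ℝ n Y) : ContDiff ℝ n (fun x => Th ε d (T x) (Y x)) := by
  have h1 : ContDiff ℝ n (fun x => rr ε (Y x)) := by
    unfold rr
    apply ContDiff.sqrt
    · fun_prop
    · intro x; positivity
  have hne : ∀ x, rr ε (Y x) ≠ 0 := fun x => (rr_pos hε _).ne'
  unfold Th Aa
  refine (hY.div h1 hne).mul (ContDiff.add ?_ ?_)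
  · exact Real.contDiff_arctan.comp ((contDiff_const.sub hT).div h1 hne)
  · exact Real.contDiff_arctan.comp (hT.div h1 hne)

/-- the mass of the singular part on a box -/
lemma lint_Ss {ε d τ R : ℝ} (hε : 0 < ε) (hd : 0 < d) (hτ : 0 < τ) (hR : 0 < R) :
    ∫⁻ z in (Icc (-R) R ×ˢ Icc (-R) R : Set (ℝ × ℝ)), ENNReal.ofReal (Ss ε d z.1 z.2) ≤
      ENNReal.ofReal (2 * Real.pi * (d + 2 * τ) + 2 * R * (d * Real.pi * ε / τ ^ 2)) := by
  have hrc : Continuous (rr ε) := by unfold rr; fun_prop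
  have hrne : ∀ y, rr ε y ≠ 0 := fun y => (rr_pos hε y).ne'
  have hAc : Continuous (fun z : ℝ × ℝ => Aa ε d z.1 z.2) := by
    unfold Aa
    refine Continuous.add ?_ ?_
    · exact Real.continuous_arctan.comp ((by fun_prop : Continuous fun z : ℝ × ℝ => d - z.1).div
        (hrc.comp continuous_snd) (fun z => hrne _))
    · exact Real.continuous_arctan.comp (continuous_fst.div
        (hrc.comp continuous_snd) (fun z => hrne _))
  have hSc : Continuous (fun z : ℝ × ℝ => Ss ε d z.1 z.2) := by
    unfold Ss
    refine Continuous.mul ?_ hAc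
    exact continuous_const.div ((hrc.comp continuous_snd).pow 3) (fun z => pow_ne_zero _ (hrne _))
  have hI3 : ∫⁻ y in Icc (-R) R, ENNReal.ofReal (ε ^ 2 / rr ε y ^ 3) ≤ ENNReal.ofReal 2 := by
    have hc : Continuous (fun y => ε ^ 2 / rr ε y ^ 3) :=
      continuous_const.div (hrc.pow 3) (fun z => pow_ne_zero _ (hrne _))
    rw [← ofReal_integral_eq_lintegral_ofReal (hc.integrableOn_Icc)
      (Eventually.of_forall fun y => by have := rr_pos hε y; positivity), integral_Icc_eq_integral_Ioc,
      ← intervalIntegral.integral_of_le (by linarith),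
      intervalIntegral.integral_eq_sub_of_hasDerivAt (f := fun y => y / rr ε y)
        (fun y _ => hasDerivAt_y_div_rr hε y) (hc.intervalIntegrable _ _)]
    apply ENNReal.ofReal_le_ofReal
    have h : ∀ y, |y / rr ε y| ≤ 1 := by
      intro y
      rw [abs_div, abs_of_pos (rr_pos hε y), div_le_one (rr_pos hε y)]
      apply Real.abs_le_sqrt
      nlinarith [sq_nonneg ε]
    have h1 := (abs_le.1 (h R)).2
    have h2 := (abs_le.1 (h (-R))).1
    linarith
  have hI2 : ∫⁻ y in Icc (-R) R, ENNReal.ofReal (ε ^ 2 / rr ε y ^ 2) ≤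
      ENNReal.ofReal (Real.pi * ε) := by
    have hc : Continuous (fun y => ε ^ 2 / rr ε y ^ 2) :=
      continuous_const.div (hrc.pow 2) (fun z => pow_ne_zero _ (hrne _))
    have hder : ∀ y : ℝ, HasDerivAt (fun y => ε * Real.arctan (y / ε)) (ε ^ 2 / rr ε y ^ 2) y := by
      intro y
      convert! ((((hasDerivAt_id y).div_const ε).arctan).const_mul ε) using 1
      rw [rr_sq]
      simp only [id]
      field_simp
      ring
    rw [← ofReal_integral_eq_lintegral_ofReal (hc.integrableOn_Icc)
      (Eventually.of_forall fun y => by have := rr_pos hε y; positivity), integral_Icc_eq_integral_Ioc,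
      ← intervalIntegral.integral_of_le (by linarith),
      intervalIntegral.integral_eq_sub_of_hasDerivAt (f := fun y => ε * Real.arctan (y / ε))
        (fun y _ => hder y) (hc.intervalIntegrable _ _)]
    apply ENNReal.ofReal_le_ofReal
    have h1 := Real.arctan_lt_pi_div_two (R / ε)
    have h2 := Real.neg_pi_div_two_lt_arctan (-R / ε)
    nlinarith
  rw [Measure.volume_eq_prod, ← Measure.prod_restrict, lintegral_prod _
    (hSc.measurable.ennreal_ofReal.aemeasurable)]
  have hin : ∀ t : ℝ, ∫⁻ y in Icc (-R) R, ENNReal.ofReal (Ss ε d t y) ≤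
      (Icc (-τ) (d + τ)).indicator (fun _ => ENNReal.ofReal (2 * Real.pi)) t +
        ENNReal.ofReal (d * Real.pi * ε / τ ^ 2) := by
    intro t
    by_cases ht : t ∈ Icc (-τ) (d + τ)
    · rw [indicator_of_mem ht]
      refine le_add_right ?_
      calc ∫⁻ y in Icc (-R) R, ENNReal.ofReal (Ss ε d t y)
          ≤ ∫⁻ y in Icc (-R) R, ENNReal.ofReal (ε ^ 2 / rr ε y ^ 3) * ENNReal.ofReal Real.pi := by
            apply lintegral_mono
            intro y
            have := rr_pos hε y
            dsimp only
            rw [← ENNReal.ofReal_mul (by positivity)]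
            apply ENNReal.ofReal_le_ofReal
            unfold Ss
            gcongr
            exact Aa_le_pi _ _ _ _
        _ = (∫⁻ y in Icc (-R) R, ENNReal.ofReal (ε ^ 2 / rr ε y ^ 3)) * ENNReal.ofReal Real.pi :=
            lintegral_mul_const' _ _ ENNReal.ofReal_ne_top
        _ ≤ ENNReal.ofReal 2 * ENNReal.ofReal Real.pi := by gcongr
        _ = _ := by rw [← ENNReal.ofReal_mul (by norm_num)]
    · rw [indicator_of_notMem ht, zero_add]
      have ht' : t ≤ -τ ∨ d + τ ≤ t := by
        by_contra hcon
        push Not at hcon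
        exact ht ⟨hcon.1.le, hcon.2.le⟩
      calc ∫⁻ y in Icc (-R) R, ENNReal.ofReal (Ss ε d t y)
          ≤ ∫⁻ y in Icc (-R) R, ENNReal.ofReal (ε ^ 2 / rr ε y ^ 2) * ENNReal.ofReal (d / τ ^ 2) := by
            apply lintegral_mono
            intro y
            have hr := rr_pos hε y
            dsimp only
            rw [← ENNReal.ofReal_mul (by positivity)]
            apply ENNReal.ofReal_le_ofReal
            unfold Ss
            have := Aa_le_far hε hd hτ t y ht'
            calc ε ^ 2 / rr ε y ^ 3 * Aa ε d t y ≤ ε ^ 2 / rr ε y ^ 3 * (d * rr ε y / τ ^ 2) := by gcongr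
              _ = _ := by field_simp
        _ = (∫⁻ y in Icc (-R) R, ENNReal.ofReal (ε ^ 2 / rr ε y ^ 2)) * ENNReal.ofReal (d / τ ^ 2) :=
            lintegral_mul_const' _ _ ENNReal.ofReal_ne_top
        _ ≤ ENNReal.ofReal (Real.pi * ε) * ENNReal.ofReal (d / τ ^ 2) := by gcongr
        _ = _ := by rw [← ENNReal.ofReal_mul (by positivity)]; congr 1; ring
  calc _ ≤ ∫⁻ t in Icc (-R) R, ((Icc (-τ) (d + τ)).indicator (fun _ => ENNReal.ofReal (2 * Real.pi)) t +
        ENNReal.ofReal (d * Real.pi * ε / τ ^ 2)) := lintegral_mono fun t => hin t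
    _ = (∫⁻ t in Icc (-R) R, (Icc (-τ) (d + τ)).indicator (fun _ => ENNReal.ofReal (2 * Real.pi)) t) +
        ENNReal.ofReal (d * Real.pi * ε / τ ^ 2) * ENNReal.ofReal (2 * R) := by
        rw [lintegral_add_right _ measurable_const, setLIntegral_const, Real.volume_Icc]
        congr 3; ring
    _ ≤ (∫⁻ t, (Icc (-τ) (d + τ)).indicator (fun _ => ENNReal.ofReal (2 * Real.pi)) t) +
        ENNReal.ofReal (d * Real.pi * ε / τ ^ 2) * ENNReal.ofReal (2 * R) := by
        gcongr
        exact Measure.restrict_le_self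
    _ = _ := by
        rw [lintegral_indicator measurableSet_Icc, setLIntegral_const, Real.volume_Icc,
          ← ENNReal.ofReal_mul (by positivity), ← ENNReal.ofReal_mul (by positivity),
          ← ENNReal.ofReal_add]
        · congr 1; ring
        · have := Real.pi_pos; nlinarith [mul_pos this hτ, mul_pos this hd]
        · positivity


/-! ### The dipole -/

lemma exp_arctan (s : ℝ) : Complex.exp (Real.arctan s * Complex.I) = uv (1 + s * Complex.I) := by
  have hn : ‖(1 + s * Complex.I : ℂ)‖ = Real.sqrt (1 + s ^ 2) := by
    have := Complex.norm_add_mul_I 1 s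
    simpa using this
  rw [Complex.exp_mul_I, ← Complex.ofReal_cos, ← Complex.ofReal_sin, Real.cos_arctan,
    Real.sin_arctan, uv, hn]
  push_cast
  ring

lemma uv_real_mul {c : ℝ} (hc : 0 < c) (z : ℂ) : uv (c * z) = uv z := by
  unfold uv
  rw [norm_mul, Complex.norm_real, Real.norm_of_nonneg hc.le]
  push_cast
  rw [mul_div_mul_left]
  exact_mod_cast hc.ne'

lemma rr_zero (y : ℝ) : rr 0 y = |y| := by
  unfold rr; rw [zero_pow two_ne_zero, add_zero, Real.sqrt_sq_eq_abs]

lemma Th_zero {d t y : ℝ} (hy : y ≠ 0) :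
    Th 0 d t y = Real.arctan ((d - t) / y) + Real.arctan (t / y) := by
  unfold Th Aa
  rw [rr_zero]
  rcases lt_or_gt_of_ne hy with h | h
  · rw [abs_of_neg h, div_neg, div_neg, div_neg, Real.arctan_neg, Real.arctan_neg, div_self hy]
    ring
  · rw [abs_of_pos h, div_self hy, one_mul]

lemma exp_Th_zero {d : ℝ} {z : ℂ} (hy : z.im ≠ 0) :
    Complex.exp (Th 0 d z.re z.im * Complex.I) = uv ((z - d) * (starRingEnd ℂ) z) := by
  rw [Th_zero hy, Complex.ofReal_add]
  rw [add_mul, Complex.exp_add, exp_arctan, exp_arctan, ← uv_mul]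
  rw [← uv_real_mul (c := z.im ^ 2) (by positivity)]
  congr 1
  have hy' : (z.im : ℂ) ≠ 0 := by exact_mod_cast hy
  push_cast
  have hzc : (starRingEnd ℂ) z = z.re - z.im * Complex.I := by
    apply Complex.ext <;> simp
  have hzd : z - d = (z.re - d) + z.im * Complex.I := by
    apply Complex.ext <;> simp
  rw [hzc, hzd]
  field_simp
  ring_nf
  simp only [Complex.I_sq]
  ring

lemma I_div_conj (w : ℂ) : Complex.I / (starRingEnd ℂ) w =
    ⟨-w.im / Complex.normSq w, w.re / Complex.normSq w⟩ := by
  apply Complex.ext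
  · rw [Complex.div_re, Complex.normSq_conj]; simp
  · rw [Complex.div_im, Complex.normSq_conj]; simp

lemma F_zero (d : ℝ) (z : ℂ) (hy : z.im ≠ 0) :
    ((F1 0 d z.re z.im : ℝ) : ℂ) + Complex.I * (F2 0 d z.re z.im : ℝ) =
      Complex.I / (starRingEnd ℂ) (z - d) - Complex.I / (starRingEnd ℂ) z := by
  have h1 : z.im ^ 2 + z.re ^ 2 ≠ 0 := by positivity
  have h2 : z.im ^ 2 + (d - z.re) ^ 2 ≠ 0 := by positivity
  have e1 : Complex.normSq z = z.im ^ 2 + z.re ^ 2 := by rw [Complex.normSq_apply]; ring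
  have e2 : Complex.normSq (z - d) = z.im ^ 2 + (d - z.re) ^ 2 := by
    rw [Complex.normSq_apply]; simp; ring
  have f1 : F1 0 d z.re z.im = z.im / (z.im ^ 2 + z.re ^ 2) - z.im / (z.im ^ 2 + (d - z.re) ^ 2) := by
    unfold F1; rw [rr_zero, sq_abs]; ring
  have f2 : F2 0 d z.re z.im = (z.re - d) / (z.im ^ 2 + (d - z.re) ^ 2) -
      z.re / (z.im ^ 2 + z.re ^ 2) := by
    unfold F2; rw [rr_zero, sq_abs, div_self (pow_ne_zero 2 hy)]; ring
  rw [I_div_conj, I_div_conj, e1, e2]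
  apply Complex.ext
  · rw [Complex.add_re, Complex.ofReal_re, Complex.re_mul_ofReal, f1]
    simp
    ring
  · rw [Complex.add_im, Complex.ofReal_im, Complex.im_mul_ofReal, f2]
    simp

lemma F_bound {ε d : ℝ} (z : ℂ) :
    ‖((F1 ε d z.re z.im : ℝ) : ℂ) + Complex.I * (F2 ε d z.re z.im : ℝ)‖ ≤
      2 * (‖z‖⁻¹ + ‖z - d‖⁻¹) := by
  have hr := rr_sq (ε := ε) z.im
  have n1 : ‖z‖ ^ 2 = z.im ^ 2 + z.re ^ 2 := by
    rw [← Complex.normSq_eq_norm_sq, Complex.normSq_apply]; ring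
  have n2 : ‖z - d‖ ^ 2 = z.im ^ 2 + (d - z.re) ^ 2 := by
    rw [← Complex.normSq_eq_norm_sq, Complex.normSq_apply]; simp; ring
  have key : ∀ a b n R : ℝ, 0 ≤ n → n ^ 2 ≤ R → |a| ≤ n → |a / R| ≤ n⁻¹ := by
    intro a b n R hn hR ha
    rw [abs_div]
    rcases hn.eq_or_lt with h | h
    · rw [← h] at ha ⊢
      rw [abs_nonpos_iff.1 ha]; simp
    · have hRp : 0 < R := lt_of_lt_of_le (by positivity) hR
      rw [abs_of_pos hRp, div_le_iff₀ hRp, inv_mul_eq_div, le_div_iff₀ h]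
      nlinarith
  have hy1 : |z.im| ≤ ‖z‖ := Complex.abs_im_le_norm z
  have hx1 : |z.re| ≤ ‖z‖ := Complex.abs_re_le_norm z
  have hy2 : |z.im| ≤ ‖z - d‖ := by simpa using Complex.abs_im_le_norm (z - d)
  have hx2 : |-(d - z.re)| ≤ ‖z - d‖ := by simpa using Complex.abs_re_le_norm (z - d)
  have hR1 : ‖z‖ ^ 2 ≤ rr ε z.im ^ 2 + z.re ^ 2 := by rw [n1, hr]; nlinarith [sq_nonneg ε]
  have hR2 : ‖z - d‖ ^ 2 ≤ rr ε z.im ^ 2 + (d - z.re) ^ 2 := by rw [n2, hr]; nlinarith [sq_nonneg ε]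
  have a1 := key _ 0 _ _ (norm_nonneg z) hR1 hy1
  have a2 := key _ 0 _ _ (norm_nonneg z) hR1 hx1
  have a3 := key _ 0 _ _ (norm_nonneg _) hR2 hy2
  have a4 := key _ 0 _ _ (norm_nonneg _) hR2 hx2
  have b1 : |F1 ε d z.re z.im| ≤ ‖z‖⁻¹ + ‖z - d‖⁻¹ := by
    have : F1 ε d z.re z.im = z.im / (rr ε z.im ^ 2 + z.re ^ 2) -
      z.im / (rr ε z.im ^ 2 + (d - z.re) ^ 2) := by unfold F1; ring
    rw [this]
    exact (abs_sub _ _).trans (add_le_add a1 a3)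
  have b2 : |F2 ε d z.re z.im| ≤ ‖z‖⁻¹ + ‖z - d‖⁻¹ := by
    unfold F2
    rw [abs_mul]
    have h1 : |z.im ^ 2 / rr ε z.im ^ 2| ≤ 1 := by
      rw [abs_of_nonneg (by positivity)]
      apply div_le_one_of_le₀ _ (by positivity)
      rw [hr]; nlinarith [sq_nonneg ε]
    have h2 := (abs_sub _ _).trans (add_le_add a4 a2)
    calc _ ≤ 1 * (‖z - d‖⁻¹ + ‖z‖⁻¹) := by gcongr
      _ = _ := by ring
  calc _ ≤ ‖((F1 ε d z.re z.im : ℝ) : ℂ)‖ + ‖Complex.I * (F2 ε d z.re z.im : ℝ)‖ := norm_add_le _ _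
    _ = |F1 ε d z.re z.im| + |F2 ε d z.re z.im| := by simp
    _ ≤ _ := by linarith

/-! ### The cost of a dipole -/

/-- adapted complex coordinate -/
def zt (p : R2) (e : ℂ) (x : R2) : ℂ := (starRingEnd ℂ) e * (cx x - cx p)

lemma mp_zt (p : R2) {e : ℂ} (he : ‖e‖ = 1) :
    MeasurePreserving (fun x => ((zt p e x).re, (zt p e x).im)) volume volume := by
  have h1 : MeasurePreserving (fun x : R2 => x - p) volume volume :=
    measurePreserving_sub_right volume p
  have h2 : MeasurePreserving (fun x : R2 => cx x) volume volume := cx.measurePreserving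
  have hc : (starRingEnd ℂ) e ∈ Submonoid.unitSphere ℂ := by
    simpa [Submonoid.unitSphere] using he
  have h3 : MeasurePreserving (fun z : ℂ => (starRingEnd ℂ) e * z) volume volume :=
    LinearIsometryEquiv.measurePreserving (rotation ⟨(starRingEnd ℂ) e, hc⟩)
  have h4 := Complex.volume_preserving_equiv_real_prod
  have := h4.comp (h3.comp (h2.comp h1))
  convert! this using 1
  ext x <;> simp [zt, Complex.measurableEquivRealProd]

lemma ae_im_ne_zero : ∀ᵐ z : ℝ × ℝ, z.2 ≠ 0 := by
  rw [ae_iff]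
  have : {z : ℝ × ℝ | ¬ z.2 ≠ 0} = univ ×ˢ {0} := by ext z; simp
  rw [this, Measure.volume_eq_prod, Measure.prod_prod]
  simp

lemma continuous_zt (p : R2) (e : ℂ) : Continuous (zt p e) :=
  continuous_const.mul (cx.continuous.sub continuous_const)

/-- the derivative of the coordinate -/
def ztL (e : ℂ) : R2 →L[ℝ] ℂ :=
  ((ContinuousLinearMap.mul ℝ ℂ) ((starRingEnd ℂ) e)).comp (cx.toContinuousLinearEquiv : R2 →L[ℝ] ℂ)

lemma ztL_apply (e : ℂ) (v : R2) : ztL e v = (starRingEnd ℂ) e * cx v := rfl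

lemma hasFDerivAt_zt (p : R2) (e : ℂ) (x : R2) : HasFDerivAt (zt p e) (ztL e) x := by
  have : zt p e = fun x => ztL e x - (starRingEnd ℂ) e * cx p := by
    ext x; rw [ztL_apply, zt]; ring
  rw [this]
  exact (ztL e).hasFDerivAt.sub_const _

lemma contDiff_zt (p : R2) (e : ℂ) {n : WithTop ℕ∞} : ContDiff ℝ n (zt p e) := by
  have : zt p e = fun x => ztL e x - (starRingEnd ℂ) e * cx p := by
    ext x; rw [ztL_apply, zt]; ring
  rw [this]
  exact (ztL e).contDiff.sub contDiff_const

/-- approximating dipole -/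
def dpA (p : R2) (e : ℂ) (ε d : ℝ) (x : R2) : ℂ :=
  Complex.exp (Th ε d (zt p e x).re (zt p e x).im * Complex.I)

lemma norm_dpA (p : R2) (e : ℂ) (ε d : ℝ) (x : R2) : ‖dpA p e ε d x‖ = 1 :=
  Complex.norm_exp_ofReal_mul_I _

lemma contDiff_dpA (p : R2) (e : ℂ) {ε : ℝ} (hε : 0 < ε) (d : ℝ) : ContDiff ℝ 1 (dpA p e ε d) := by
  unfold dpA
  have h := contDiff_Th (d := d) hε (Complex.reCLM.contDiff.comp (contDiff_zt p e (n := 1)))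
    (Complex.imCLM.contDiff.comp (contDiff_zt p e (n := 1)))
  have h2 : ContDiff ℝ 1 (fun x => ((Th ε d (zt p e x).re (zt p e x).im : ℝ) : ℂ)) :=
    Complex.ofRealCLM.contDiff.comp h
  exact (h2.mul contDiff_const).cexp

lemma jf_dpA (p : R2) {e : ℂ} {ε : ℝ} (hε : 0 < ε) (d : ℝ) (x : R2) :
    jf (dpA p e ε d) x = e * (((F1 ε d (zt p e x).re (zt p e x).im : ℝ) : ℂ) +
      Complex.I * (F2 ε d (zt p e x).re (zt p e x).im : ℝ)) +
      e * (Complex.I * (Ss ε d (zt p e x).re (zt p e x).im : ℝ)) := by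
  have hre : HasFDerivAt (fun x => (zt p e x).re) (Complex.reCLM.comp (ztL e)) x :=
    Complex.reCLM.hasFDerivAt.comp x (hasFDerivAt_zt p e x)
  have him : HasFDerivAt (fun x => (zt p e x).im) (Complex.imCLM.comp (ztL e)) x :=
    Complex.imCLM.hasFDerivAt.comp x (hasFDerivAt_zt p e x)
  have h := hasFDerivAt_Th (d := d) hε hre him
  have h2 : HasFDerivAt (fun x => ((Th ε d (zt p e x).re (zt p e x).im : ℝ) : ℂ)) _ x :=
    Complex.ofRealCLM.hasFDerivAt.comp x h
  have h3 : HasFDerivAt (dpA p e ε d) _ x := (h2.mul_const Complex.I).cexp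
  have key : ∀ v : R2, (fderiv ℝ (dpA p e ε d) x v / dpA p e ε d x).im =
      F1 ε d (zt p e x).re (zt p e x).im * (ztL e v).re +
      (F2 ε d (zt p e x).re (zt p e x).im + Ss ε d (zt p e x).re (zt p e x).im) * (ztL e v).im := by
    intro v
    have hne : dpA p e ε d x ≠ 0 := Complex.exp_ne_zero _
    rw [h3.fderiv, smul_apply, smul_eq_mul, ← dpA, mul_div_cancel_left₀ _ hne]
    simp
  unfold jf
  rw [key, key, ztL_apply, ztL_apply, cx_ee0, cx_ee1]
  apply Complex.ext
  · simp; ring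
  · simp; ring

lemma lint_dp {U : Set R2} {p : R2} {R : ℝ} (hR : 0 < R) (hU : U ⊆ ball p R) {e : ℂ} (he : ‖e‖ = 1)
    {ε d τ : ℝ} (hε : 0 < ε) (hd : 0 < d) (hτ : 0 < τ) :
    ∫⁻ x in U, ‖e * (Complex.I * (Ss ε d (zt p e x).re (zt p e x).im : ℝ))‖ₑ ≤
      ENNReal.ofReal (2 * Real.pi * (d + 2 * τ) + 2 * R * (d * Real.pi * ε / τ ^ 2)) := by
  refine le_trans ?_ (lint_Ss hε hd hτ hR)
  have hrc : Continuous (rr ε) := by unfold rr; fun_prop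
  have hrne : ∀ y, rr ε y ≠ 0 := fun y => (rr_pos hε y).ne'
  have hAc : Continuous (fun z : ℝ × ℝ => Aa ε d z.1 z.2) := by
    unfold Aa
    refine Continuous.add ?_ ?_
    · exact Real.continuous_arctan.comp ((by fun_prop : Continuous fun z : ℝ × ℝ => d - z.1).div
        (hrc.comp continuous_snd) (fun z => hrne _))
    · exact Real.continuous_arctan.comp (continuous_fst.div
        (hrc.comp continuous_snd) (fun z => hrne _))
  have hSc : Continuous (fun z : ℝ × ℝ => Ss ε d z.1 z.2) := by
    unfold Ss
    refine Continuous.mul ?_ hAc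
    exact continuous_const.div ((hrc.comp continuous_snd).pow 3) (fun z => pow_ne_zero _ (hrne _))
  rw [← (mp_zt p he).setLIntegral_comp_preimage (measurableSet_Icc.prod measurableSet_Icc)
    hSc.measurable.ennreal_ofReal]
  refine (lintegral_mono_set (t := (fun x => ((zt p e x).re, (zt p e x).im)) ⁻¹'
    (Icc (-R) R ×ˢ Icc (-R) R)) ?_).trans ?_
  · intro x hx
    have h1 : ‖zt p e x‖ ≤ R := by
      unfold zt
      rw [norm_mul, RCLike.norm_conj, he, one_mul, ← map_sub, LinearIsometryEquiv.norm_map,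
        ← dist_eq_norm]
      exact (mem_ball.1 (hU hx)).le
    exact ⟨abs_le.1 ((Complex.abs_re_le_norm _).trans h1),
      abs_le.1 ((Complex.abs_im_le_norm _).trans h1)⟩
  · apply lintegral_mono
    intro x
    dsimp only
    rw [← ofReal_norm, norm_mul, norm_mul, he, Complex.norm_I, Complex.norm_real, one_mul, one_mul,
      Real.norm_of_nonneg]
    have := rr_pos hε (zt p e x).im
    have := Aa_nonneg hε hd (zt p e x).re (zt p e x).im
    unfold Ss; positivity

lemma zt_eq (p : R2) {e : ℂ} (he : ‖e‖ = 1) (x : R2) : e * zt p e x = cx x - cx p := by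
  unfold zt
  rw [← mul_assoc, Complex.mul_conj, Complex.normSq_eq_norm_sq, he]; simp

lemma e_div_conj {e : ℂ} (he : ‖e‖ = 1) (z : ℂ) :
    Complex.I / (starRingEnd ℂ) (e * z) = e * (Complex.I / (starRingEnd ℂ) z) := by
  have hmul : e * (starRingEnd ℂ) e = 1 := by
    rw [Complex.mul_conj, Complex.normSq_eq_norm_sq, he]; simp
  have hne : (starRingEnd ℂ) e ≠ 0 := right_ne_zero_of_mul_eq_one hmul
  rw [map_mul]
  by_cases hz : (starRingEnd ℂ) z = 0
  · simp [hz]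
  · field_simp
    rw [mul_comm] at hmul
    exact hmul.symm

lemma costLE_dipole_ne {U : Set R2} (hUo : IsOpen U) (hU : Bornology.IsBounded U) {p q : R2}
    (hpq : p ≠ q) :
    CostLE U (fun x => uv (vx true q x) * uv (vx false p x)) (fun x => jv q x - jv p x)
      (2 * Real.pi * dist q p) := by
  intro ε₀ hε₀
  obtain ⟨R₀, hR₀⟩ := hU.subset_ball p
  set R := max R₀ 1 with hRdef
  have hR : 0 < R := by positivity
  have hUR : U ⊆ ball p R := hR₀.trans (ball_subset_ball (le_max_left _ _))
  set d := dist q p with hd_def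
  have hd : 0 < d := dist_pos.2 hpq.symm
  set e : ℂ := (cx q - cx p) / d with he_def
  have hdn : ‖cx q - cx p‖ = d := by
    rw [← map_sub, LinearIsometryEquiv.norm_map, ← dist_eq_norm]
  have he : ‖e‖ = 1 := by
    rw [he_def, norm_div, hdn, Complex.norm_real, Real.norm_of_nonneg hd.le, div_self hd.ne']
  have hed : e * d = cx q - cx p := by
    rw [he_def, div_mul_cancel₀]; exact_mod_cast hd.ne'
  have hzq : ∀ x, e * (zt p e x - d) = cx x - cx q := by
    intro x; rw [mul_sub, zt_eq p he, hed]; ring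
  have hnz : ∀ x, ‖zt p e x‖ = ‖x - p‖ := by
    intro x
    have := congrArg norm (zt_eq p he x)
    rw [norm_mul, he, one_mul, ← map_sub, LinearIsometryEquiv.norm_map] at this
    exact this
  have hnzq : ∀ x, ‖zt p e x - d‖ = ‖x - q‖ := by
    intro x
    have := congrArg norm (hzq x)
    rw [norm_mul, he, one_mul, ← map_sub, LinearIsometryEquiv.norm_map] at this
    exact this
  have hAlim : ∀ x, uv (vx true q x) * uv (vx false p x) =
      uv ((zt p e x - d) * (starRingEnd ℂ) (zt p e x)) := by
    intro x
    rw [← uv_mul]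
    congr 1
    simp only [vx, sg, if_true, Bool.false_eq_true, if_false]
    rw [← hzq x, ← zt_eq p he x, map_mul]
    have hmul : e * (starRingEnd ℂ) e = 1 := by
      rw [Complex.mul_conj, Complex.normSq_eq_norm_sq, he]; simp
    linear_combination (zt p e x - d) * (starRingEnd ℂ) (zt p e x) * hmul
  have hjlim : ∀ x, (zt p e x).im ≠ 0 → jv q x - jv p x =
      e * (((F1 0 d (zt p e x).re (zt p e x).im : ℝ) : ℂ) +
      Complex.I * (F2 0 d (zt p e x).re (zt p e x).im : ℝ)) := by
    intro x hx
    rw [F_zero d _ hx, mul_sub, ← e_div_conj he, ← e_div_conj he, hzq, zt_eq p he]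
    rfl
  have hae : ∀ᵐ x ∂(volume.restrict U), (zt p e x).im ≠ 0 :=
    ae_restrict_of_ae ((mp_zt p he).quasiMeasurePreserving.ae ae_im_ne_zero)
  have hvolU : volume U ≠ ∞ := hU.measure_lt_top.ne
  -- continuity in ε
  have hrrc : Continuous (fun z : ℝ × ℝ => rr z.1 z.2) := by unfold rr; fun_prop
  have hrr0 : ∀ y : ℝ, y ≠ 0 → rr 0 y ≠ 0 := fun y hy => by rw [rr_zero]; exact abs_ne_zero.2 hy
  have hrrt : ∀ y : ℝ, ContinuousAt (fun ε => rr ε y) 0 := fun y =>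
    (hrrc.comp (by fun_prop : Continuous fun ε : ℝ => (ε, y))).continuousAt
  have hThc : ∀ t y : ℝ, y ≠ 0 → ContinuousAt (fun ε => Th ε d t y) 0 := by
    intro t y hy
    unfold Th Aa
    have h0 := hrr0 y hy
    refine (continuousAt_const.div (hrrt y) h0).mul (ContinuousAt.add ?_ ?_)
    · exact Real.continuous_arctan.continuousAt.comp (continuousAt_const.div (hrrt y) h0)
    · exact Real.continuous_arctan.continuousAt.comp (continuousAt_const.div (hrrt y) h0)
  have hpos : ∀ y t : ℝ, y ≠ 0 → rr 0 y ^ 2 + t ^ 2 ≠ 0 := fun y t hy => by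
    rw [rr_zero, sq_abs]; positivity
  have hF1c : ∀ t y : ℝ, y ≠ 0 → ContinuousAt (fun ε => F1 ε d t y) 0 := by
    intro t y hy
    unfold F1
    refine continuousAt_const.mul (ContinuousAt.sub ?_ ?_)
    · exact continuousAt_const.div (((hrrt y).pow 2).add continuousAt_const) (hpos y t hy)
    · exact continuousAt_const.div (((hrrt y).pow 2).add continuousAt_const) (hpos y _ hy)
  have hF2c : ∀ t y : ℝ, y ≠ 0 → ContinuousAt (fun ε => F2 ε d t y) 0 := by
    intro t y hy
    unfold F2
    refine ContinuousAt.mul ?_ (ContinuousAt.sub ?_ ?_)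
    · exact continuousAt_const.div ((hrrt y).pow 2) (pow_ne_zero 2 (hrr0 y hy))
    · exact continuousAt_const.div (((hrrt y).pow 2).add continuousAt_const) (hpos y _ hy)
    · exact continuousAt_const.div (((hrrt y).pow 2).add continuousAt_const) (hpos y _ hy)
  -- measurability
  have hmA : Measurable (fun x => uv (vx true q x) * uv (vx false p x)) :=
    (measurable_uv.comp (continuous_vx _ _).measurable).mul
      (measurable_uv.comp (continuous_vx _ _).measurable)
  have hmj : Measurable (fun x => jv q x - jv p x) := (measurable_jv q).sub (measurable_jv p)
  have hmz : Measurable (zt p e) := (continuous_zt p e).measurable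
  have hmrr : Measurable (fun z : ℝ × ℝ => rr z.1 z.2) := hrrc.measurable
  have hmr : ∀ ε : ℝ, Measurable (fun x => rr ε (zt p e x).im) := fun ε =>
    hmrr.comp (measurable_const.prodMk (Complex.measurable_im.comp hmz))
  have hmF : ∀ ε : ℝ, Measurable (fun x => e * (((F1 ε d (zt p e x).re (zt p e x).im : ℝ) : ℂ) +
      Complex.I * (F2 ε d (zt p e x).re (zt p e x).im : ℝ))) := by
    intro ε
    have hm1 : Measurable fun x => (zt p e x).re := Complex.measurable_re.comp hmz
    have hm2 : Measurable fun x => (zt p e x).im := Complex.measurable_im.comp hmz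
    have hmr := hmr ε
    unfold F1 F2
    fun_prop
  -- the two limits
  have hlim1 : Tendsto (fun ε => ∫⁻ x in U, ‖dpA p e ε d x - uv (vx true q x) * uv (vx false p x)‖ₑ)
      (𝓝[>] 0) (𝓝 0) := by
    have h0 : ∫⁻ x in U, (0 : ℝ≥0∞) = 0 := by simp
    rw [← h0]
    refine tendsto_lintegral_filter_of_dominated_convergence (fun _ => 2) ?_ ?_ ?_ ?_
    · filter_upwards [self_mem_nhdsWithin] with ε hε
      exact ((contDiff_dpA p e hε d).continuous.measurable.sub hmA).enorm
    · refine Eventually.of_forall fun ε => Eventually.of_forall fun x => ?_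
      refine (enorm_sub_le).trans ?_
      rw [← one_add_one_eq_two]
      gcongr
      · rw [← ofReal_norm, norm_dpA]; simp
      · rw [← ofReal_norm, norm_mul]
        apply ENNReal.ofReal_le_one.2
        exact mul_le_one₀ (norm_uv_le _) (norm_nonneg _) (norm_uv_le _)
    · rw [setLIntegral_const]; exact ENNReal.mul_ne_top (by simp) hvolU
    · filter_upwards [hae] with x hx
      have : ContinuousAt (fun ε => dpA p e ε d x) 0 := by
        unfold dpA
        exact Complex.continuous_exp.continuousAt.comp
          ((Complex.continuous_ofReal.continuousAt.comp (hThc _ _ hx)).mul continuousAt_const)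
      have h1 : Tendsto (fun ε => dpA p e ε d x) (𝓝[>] 0)
          (𝓝 (uv (vx true q x) * uv (vx false p x))) := by
        have h2 := this.tendsto
        rw [show dpA p e 0 d x = _ from exp_Th_zero hx, ← hAlim x] at h2
        exact h2.mono_left nhdsWithin_le_nhds
      have h3 := (h1.sub_const (uv (vx true q x) * uv (vx false p x))).enorm
      simpa using h3
  have hlim2 : Tendsto (fun ε => ∫⁻ x in U, ‖e * (((F1 ε d (zt p e x).re (zt p e x).im : ℝ) : ℂ) +
      Complex.I * (F2 ε d (zt p e x).re (zt p e x).im : ℝ)) - (jv q x - jv p x)‖ₑ)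
      (𝓝[>] 0) (𝓝 0) := by
    have h0 : ∫⁻ x in U, (0 : ℝ≥0∞) = 0 := by simp
    rw [← h0]
    refine tendsto_lintegral_filter_of_dominated_convergence
      (fun x => 4 * (ENNReal.ofReal (‖x - p‖⁻¹) + ENNReal.ofReal (‖x - q‖⁻¹))) ?_ ?_ ?_ ?_
    · exact Eventually.of_forall fun ε => ((hmF ε).sub hmj).enorm
    · refine Eventually.of_forall fun ε => ?_
      filter_upwards [hae] with x hx
      rw [hjlim x hx, ← ENNReal.ofReal_add (by positivity) (by positivity),
        show (4 : ℝ≥0∞) = ENNReal.ofReal 4 by simp, ← ENNReal.ofReal_mul (by norm_num), ← ofReal_norm]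
      apply ENNReal.ofReal_le_ofReal
      refine (norm_sub_le _ _).trans ?_
      rw [norm_mul, norm_mul, he, one_mul, one_mul]
      have b1 := F_bound (ε := ε) (d := d) (zt p e x)
      have b2 := F_bound (ε := 0) (d := d) (zt p e x)
      rw [hnz, hnzq] at b1 b2
      linarith
    · rw [lintegral_const_mul _ (by fun_prop), lintegral_add_left (by fun_prop)]
      exact ENNReal.mul_ne_top (by simp)
        (ENNReal.add_ne_top.2 ⟨(lint_inv_lt_top p hU).ne, (lint_inv_lt_top q hU).ne⟩)
    · filter_upwards [hae] with x hx
      rw [hjlim x hx]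
      have h1 : ContinuousAt (fun ε => e * (((F1 ε d (zt p e x).re (zt p e x).im : ℝ) : ℂ) +
          Complex.I * (F2 ε d (zt p e x).re (zt p e x).im : ℝ))) 0 :=
        continuousAt_const.mul
          ((Complex.continuous_ofReal.continuousAt.comp (hF1c _ _ hx)).add
            (continuousAt_const.mul (Complex.continuous_ofReal.continuousAt.comp (hF2c _ _ hx))))
      have h2 := (h1.tendsto.mono_left (nhdsWithin_le_nhds (s := Ioi 0))).sub_const
        (e * (((F1 0 d (zt p e x).re (zt p e x).im : ℝ) : ℂ) +
          Complex.I * (F2 0 d (zt p e x).re (zt p e x).im : ℝ)))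
      simpa using h2.enorm
  -- choose parameters
  set τ := ε₀ / (12 * Real.pi) with hτ_def
  have hτ : 0 < τ := by positivity
  have e1 := hlim1.eventually (gt_mem_nhds (ENNReal.ofReal_pos.2 hε₀))
  have e2 := hlim2.eventually (gt_mem_nhds (ENNReal.ofReal_pos.2 (by positivity : 0 < ε₀ / 3)))
  have e3 : ∀ᶠ ε : ℝ in 𝓝[>] 0, 2 * R * (d * Real.pi * ε / τ ^ 2) < ε₀ / 3 := by
    have : Tendsto (fun ε : ℝ => 2 * R * (d * Real.pi * ε / τ ^ 2)) (𝓝 0)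
        (𝓝 (2 * R * (d * Real.pi * 0 / τ ^ 2))) := by
      apply Continuous.tendsto; fun_prop
    simp only [mul_zero, zero_div] at this
    exact (this.mono_left nhdsWithin_le_nhds).eventually (gt_mem_nhds (by positivity))
  obtain ⟨ε, ⟨⟨h1, h2⟩, h3⟩, hε⟩ := ((e1.and e2).and e3).and self_mem_nhdsWithin |>.exists
  have hε : 0 < ε := hε
  refine ⟨dpA p e ε d, (contDiff_dpA p e hε d).contDiffOn, fun x _ => norm_dpA _ _ _ _ _, h1.le, ?_⟩
  calc ∫⁻ x in U, ‖jf (dpA p e ε d) x - (jv q x - jv p x)‖ₑ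
      ≤ ∫⁻ x in U, (‖e * (((F1 ε d (zt p e x).re (zt p e x).im : ℝ) : ℂ) +
      Complex.I * (F2 ε d (zt p e x).re (zt p e x).im : ℝ)) - (jv q x - jv p x)‖ₑ +
      ‖e * (Complex.I * (Ss ε d (zt p e x).re (zt p e x).im : ℝ))‖ₑ) := by
        apply lintegral_mono
        intro x
        dsimp only
        rw [jf_dpA p hε, add_sub_right_comm]
        exact enorm_add_le _ _
    _ = _ := lintegral_add_left ((hmF ε).sub hmj).enorm _
    _ ≤ ENNReal.ofReal (ε₀ / 3) + ENNReal.ofReal (2 * Real.pi * (d + 2 * τ) + ε₀ / 3) := by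
        refine add_le_add h2.le ((lint_dp hR hUR he hε hd hτ).trans ?_)
        apply ENNReal.ofReal_le_ofReal
        linarith
    _ = _ := by
        rw [← ENNReal.ofReal_add (by positivity) (by positivity)]
        congr 1
        rw [hτ_def]
        field_simp
        ring

lemma ae_ne (p : R2) (U : Set R2) : ∀ᵐ x ∂(volume.restrict U), x ≠ p :=
  ae_restrict_of_ae (by rw [ae_iff]; simp)

lemma uv_vx_mul {s : Bool} {p x : R2} (h : x ≠ p) : uv (vx s p x) * uv (vx (!s) p x) = 1 := by
  have h0 : vx s p x ≠ 0 := fun hc => h (vx_eq_zero.1 hc)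
  have hr : vx s p x * vx (!s) p x = ((‖x - p‖ ^ 2 : ℝ) : ℂ) := by
    have : ‖x - p‖ = ‖cx x - cx p‖ := by rw [← map_sub, LinearIsometryEquiv.norm_map]
    rw [this, ← Complex.normSq_eq_norm_sq]
    cases s
    · simp only [vx, sg, Bool.not_false, if_true, Bool.false_eq_true, if_false]
      rw [mul_comm, Complex.mul_conj]
    · simp only [vx, sg, Bool.not_true, if_true, Bool.false_eq_true, if_false]
      rw [Complex.mul_conj]
  rw [← uv_mul, hr, ← mul_one ((‖x - p‖ ^ 2 : ℝ) : ℂ), uv_real_mul]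
  · exact uv_of_norm_one (by simp)
  · have := norm_pos_iff.2 (sub_ne_zero.2 h); positivity

lemma costLE_dipole {U : Set R2} (hUo : IsOpen U) (hU : Bornology.IsBounded U) (s : Bool) (p q : R2) :
    CostLE U (fun x => uv (vx s p x) * uv (vx (!s) q x)) (fun x => sr s * (jv p x - jv q x))
      (2 * Real.pi * dist p q) := by
  by_cases hpq : p = q
  · subst hpq
    intro ε hε
    refine ⟨fun _ => 1, contDiffOn_const, by simp, ?_, ?_⟩
    · have : ∫⁻ x in U, ‖(1 : ℂ) - uv (vx s p x) * uv (vx (!s) p x)‖ₑ = ∫⁻ x in U, 0 := by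
        apply lintegral_congr_ae
        filter_upwards [ae_ne p U] with x hx
        rw [uv_vx_mul hx]; simp
      rw [this]; simp
    · have : ∀ x, jf (fun _ => (1 : ℂ)) x = 0 := by
        intro x; unfold jf; simp; rfl
      simp [this]
  · cases s
    · have := costLE_dipole_ne hUo hU hpq
      rw [dist_comm] at this
      intro ε hε
      obtain ⟨A, h1, h2, h3, h4⟩ := this ε hε
      refine ⟨A, h1, h2, ?_, ?_⟩
      · refine le_of_eq_of_le ?_ h3
        congr 1; ext x; simp only [Bool.not_false]; rw [mul_comm (uv (vx false p x))]
      · refine le_of_eq_of_le ?_ h4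
        congr 1; ext x; simp [sr]
    · have := costLE_dipole_ne hUo hU (Ne.symm hpq)
      intro ε hε
      obtain ⟨A, h1, h2, h3, h4⟩ := this ε hε
      refine ⟨A, h1, h2, h3, ?_⟩
      refine le_of_eq_of_le ?_ h4
      congr 1; ext x; simp [sr]

/-! ### Assignment duality -/

lemma assignment_duality {I : Type} [Fintype I] [Nonempty I] (c : I → I → ℝ) :
    ∃ (σ : I ≃ I) (a b : I → ℝ), (∀ i j, a i ≤ b j + c i j) ∧ ∀ i, a i = b (σ i) + c i (σ i) := by
  set mn : (I → ℝ) → I → ℝ := fun b i => Finset.univ.inf' Finset.univ_nonempty (fun j => b j + c i j)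
    with hmn
  set h : (I → ℝ) → ℝ := fun b => ∑ i, mn b i - ∑ j, b j with hh
  have hmn_le : ∀ b i j, mn b i ≤ b j + c i j := fun b i j =>
    Finset.inf'_le _ (Finset.mem_univ j)
  have hmn_ex : ∀ b i, ∃ j, mn b i = b j + c i j := fun b i => by
    obtain ⟨j, _, hj⟩ := Finset.exists_mem_eq_inf' Finset.univ_nonempty (fun j => b j + c i j)
    exact ⟨j, hj⟩
  have hcont : Continuous h := by
    refine Continuous.sub (continuous_finsetSum _ fun i _ => ?_) (by fun_prop)
    exact Continuous.finset_inf'_apply _ fun j _ => by fun_prop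
  have hshift : ∀ b t, h (fun j => b j + t) = h b := by
    intro b t
    have : ∀ i, mn (fun j => b j + t) i = mn b i + t := by
      intro i
      apply le_antisymm
      · obtain ⟨j, hj⟩ := hmn_ex b i
        have := hmn_le (fun j => b j + t) i j
        linarith
      · obtain ⟨j, hj⟩ := hmn_ex (fun j => b j + t) i
        have := hmn_le b i j
        linarith
    simp only [hh, this, Finset.sum_add_distrib]
    ring
  -- global maximum
  have hmax : ∃ b, ∀ b', h b' ≤ h b := by
    obtain ⟨K0, hK0⟩ : ∃ K0 : ℝ, ∀ i j, c i j ≤ K0 := by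
      obtain ⟨K, hK⟩ := (Set.finite_range (fun z : I × I => c z.1 z.2)).bddAbove
      exact ⟨K, fun i j => hK ⟨(i, j), rfl⟩⟩
    set N : ℝ := (Fintype.card I : ℝ)
    set K : ℝ := max 0 (N * K0 - h 0) with hK
    obtain ⟨b, hb, hbm⟩ := (isCompact_univ_pi (fun _ : I => isCompact_Icc (a := (0 : ℝ)) (b := K))).exists_isMaxOn
      ⟨0, fun i _ => ⟨le_rfl, le_max_left _ _⟩⟩ hcont.continuousOn
    refine ⟨b, fun b' => ?_⟩
    obtain ⟨j0, _, hj0⟩ := Finset.exists_mem_eq_inf' Finset.univ_nonempty b'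
    have hj0' : ∀ j, b' j0 ≤ b' j := fun j => by
      rw [← hj0]; exact Finset.inf'_le _ (Finset.mem_univ j)
    rw [← hshift b' (-(b' j0))]
    set b2 : I → ℝ := fun j => b' j + -(b' j0) with hb2
    have hb2n : ∀ j, 0 ≤ b2 j := fun j => by simp only [hb2]; linarith [hj0' j]
    by_cases hin : ∀ j, b2 j ≤ K
    · exact hbm (a := b2) fun j _ => ⟨hb2n j, hin j⟩
    · push Not at hin
      obtain ⟨j1, hj1⟩ := hin
      have h0 : h 0 ≤ h b := hbm (a := 0) fun j _ => ⟨le_rfl, le_max_left _ _⟩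
      have h1 : ∑ i, mn b2 i ≤ N * K0 := by
        calc ∑ i, mn b2 i ≤ ∑ _i : I, K0 := by
              apply Finset.sum_le_sum
              intro i _
              have h2 := hmn_le b2 i j0
              have h3 : b2 j0 = 0 := by simp [hb2]
              linarith [hK0 i j0]
          _ = N * K0 := by simp [N]
      have h2 : K ≤ ∑ j, b2 j :=
        hj1.le.trans (Finset.single_le_sum (fun j _ => hb2n j) (Finset.mem_univ j1))
      have h3 : N * K0 - h 0 ≤ K := le_max_right _ _
      have h4 : h b2 = ∑ i, mn b2 i - ∑ j, b2 j := rfl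
      linarith
  obtain ⟨b, hb⟩ := hmax
  -- tight neighbours
  set t : I → Finset I := fun i => Finset.univ.filter fun j => mn b i = b j + c i j with ht
  have hall : ∀ s : Finset I, s.card ≤ (s.biUnion t).card := by
    intro s
    by_contra hlt
    push Not at hlt
    -- gap
    obtain ⟨ε, hε, hgap⟩ : ∃ ε > 0, ∀ i j, j ∉ t i → mn b i + ε ≤ b j + c i j := by
      have : ∀ z : I × I, ∃ ε > 0, z.2 ∉ t z.1 → mn b z.1 + ε ≤ b z.2 + c z.1 z.2 := by
        intro z
        by_cases hz : z.2 ∈ t z.1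
        · exact ⟨1, one_pos, fun h => absurd hz h⟩
        · have : mn b z.1 ≠ b z.2 + c z.1 z.2 := by simpa [ht] using hz
          have h2 := lt_of_le_of_ne (hmn_le b z.1 z.2) this
          exact ⟨b z.2 + c z.1 z.2 - mn b z.1, by linarith, fun _ => by linarith⟩
      choose e he1 he2 using this
      refine ⟨Finset.univ.inf' Finset.univ_nonempty e, ?_, ?_⟩
      · rw [gt_iff_lt, Finset.lt_inf'_iff]; exact fun z _ => he1 z
      · intro i j hj
        have := Finset.inf'_le e (Finset.mem_univ (i, j))
        linarith [he2 (i, j) hj]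
    set b2 : I → ℝ := fun j => if j ∈ s.biUnion t then b j + ε else b j with hb2
    have hge : ∀ j, b j ≤ b2 j := fun j => by simp only [hb2]; split_ifs <;> linarith
    have h1 : ∀ i, mn b i + (if i ∈ s then ε else 0) ≤ mn b2 i := by
      intro i
      obtain ⟨j, hj⟩ := hmn_ex b2 i
      rw [hj]
      by_cases hi : i ∈ s
      · rw [if_pos hi]
        by_cases hjt : j ∈ t i
        · have : j ∈ s.biUnion t := Finset.mem_biUnion.2 ⟨i, hi, hjt⟩
          simp only [hb2, if_pos this]
          linarith [hmn_le b i j]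
        · linarith [hgap i j hjt, hge j]
      · rw [if_neg hi]
        linarith [hmn_le b i j, hge j]
    have h2 : ∑ j, b2 j = ∑ j, b j + ε * (s.biUnion t).card := by
      have : ∀ j, b2 j = b j + if j ∈ s.biUnion t then ε else 0 := fun j => by
        simp only [hb2]; split_ifs <;> simp
      simp only [this, Finset.sum_add_distrib, Finset.sum_ite_mem, Finset.univ_inter,
        Finset.sum_const, nsmul_eq_mul]
      ring
    have h3 : ∑ i, mn b i + ε * s.card ≤ ∑ i, mn b2 i := by
      refine le_trans (le_of_eq ?_) (Finset.sum_le_sum fun i _ => h1 i)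
      simp only [Finset.sum_add_distrib, Finset.sum_ite_mem, Finset.univ_inter,
        Finset.sum_const, nsmul_eq_mul]
      ring
    have h4 := hb b2
    simp only [hh] at h4
    have h5 : ((s.biUnion t).card : ℝ) < s.card := by exact_mod_cast hlt
    nlinarith
  obtain ⟨f, hf, hft⟩ := (Finset.all_card_le_biUnion_card_iff_exists_injective t).1 hall
  refine ⟨Equiv.ofBijective f (Finite.injective_iff_bijective.1 hf), mn b, b, hmn_le b, fun i => ?_⟩
  have := hft i
  simpa [ht] using this

/-! ### The matching -/

/-- distance with a drain -/
def dd (g : R2 → ℝ) : Option R2 → Option R2 → ℝ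
  | none, none => 0
  | none, some y => g y
  | some x, none => g x
  | some x, some y => min (2 * dist x y) (g x + g y)

lemma dd_self {g : R2 → ℝ} (hg : ∀ x, 0 ≤ g x) (x : Option R2) : dd g x x = 0 := by
  cases x
  · rfl
  · simp only [dd, dist_self, mul_zero]; rw [min_eq_left]; linarith [hg (by assumption)]

lemma dd_tri {g : R2 → ℝ} (hg : ∀ x, 0 ≤ g x) (hl : ∀ x y, g x ≤ g y + 2 * dist x y)
    (x y z : Option R2) : dd g x z ≤ dd g x y + dd g y z := by
  rcases x with _ | x <;> rcases y with _ | y <;> rcases z with _ | z <;> simp only [dd]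
  · linarith
  · linarith
  · linarith [hg y]
  · rcases min_choice (2 * dist y z) (g y + g z) with h | h <;> rw [h]
    · have := hl z y; rw [dist_comm] at this; linarith
    · linarith [hg y]
  · linarith
  · exact min_le_right _ _
  · rcases min_choice (2 * dist x y) (g x + g y) with h | h <;> rw [h]
    · have := hl x y; linarith
    · linarith [hg y]
  · have tr := dist_triangle x y z
    have h1 := hl x y
    have h2 := hl z y
    rw [dist_comm z y] at h2
    have m1 : min (2 * dist x z) (g x + g z) ≤ 2 * dist x z := min_le_left _ _
    have m2 : min (2 * dist x z) (g x + g z) ≤ g x + g z := min_le_right _ _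
    have := hg y
    rcases min_choice (2 * dist x y) (g x + g y) with h | h <;>
    rcases min_choice (2 * dist y z) (g y + g z) with h' | h' <;> rw [h, h'] <;> linarith

/-- **Duality for the matching of vortices** -/
lemma matching_aux (P : Finset R2) (s : R2 → Bool) (g : R2 → ℝ) (hg : ∀ x, 0 ≤ g x)
    (hl : ∀ x y, g x ≤ g y + 2 * dist x y) :
    ∃ (φ : R2 → ℝ) (S M : Finset R2) (τ : R2 → R2), (∀ x y, |φ x - φ y| ≤ 2 * dist x y) ∧
      (∀ x, |φ x| ≤ g x) ∧ S ⊆ P ∧ M ⊆ P ∧ (∀ p ∈ M, s p = true ∧ s (τ p) = false) ∧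
      (∀ {N : Type} [CommMonoid N] (F : R2 → N),
        ∏ p ∈ P, F p = (∏ p ∈ S, F p) * ∏ p ∈ M, (F p * F (τ p))) ∧
      ∑ p ∈ S, g p + ∑ p ∈ M, 2 * dist p (τ p) ≤ ∑ p ∈ P, sr (s p) * φ p := by
  rcases P.eq_empty_or_nonempty with rfl | hne
  · refine ⟨fun _ => 0, ∅, ∅, id, by simp, by simpa using hg, by simp, by simp, by simp, ?_, by simp⟩
    intro N _ F; simp
  have : Nonempty P := hne.to_subtype
  set src : P → Option R2 := fun i => if s i then some i else none with hsrc
  set tgt : P → Option R2 := fun i => if s i then none else some i with htgt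
  obtain ⟨σ, a, b, hab, heq⟩ := assignment_duality (I := P) (fun i j => dd g (src i) (tgt j))
  set φ₀ : Option R2 → ℝ := fun x => Finset.univ.inf' Finset.univ_nonempty
    (fun j => b j + dd g x (tgt j)) with hφ₀
  have hle : ∀ x j, φ₀ x ≤ b j + dd g x (tgt j) := fun x j => Finset.inf'_le _ (Finset.mem_univ j)
  have hex : ∀ x, ∃ j, φ₀ x = b j + dd g x (tgt j) := fun x => by
    obtain ⟨j, _, hj⟩ := Finset.exists_mem_eq_inf' Finset.univ_nonempty (fun j => b j + dd g x (tgt j))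
    exact ⟨j, hj⟩
  have hlip : ∀ x y, φ₀ x ≤ φ₀ y + dd g x y := by
    intro x y
    obtain ⟨j, hj⟩ := hex y
    linarith [hle x j, dd_tri hg hl x y (tgt j)]
  have hs : ∀ i, a i ≤ φ₀ (src i) := by
    intro i
    obtain ⟨j, hj⟩ := hex (src i)
    rw [hj]; exact hab i j
  have ht : ∀ j, φ₀ (tgt j) ≤ b j := by
    intro j
    have := hle (tgt j) j
    rwa [dd_self hg, add_zero] at this
  have hcost : ∑ i : P, dd g (src i) (tgt (σ i)) ≤ ∑ i : P, (φ₀ (src i) - φ₀ (tgt i)) := by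
    rw [Finset.sum_sub_distrib, ← Equiv.sum_comp σ (fun i => φ₀ (tgt i)), ← Finset.sum_sub_distrib]
    apply Finset.sum_le_sum
    intro i _
    have h1 := hs i
    have h2 := ht (σ i)
    have h3 := heq i
    linarith
  -- the pairs
  set Mc : P → Prop := fun i => s i = true ∧ s (σ i) = false ∧
    2 * dist (i : R2) (σ i) ≤ g i + g (σ i) with hMc
  set MI : Finset P := Finset.univ.filter Mc with hMI
  set SI : Finset P := Finset.univ.filter (fun i => i ∉ MI ∧ i ∉ MI.image σ) with hSI
  set τ : R2 → R2 := fun x => if h : x ∈ P then σ ⟨x, h⟩ else x with hτ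
  have hτi : ∀ i : P, τ i = σ i := fun i => by simp [hτ]
  have hinj : Set.InjOn (Subtype.val : P → R2) Set.univ := Subtype.val_injective.injOn
  have hdisj : Disjoint MI (MI.image σ) := by
    rw [Finset.disjoint_left]
    intro i hi hi2
    obtain ⟨k, hk, rfl⟩ := Finset.mem_image.1 hi2
    have h1 : s (σ k) = true := (Finset.mem_filter.1 hi).2.1
    have h2 : s (σ k) = false := (Finset.mem_filter.1 hk).2.2.1
    rw [h1] at h2; exact absurd h2 (by simp)
  have hdec : ∀ {N : Type} [CommMonoid N] (F : P → N), ∏ i, F i =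
      (∏ i ∈ SI, F i) * ∏ i ∈ MI, (F i * F (σ i)) := by
    intro N _ F
    have hu : (Finset.univ : Finset P) = SI ∪ (MI ∪ MI.image σ) := by
      ext i; simp only [hSI, Finset.mem_union, Finset.mem_filter, Finset.mem_univ, true_and]; tauto
    have hd2 : Disjoint SI (MI ∪ MI.image σ) := by
      rw [Finset.disjoint_left]; intro i hi
      simp only [hSI, Finset.mem_filter, Finset.mem_univ, true_and] at hi
      simp only [Finset.mem_union]; tauto
    rw [hu, Finset.prod_union hd2, Finset.prod_union hdisj,
      Finset.prod_image σ.injective.injOn, Finset.prod_mul_distrib]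
  refine ⟨fun x => φ₀ (some x) - φ₀ none, SI.image Subtype.val, MI.image Subtype.val, τ, ?_, ?_, ?_, ?_, ?_, ?_, ?_⟩
  · intro x y
    have h1 := hlip (some x) (some y)
    have h2 := hlip (some y) (some x)
    have e1 : dd g (some x) (some y) ≤ 2 * dist x y := min_le_left _ _
    have e2 : dd g (some y) (some x) ≤ 2 * dist y x := min_le_left _ _
    rw [dist_comm] at e2
    rw [abs_le]; constructor <;> linarith
  · intro x
    have h1 := hlip (some x) none
    have h2 := hlip none (some x)
    simp only [dd] at h1 h2
    rw [abs_le]; constructor <;> linarith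
  · intro x hx
    obtain ⟨i, _, rfl⟩ := Finset.mem_image.1 hx
    exact i.2
  · intro x hx
    obtain ⟨i, _, rfl⟩ := Finset.mem_image.1 hx
    exact i.2
  · intro x hx
    obtain ⟨i, hi, rfl⟩ := Finset.mem_image.1 hx
    rw [hτi]
    have := (Finset.mem_filter.1 hi).2
    exact ⟨this.1, this.2.1⟩
  · intro N _ F
    rw [Finset.prod_image Subtype.val_injective.injOn, Finset.prod_image Subtype.val_injective.injOn]
    simp only [hτi]
    rw [← hdec (fun i => F i), ← Finset.prod_coe_sort]
  · rw [Finset.sum_image Subtype.val_injective.injOn, Finset.sum_image Subtype.val_injective.injOn]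
    simp only [hτi]
    have e1 : ∑ p ∈ P, sr (s p) * (φ₀ (some p) - φ₀ none) = ∑ i : P, (φ₀ (src i) - φ₀ (tgt i)) := by
      rw [← Finset.sum_coe_sort]
      apply Finset.sum_congr rfl
      intro i _
      cases hsi : s i <;> simp [hsrc, htgt, hsi, sr]
    rw [e1]
    refine le_trans (le_of_eq ?_) hcost
    -- compute the cost
    have e2 : ∀ i : P, dd g (src i) (tgt (σ i)) =
        (if s i = true ∧ i ∉ MI then g i else 0) +
        (if s (σ i) = false ∧ σ i ∉ MI.image σ then g (σ i) else 0) +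
        (if i ∈ MI then 2 * dist (i : R2) (σ i) else 0) := by
      intro i
      have hmi : σ i ∈ MI.image σ ↔ i ∈ MI := by
        simp
      have hmem : i ∈ MI ↔ Mc i := by simp [hMI]
      simp only [hmi, hmem]
      rcases (Bool.eq_false_or_eq_true (s i)).symm with h1 | h1 <;>
        rcases (Bool.eq_false_or_eq_true (s (σ i))).symm with h2 | h2
      · simp [hsrc, htgt, h1, h2, dd, hMc]
      · simp [hsrc, htgt, h1, h2, dd, hMc]
      · by_cases h3 : 2 * dist (i : R2) (σ i) ≤ g i + g (σ i)
        · simp [hsrc, htgt, h1, h2, dd, hMc, h3]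
        · simp [hsrc, htgt, h1, h2, dd, hMc, h3]
          exact (not_le.1 h3).le
      · simp [hsrc, htgt, h1, h2, dd, hMc]
    simp only [e2]
    rw [Finset.sum_add_distrib, Finset.sum_add_distrib,
      Equiv.sum_comp σ (fun j => if s j = false ∧ j ∉ MI.image σ then g j else 0),
      ← Finset.sum_add_distrib, ← Finset.sum_filter (fun i => i ∈ MI)]
    congr 1
    · rw [hSI, Finset.sum_filter]
      apply Finset.sum_congr rfl
      intro i _
      cases h1 : s i
      · have : i ∉ MI := fun h => by
          have := (Finset.mem_filter.1 h).2.1; rw [h1] at this; exact absurd this (by simp)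
        simp [this]
      · have : i ∉ MI.image σ := fun h => by
          obtain ⟨k, hk, rfl⟩ := Finset.mem_image.1 h
          have := (Finset.mem_filter.1 hk).2.2.1; rw [h1] at this; exact absurd this (by simp)
        simp only [this]
        simp
    · rw [Finset.filter_mem_eq_inter, Finset.univ_inter]

/-- additive version of a decomposition -/
lemma dec_add {P S M : Finset R2} {τ : R2 → R2} (h : ∀ {N : Type} [CommMonoid N] (F : R2 → N),
    ∏ p ∈ P, F p = (∏ p ∈ S, F p) * ∏ p ∈ M, (F p * F (τ p))) {A : Type} [AddCommMonoid A]
    (F : R2 → A) : ∑ p ∈ P, F p = ∑ p ∈ S, F p + ∑ p ∈ M, (F p + F (τ p)) :=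
  h (N := Multiplicative A) (fun p => Multiplicative.ofAdd (F p))

/-! ### Algebra of costs -/

/-- good pairs with cost -/
def CostG (U : Set R2) (A a : R2 → ℂ) (c : ℝ) : Prop :=
  CostLE U A a c ∧ Measurable A ∧ (∀ x, ‖A x‖ ≤ 1) ∧ AEMeasurable a (volume.restrict U) ∧ 0 ≤ c

lemma CostLE.congr {U : Set R2} (hU : IsOpen U) {A a B b : R2 → ℂ} {c : ℝ} (h : CostLE U A a c)
    (hA : ∀ x ∈ U, A x = B x) (ha : ∀ x ∈ U, a x = b x) : CostLE U B b c := by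
  intro ε hε
  obtain ⟨A', h1, h2, h3, h4⟩ := h ε hε
  refine ⟨A', h1, h2, ?_, ?_⟩
  · rwa [← setLIntegral_congr_fun (f := fun x => ‖A' x - A x‖ₑ) hU.measurableSet
      (fun x hx => by simp only [hA x hx])]
  · rwa [← setLIntegral_congr_fun (f := fun x => ‖jf A' x - a x‖ₑ) hU.measurableSet
      (fun x hx => by simp only [ha x hx])]

lemma CostLE.exact {U : Set R2} {A : R2 → ℂ} (h1 : ContDiffOn ℝ 1 A U)
    (h2 : ∀ x ∈ U, ‖A x‖ = 1) : CostLE U A (jf A) 0 := by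
  intro ε hε
  exact ⟨A, h1, h2, by simp, by simp⟩

lemma CostG.mul {U : Set R2} (hU : IsOpen U) {A a B b : R2 → ℂ} {c d : ℝ} (hA : CostG U A a c)
    (hB : CostG U B b d) : CostG U (fun x => A x * B x) (fun x => a x + b x) (c + d) := by
  obtain ⟨kA, mA, nA, ma, hc⟩ := hA
  obtain ⟨kB, mB, nB, mb, hd⟩ := hB
  refine ⟨?_, mA.mul mB, fun x => ?_, ma.add mb, add_nonneg hc hd⟩
  swap
  · rw [norm_mul]; exact mul_le_one₀ (nA x) (norm_nonneg _) (nB x)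
  intro ε hε
  obtain ⟨A', A1, A2, A3, A4⟩ := kA (ε / 2) (by positivity)
  obtain ⟨B', B1, B2, B3, B4⟩ := kB (ε / 2) (by positivity)
  have mA' : AEMeasurable A' (volume.restrict U) := A1.continuousOn.aemeasurable hU.measurableSet
  have mB' : AEMeasurable B' (volume.restrict U) := B1.continuousOn.aemeasurable hU.measurableSet
  refine ⟨fun x => A' x * B' x, A1.mul B1, fun x hx => by rw [norm_mul, A2 x hx, B2 x hx, one_mul], ?_, ?_⟩
  · calc ∫⁻ x in U, ‖A' x * B' x - A x * B x‖ₑ ≤ ∫⁻ x in U, (‖A' x - A x‖ₑ + ‖B' x - B x‖ₑ) := by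
          refine setLIntegral_mono_ae ?_ ?_
          · exact ((mA'.sub mA.aemeasurable).enorm.add (mB'.sub mB.aemeasurable).enorm)
          · refine Eventually.of_forall fun x hx => ?_
            have e : A' x * B' x - A x * B x = (A' x - A x) * B x + A' x * (B' x - B x) := by ring
            rw [e]
            refine (enorm_add_le _ _).trans ?_
            rw [enorm_mul, enorm_mul]
            have h1 : ‖B x‖ₑ ≤ 1 := by rw [← ofReal_norm]; exact ENNReal.ofReal_le_one.2 (nB x)
            have h2 : ‖A' x‖ₑ = 1 := by rw [← ofReal_norm, A2 x hx]; simp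
            rw [h2, one_mul]
            gcongr
            exact mul_le_of_le_one_right' h1
      _ = _ := lintegral_add_left' (mA'.sub mA.aemeasurable).enorm _
      _ ≤ ENNReal.ofReal (ε / 2) + ENNReal.ofReal (ε / 2) := add_le_add A3 B3
      _ = _ := by rw [← ENNReal.ofReal_add (by positivity) (by positivity), add_halves]
  · calc ∫⁻ x in U, ‖jf (fun x => A' x * B' x) x - (a x + b x)‖ₑ
        ≤ ∫⁻ x in U, (‖jf A' x - a x‖ₑ + ‖jf B' x - b x‖ₑ) := by
          refine setLIntegral_mono_ae ?_ ?_
          · exact (((aemeasurable_jf mA').sub ma).enorm.add ((aemeasurable_jf mB').sub mb).enorm)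
          · refine Eventually.of_forall fun x hx => ?_
            have hx' := hU.mem_nhds hx
            rw [jf_mul ((A1.contDiffAt hx').differentiableAt (by norm_num))
              ((B1.contDiffAt hx').differentiableAt (by norm_num))
              (fun h => by have := A2 x hx; rw [h] at this; simp at this)
              (fun h => by have := B2 x hx; rw [h] at this; simp at this), add_sub_add_comm]
            exact enorm_add_le _ _
      _ = _ := lintegral_add_left' ((aemeasurable_jf mA').sub ma).enorm _
      _ ≤ ENNReal.ofReal (c + ε / 2) + ENNReal.ofReal (d + ε / 2) := add_le_add A4 B4
      _ = _ := by
        rw [← ENNReal.ofReal_add (by positivity) (by positivity)]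
        congr 1; ring

lemma CostG.one (U : Set R2) : CostG U (fun _ => 1) (fun _ => 0) 0 := by
  refine ⟨?_, measurable_const, by simp, aemeasurable_const, le_rfl⟩
  have : jf (fun _ => (1 : ℂ)) = fun _ => 0 := by ext x; unfold jf; simp; rfl
  have h := CostLE.exact (U := U) (A := fun _ => (1 : ℂ)) contDiffOn_const (by simp)
  rwa [this] at h

lemma CostG.prod {U : Set R2} (hU : IsOpen U) {ι : Type*} (S : Finset ι) {A a : ι → R2 → ℂ} {c : ι → ℝ}
    (h : ∀ i ∈ S, CostG U (A i) (a i) (c i)) :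
    CostG U (fun x => ∏ i ∈ S, A i x) (fun x => ∑ i ∈ S, a i x) (∑ i ∈ S, c i) := by
  induction S using Finset.induction_on with
  | empty => simpa using CostG.one U
  | insert i S hi ih =>
    have h1 := h i (Finset.mem_insert_self _ _)
    have h2 := ih fun j hj => h j (Finset.mem_insert_of_mem hj)
    simpa [Finset.prod_insert hi, Finset.sum_insert hi] using h1.mul hU h2

lemma measurable_uvvx (s : Bool) (p : R2) : Measurable (fun x => uv (vx s p x)) :=
  measurable_uv.comp (continuous_vx _ _).measurable

lemma contDiffOn_uvvx (s : Bool) {p : R2} {U : Set R2} (hp : p ∉ U) :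
    ContDiffOn ℝ 1 (fun x => uv (vx s p x)) U := fun x hx =>
  (contDiffAt_uv (contDiff_vx s p).contDiffAt fun h => hp (vx_eq_zero.1 h ▸ hx)).contDiffWithinAt

lemma jf_uvvx (s : Bool) {p x : R2} (h : x ≠ p) : jf (fun y => uv (vx s p y)) x = sr s * jv p x := by
  rw [jf_uv (contDiff_vx s p).contDiffAt fun hc => h (vx_eq_zero.1 hc), jf_vx]

lemma costG_pair {U : Set R2} (hUo : IsOpen U) (hU : Bornology.IsBounded U) {s : R2 → Bool} {p q : R2}
    (hp : s p = true) (hq : s q = false) :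
    CostG U (fun x => uv (vx (s p) p x) * uv (vx (s q) q x))
      (fun x => sr (s p) * jv p x + sr (s q) * jv q x) (2 * Real.pi * dist p q) := by
  have h := costLE_dipole hUo hU true p q
  refine ⟨?_, (measurable_uvvx _ _).mul (measurable_uvvx _ _), fun x => ?_, ?_, by positivity⟩
  · rw [hp, hq]
    refine h.congr hUo (fun x _ => rfl) fun x _ => ?_
    simp [sr]; ring
  · rw [norm_mul]; exact mul_le_one₀ (norm_uv_le _) (norm_nonneg _) (norm_uv_le _)
  · exact (((measurable_jv p).const_mul _).add ((measurable_jv q).const_mul _)).aemeasurable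

lemma costG_single {U : Set R2} (hUo : IsOpen U) (hU : Bornology.IsBounded U) (s : Bool) (p : R2) {q : R2}
    (hq : q ∉ U) :
    CostG U (fun x => uv (vx s p x)) (fun x => sr s * jv p x) (2 * Real.pi * dist p q) := by
  have hne : ∀ x ∈ U, x ≠ q := fun x hx h => hq (h ▸ hx)
  have h1 : CostG U (fun x => uv (vx s p x) * uv (vx (!s) q x)) (fun x => sr s * (jv p x - jv q x))
      (2 * Real.pi * dist p q) := by
    refine ⟨costLE_dipole hUo hU s p q, (measurable_uvvx _ _).mul (measurable_uvvx _ _),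
      fun x => ?_, ?_, by positivity⟩
    · rw [norm_mul]; exact mul_le_one₀ (norm_uv_le _) (norm_nonneg _) (norm_uv_le _)
    · exact (((measurable_jv p).sub (measurable_jv q)).const_mul _).aemeasurable
  have h2 : CostG U (fun x => uv (vx s q x)) (fun x => sr s * jv q x) 0 := by
    refine ⟨?_, measurable_uvvx _ _, fun x => norm_uv_le _, ((measurable_jv q).const_mul _).aemeasurable, le_rfl⟩
    refine (CostLE.exact (contDiffOn_uvvx s hq) fun x hx =>
      norm_uv fun h => hne x hx (vx_eq_zero.1 h)).congr hUo (fun _ _ => rfl) fun x hx => ?_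
    exact jf_uvvx s (hne x hx)
  have h3 := h1.mul hUo h2
  refine ⟨?_, measurable_uvvx _ _, fun x => norm_uv_le _, ((measurable_jv p).const_mul _).aemeasurable, by positivity⟩
  have h4 := h3.1
  rw [add_zero] at h4
  refine h4.congr hUo (fun x hx => ?_) fun x _ => by ring
  rw [mul_assoc, mul_comm (uv (vx (!s) q x)), uv_vx_mul (hne x hx), mul_one]

lemma costG_smooth {U : Set R2} (hUo : IsOpen U) {W : R2 → ℂ} (hW : ContDiff ℝ 1 W)
    (h0 : ∀ x ∈ U, W x ≠ 0) : CostG U (fun x => uv (W x)) (jf W) 0 := by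
  refine ⟨?_, measurable_uv.comp hW.continuous.measurable, fun x => norm_uv_le _,
    aemeasurable_jf hW.continuous.measurable.aemeasurable, le_rfl⟩
  refine (CostLE.exact (A := fun x => uv (W x)) (fun x hx =>
    (contDiffAt_uv hW.contDiffAt (h0 x hx)).contDiffWithinAt)
    fun x hx => norm_uv (h0 x hx)).congr hUo (fun _ _ => rfl) fun x hx => ?_
  exact jf_uv hW.contDiffAt (h0 x hx)

/-- The smooth approximations of everything except the drilled vortices -/
lemma costLE_all {U : Set R2} (hUo : IsOpen U) (hU : Bornology.IsBounded U) {W : R2 → ℂ}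
    (hW : ContDiff ℝ 1 W) (h0 : ∀ x ∈ U, W x ≠ 0) (s : R2 → Bool) (T M : Finset R2) (q τ : R2 → R2)
    (hT : ∀ p ∈ T, q p ∉ U) (hM : ∀ p ∈ M, s p = true ∧ s (τ p) = false) :
    CostLE U (fun x => uv (W x) * ((∏ p ∈ T, uv (vx (s p) p x)) *
        ∏ p ∈ M, (uv (vx (s p) p x) * uv (vx (s (τ p)) (τ p) x))))
      (fun x => jf W x + (∑ p ∈ T, sr (s p) * jv p x +
        ∑ p ∈ M, (sr (s p) * jv p x + sr (s (τ p)) * jv (τ p) x)))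
      (0 + (∑ p ∈ T, 2 * Real.pi * dist p (q p) + ∑ p ∈ M, 2 * Real.pi * dist p (τ p))) :=
  ((costG_smooth hUo hW h0).mul hUo
    ((CostG.prod hUo T fun p hp => costG_single hUo hU (s p) p (hT p hp)).mul hUo
      (CostG.prod hUo M fun p hp => costG_pair hUo hU (hM p hp).1 (hM p hp).2))).1

/-! ### Radial cut-off -/

lemma lint_radial {F : ℝ → ℝ} (hc : Continuous F) (h0 : ∀ r, 0 ≤ F r) {ρ : ℝ}
    (hs : ∀ r, ρ < r → F r = 0) (p : R2) :
    ∫⁻ x : R2, ENNReal.ofReal (F ‖x - p‖) =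
      ENNReal.ofReal (2 * Real.pi * ∫ r in Ioi (0 : ℝ), r * F r) := by
  have h1 : ∫⁻ x : R2, ENNReal.ofReal (F ‖x - p‖) = ∫⁻ x : R2, ENNReal.ofReal (F ‖x‖) :=
    lintegral_sub_right_eq_self (fun x : R2 => ENNReal.ofReal (F ‖x‖)) p
  have hcs : HasCompactSupport (fun x : R2 => F ‖x‖) := by
    apply HasCompactSupport.of_support_subset_isCompact (isCompact_closedBall (0 : R2) ρ)
    intro x hx
    by_contra hxx
    rw [mem_closedBall, dist_zero_right, not_le] at hxx
    exact hx (hs _ hxx)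
  have hIntg : Integrable (fun x : R2 => F ‖x‖) volume :=
    (hc.comp continuous_norm).integrable_of_hasCompactSupport hcs
  rw [h1, ← ofReal_integral_eq_lintegral_ofReal hIntg (Eventually.of_forall fun x => h0 _),
    integral_fun_norm_addHaar]
  congr 1
  rw [vol_ball_one, finrank_euclideanSpace]
  simp only [Fintype.card_fin, nsmul_eq_mul, smul_eq_mul, Nat.cast_ofNat]
  norm_num
  ring

/-- radial profile -/
def Hh (δ r : ℝ) : ℝ := Real.smoothTransition (2 * r ^ 2 / δ ^ 2 - 1)
/-- derivative of the profile over the radius -/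
def kk (δ r : ℝ) : ℝ := deriv Real.smoothTransition (2 * r ^ 2 / δ ^ 2 - 1) * (4 / δ ^ 2)
/-- cut-off vanishing near `p` -/
def mm (δ : ℝ) (p x : R2) : ℝ := Hh δ ‖x - p‖

lemma hasDerivAt_Hh (δ r : ℝ) : HasDerivAt (Hh δ) (kk δ r * r) r := by
  have h1 : HasDerivAt (fun r : ℝ => 2 * r ^ 2 / δ ^ 2 - 1) (2 * (2 * r) / δ ^ 2) r := by
    simpa using (((hasDerivAt_pow 2 r).const_mul 2).div_const (δ ^ 2)).sub_const 1
  have h2 : HasDerivAt Real.smoothTransition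
      (deriv Real.smoothTransition (2 * r ^ 2 / δ ^ 2 - 1)) (2 * r ^ 2 / δ ^ 2 - 1) :=
    ((Real.smoothTransition.contDiff (n := 1)).differentiable (by norm_num) _).hasDerivAt
  refine (h2.comp r h1).congr_deriv ?_
  unfold kk; ring

lemma hasFDerivAt_mm (δ : ℝ) (p x : R2) :
    HasFDerivAt (mm δ p) (kk δ ‖x - p‖ • innerSL ℝ (x - p)) x := by
  have h0 : HasFDerivAt (fun y : R2 => ‖y - p‖ ^ 2) (2 • innerSL ℝ (x - p)) x := by
    have := ((hasFDerivAt_id (𝕜 := ℝ) x).sub_const p).norm_sq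
    simpa using this
  have h1 : HasFDerivAt (fun y : R2 => 2 * ‖y - p‖ ^ 2 / δ ^ 2 - 1)
      ((2 / δ ^ 2) • (2 • innerSL ℝ (x - p))) x := by
    have := (h0.const_mul (2 / δ ^ 2)).sub_const 1
    have e : (fun y : R2 => 2 * ‖y - p‖ ^ 2 / δ ^ 2 - 1) =
        fun y : R2 => 2 / δ ^ 2 * ‖y - p‖ ^ 2 - 1 := by ext y; ring
    rw [e]; exact this
  have h2 : HasDerivAt Real.smoothTransition
      (deriv Real.smoothTransition (2 * ‖x - p‖ ^ 2 / δ ^ 2 - 1)) (2 * ‖x - p‖ ^ 2 / δ ^ 2 - 1) :=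
    ((Real.smoothTransition.contDiff (n := 1)).differentiable (by norm_num) _).hasDerivAt
  refine (h2.comp_hasFDerivAt x h1).congr_fderiv ?_
  ext v
  unfold kk
  simp
  ring

lemma contDiff_mm (δ : ℝ) (p : R2) : ContDiff ℝ 1 (mm δ p) := by
  unfold mm Hh
  apply (Real.smoothTransition.contDiff (n := 1)).comp
  exact ((contDiff_const.mul ((contDiff_id.sub contDiff_const).norm_sq ℝ)).div_const _).sub
    contDiff_const

lemma kk_nonneg (δ r : ℝ) : 0 ≤ kk δ r :=
  mul_nonneg (Real.smoothTransition.monotone.deriv_nonneg) (by positivity)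

lemma Hh_nonneg (δ r : ℝ) : 0 ≤ Hh δ r := Real.smoothTransition.nonneg _
lemma Hh_le_one (δ r : ℝ) : Hh δ r ≤ 1 := Real.smoothTransition.le_one _

lemma Hh_eq_one {δ r : ℝ} (hδ : 0 < δ) (h : δ ≤ r) : Hh δ r = 1 := by
  apply Real.smoothTransition.one_of_one_le
  rw [le_sub_iff_add_le, le_div_iff₀ (by positivity)]
  nlinarith

lemma Hh_eq_zero {δ r : ℝ} (hδ : 0 < δ) (h0 : 0 ≤ r) (h : r ≤ δ / 2) : Hh δ r = 0 := by
  apply Real.smoothTransition.zero_of_nonpos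
  rw [sub_nonpos, div_le_iff₀ (by positivity)]
  nlinarith

lemma kk_eq_zero {δ r : ℝ} (hδ : 0 < δ) (h : δ < r) : kk δ r = 0 := by
  have h1 : 1 < 2 * r ^ 2 / δ ^ 2 - 1 := by
    rw [lt_sub_iff_add_lt, lt_div_iff₀ (by positivity)]
    nlinarith
  have : Real.smoothTransition =ᶠ[𝓝 (2 * r ^ 2 / δ ^ 2 - 1)] fun _ => 1 := by
    filter_upwards [lt_mem_nhds h1] with y hy
    exact Real.smoothTransition.one_of_one_le hy.le
  unfold kk
  rw [this.deriv_eq]; simp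

lemma continuous_kk (δ : ℝ) : Continuous (kk δ) := by
  unfold kk
  have : Continuous (deriv Real.smoothTransition) :=
    (Real.smoothTransition.contDiff (n := 1)).continuous_deriv (by norm_num)
  fun_prop

lemma continuous_Hh (δ : ℝ) : Continuous (Hh δ) := by
  unfold Hh
  have := Real.smoothTransition.continuous
  fun_prop

lemma tendsto_Hh {δ : ℝ} (hδ : 0 < δ) : Tendsto (Hh δ) atTop (𝓝 1) := by
  apply tendsto_const_nhds.congr'
  filter_upwards [eventually_ge_atTop δ] with r hr
  rw [Hh_eq_one hδ hr]

lemma lint_mm_kk {δ : ℝ} (hδ : 0 < δ) (p : R2) :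
    ∫⁻ x : R2, ENNReal.ofReal (mm δ p x * kk δ ‖x - p‖) = ENNReal.ofReal Real.pi := by
  unfold mm
  rw [lint_radial (F := fun r => Hh δ r * kk δ r) (ρ := δ)
    ((continuous_Hh δ).mul (continuous_kk δ))
    (fun r => mul_nonneg (Hh_nonneg _ _) (kk_nonneg _ _))
    (fun r hr => by simp [kk_eq_zero hδ hr])]
  have : ∫ r in Ioi (0 : ℝ), r * (Hh δ r * kk δ r) = 1 / 2 - Hh δ 0 ^ 2 / 2 := by
    apply integral_Ioi_of_hasDerivAt_of_nonneg' (g := fun r => Hh δ r ^ 2 / 2)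
    · intro r _
      refine (((hasDerivAt_Hh δ r).pow 2).div_const 2).congr_deriv ?_
      simp
      ring
    · intro r hr
      have := Hh_nonneg δ r
      have := kk_nonneg δ r
      have : 0 < r := hr
      positivity
    · simpa using ((tendsto_Hh hδ).pow 2).div_const 2
  rw [this, Hh_eq_zero hδ le_rfl (by positivity)]
  congr 1; ring

lemma lint_kk {δ : ℝ} (hδ : 0 < δ) (p : R2) :
    ∫⁻ x : R2, ENNReal.ofReal (kk δ ‖x - p‖ * ‖x - p‖) ≤ ENNReal.ofReal (2 * Real.pi * δ) := by
  have e1 : ∫ r in Ioi (0 : ℝ), kk δ r * r = 1 - Hh δ 0 :=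
    integral_Ioi_of_hasDerivAt_of_nonneg' (fun r _ => hasDerivAt_Hh δ r)
      (fun r hr => mul_nonneg (kk_nonneg _ _) (le_of_lt hr)) (tendsto_Hh hδ)
  have i1 : IntegrableOn (fun r => kk δ r * r) (Ioi (0 : ℝ)) :=
    integrableOn_Ioi_deriv_of_nonneg' (fun r _ => hasDerivAt_Hh δ r)
      (fun r hr => mul_nonneg (kk_nonneg _ _) (le_of_lt hr)) (tendsto_Hh hδ)
  have h := lint_radial (F := fun r => kk δ r * |r|) (ρ := δ)
    ((continuous_kk δ).mul continuous_abs)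
    (fun r => mul_nonneg (kk_nonneg _ _) (abs_nonneg _))
    (fun r hr => by simp [kk_eq_zero hδ hr]) p
  simp only [abs_norm] at h
  rw [h]
  apply ENNReal.ofReal_le_ofReal
  gcongr
  have : ∫ r in Ioi (0 : ℝ), r * (kk δ r * |r|) ≤ ∫ r in Ioi (0 : ℝ), δ * (kk δ r * r) := by
    apply integral_mono_of_nonneg
    · filter_upwards [ae_restrict_mem measurableSet_Ioi] with r hr
      have : 0 < r := hr
      have := kk_nonneg δ r
      positivity
    · exact i1.const_mul δ
    · filter_upwards [ae_restrict_mem measurableSet_Ioi] with r hr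
      have h0 : 0 < r := hr
      rw [abs_of_pos h0]
      by_cases h : δ < r
      · simp [kk_eq_zero hδ h]
      · exact mul_le_mul_of_nonneg_right (not_lt.1 h) (mul_nonneg (kk_nonneg _ _) h0.le)
  refine this.trans ?_
  rw [integral_const_mul, e1, Hh_eq_zero hδ le_rfl (by positivity)]
  simp

/-! ### Pointwise area estimate -/

lemma jac_symm {F : R2 → ℂ} {x : R2} (hF : DifferentiableAt ℝ F x) (j : Fin 2) :
    jacobianMatrix (fun y => cx.symm (F y)) x 0 j = (fderiv ℝ F x (ee j)).re ∧
    jacobianMatrix (fun y => cx.symm (F y)) x 1 j = (fderiv ℝ F x (ee j)).im := by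
  have h1 : HasFDerivAt (fun y => cx.symm (F y))
      ((cx.symm.toContinuousLinearEquiv : ℂ →L[ℝ] R2).comp (fderiv ℝ F x)) x :=
    cx.symm.toContinuousLinearEquiv.hasFDerivAt.comp x hF.hasFDerivAt
  unfold jacobianMatrix
  simp only [Matrix.of_apply, h1.fderiv]
  constructor
  · rw [← cx_re]; simp
  · rw [← cx_im]; simp

/-- wedge product -/
def wd (g J : ℂ) : ℝ := g.re * J.im - g.im * J.re

lemma abs_wd_le (g J : ℂ) : |wd g J| ≤ ‖g‖ * ‖J‖ := by
  have : wd g J = ((starRingEnd ℂ) g * J).im := by simp [wd]; ring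
  rw [this]
  refine (Complex.abs_im_le_norm _).trans ?_
  rw [norm_mul, RCLike.norm_conj]

lemma area_alg {m : ℝ} {B g J a b : ℂ} (hB : ‖B‖ = 1) (h0 : 0 ≤ m) (h1 : m ≤ 1)
    (ha : a = B * (g.re + m * J.re * Complex.I)) (hb : b = B * (g.im + m * J.im * Complex.I)) :
    Real.sqrt (1 + (a.re ^ 2 + b.re ^ 2 + (a.im ^ 2 + b.im ^ 2)) + (a.re * b.im - b.re * a.im) ^ 2)
      ≤ Real.sqrt (1 + ‖J‖ ^ 2) + ‖g‖ + |m * wd g J| := by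
  have hB2 : B.re ^ 2 + B.im ^ 2 = 1 := by
    have := Complex.sq_norm B
    rw [hB, Complex.normSq_apply] at this; nlinarith
  have hJ : ‖J‖ ^ 2 = J.re ^ 2 + J.im ^ 2 := by rw [Complex.sq_norm, Complex.normSq_apply]; ring
  have hg : ‖g‖ ^ 2 = g.re ^ 2 + g.im ^ 2 := by rw [Complex.sq_norm, Complex.normSq_apply]; ring
  have e1 : a.re ^ 2 + b.re ^ 2 + (a.im ^ 2 + b.im ^ 2) = ‖g‖ ^ 2 + m ^ 2 * ‖J‖ ^ 2 := by
    rw [hJ, hg, ha, hb]; simp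
    linear_combination (g.re ^ 2 + g.im ^ 2 + m ^ 2 * (J.re ^ 2 + J.im ^ 2)) * hB2
  have e2 : a.re * b.im - b.re * a.im = m * wd g J := by
    rw [ha, hb]; simp [wd]
    linear_combination (m * (g.re * J.im - g.im * J.re)) * hB2
  rw [e1, e2]
  have hs : Real.sqrt (1 + ‖J‖ ^ 2) ^ 2 = 1 + ‖J‖ ^ 2 := Real.sq_sqrt (by positivity)
  rw [Real.sqrt_le_left (by positivity), ← sq_abs (m * wd g J)]
  have : m ^ 2 * ‖J‖ ^ 2 ≤ ‖J‖ ^ 2 := by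
    have : m ^ 2 ≤ 1 := by nlinarith
    nlinarith [sq_nonneg ‖J‖]
  have p1 := Real.sqrt_nonneg (1 + ‖J‖ ^ 2)
  have p2 := norm_nonneg g
  have p3 := abs_nonneg (m * wd g J)
  nlinarith [mul_nonneg p1 p2, mul_nonneg p1 p3, mul_nonneg p2 p3]

lemma unit_deriv {B : R2 → ℂ} {x : R2} (hB : DifferentiableAt ℝ B x)
    (h1 : ∀ᶠ y in 𝓝 x, ‖B y‖ = 1) (v : R2) : (fderiv ℝ B x v / B x).re = 0 := by
  have h2 : HasFDerivAt (fun y => ‖B y‖ ^ 2) (2 • (innerSL ℝ (B x)).comp (fderiv ℝ B x)) x :=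
    hB.hasFDerivAt.norm_sq
  have h3 : HasFDerivAt (fun y => ‖B y‖ ^ 2) (0 : R2 →L[ℝ] ℝ) x := by
    apply (hasFDerivAt_const (1 : ℝ) x).congr_of_eventuallyEq
    filter_upwards [h1] with y hy; rw [hy]; norm_num
  have h4 := congrArg (fun L : R2 →L[ℝ] ℝ => L v) (h2.unique h3)
  simp only [smul_apply, ContinuousLinearMap.comp_apply,
    zero_apply] at h4
  have h5 : (fderiv ℝ B x v * (starRingEnd ℂ) (B x)).re = 0 := by
    simp at h4 ⊢
    linarith
  rw [Complex.div_re]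
  simp at h5
  rw [← add_div]
  rw [div_eq_zero_iff]; left; linarith

lemma area_pt {B : R2 → ℂ} {m : R2 → ℝ} {x : R2} {m' : R2 →L[ℝ] ℝ}
    (hB : DifferentiableAt ℝ B x) (h1 : ∀ᶠ y in 𝓝 x, ‖B y‖ = 1)
    (hm : HasFDerivAt m m' x) (m0 : 0 ≤ m x) (m1 : m x ≤ 1) :
    Real.sqrt (1 + (∑ i, ∑ j, (jacobianMatrix (fun y => cx.symm (m y * B y)) x i j) ^ 2) +
      (jacobianMatrix (fun y => cx.symm (m y * B y)) x).det ^ 2) ≤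
    Real.sqrt (1 + ‖jf B x‖ ^ 2) + ‖(⟨m' (ee 0), m' (ee 1)⟩ : ℂ)‖ +
      |m x * wd ⟨m' (ee 0), m' (ee 1)⟩ (jf B x)| := by
  have hmc : HasFDerivAt (fun y => (m y : ℂ)) (Complex.ofRealCLM.comp m') x :=
    Complex.ofRealCLM.hasFDerivAt.comp x hm
  have hF := hmc.mul hB.hasFDerivAt
  have hx1 := h1.self_of_nhds
  have hx0 : B x ≠ 0 := by intro h; rw [h] at hx1; simp at hx1
  have hd (j : Fin 2) : fderiv ℝ (fun y => (m y : ℂ) * B y) x (ee j) =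
      B x * (m' (ee j) + m x * (fderiv ℝ B x (ee j) / B x).im * Complex.I) := by
    have h2 := unit_deriv hB h1 (ee j)
    have h3 : fderiv ℝ B x (ee j) = B x * ((fderiv ℝ B x (ee j) / B x).im * Complex.I) := by
      have h4 : fderiv ℝ B x (ee j) / B x = (fderiv ℝ B x (ee j) / B x).im * Complex.I := by
        apply Complex.ext <;> simp [h2]
      rw [← h4]; field_simp
    erw [hF.fderiv]
    simp only [add_apply, smul_apply, smul_eq_mul, ContinuousLinearMap.comp_apply,
      Complex.ofRealCLM_apply]
    conv_lhs => rw [h3]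
    ring
  have hjac := fun j => jac_symm (x := x) hF.differentiableAt j
  simp only [Matrix.det_fin_two, Fin.sum_univ_two]
  have e1 := fun j => (hjac j).1
  have e2 := fun j => (hjac j).2
  simp only [Pi.mul_apply] at e1 e2
  erw [e1, e1, e2, e2]
  exact area_alg hx1 m0 m1 (hd 0) (hd 1)

/-! ### Drilling -/

lemma drill {U : Set R2} (hUo : IsOpen U) (hU : Bornology.IsBounded U) {A : R2 → ℂ}
    (hA : ContDiffOn ℝ 1 A U) (hA1 : ∀ x ∈ U, ‖A x‖ = 1) (S : Finset R2) (s : R2 → Bool)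
    (hS : ∀ p ∈ S, p ∈ U) {ε : ℝ} (hε : 0 < ε) :
    ∃ f : R2 → R2, ContDiffOn ℝ 1 f U ∧
      ∫⁻ x in U, ‖cx (f x) - A x * ∏ p ∈ S, uv (vx (s p) p x)‖ₑ ≤ ENNReal.ofReal ε ∧
      classicalArea U f ≤ (∫⁻ x in U, ENNReal.ofReal
        (Real.sqrt (1 + ‖jf A x + ∑ p ∈ S, sr (s p) * jv p x‖ ^ 2))) +
        ENNReal.ofReal (Real.pi * S.card + ε) := by
  -- local bounds
  set B : R2 → ℂ := fun x => A x * ∏ p ∈ S, uv (vx (s p) p x) with hBdef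
  set J : R2 → ℂ := fun x => jf A x + ∑ p ∈ S, sr (s p) * jv p x with hJdef
  have hAd : ∀ x ∈ U, ContDiffAt ℝ 1 A x := fun x hx => hA.contDiffAt (hUo.mem_nhds hx)
  have hA0 : ∀ x ∈ U, A x ≠ 0 := fun x hx h => by have := hA1 x hx; rw [h] at this; simp at this
  have hbd : ∀ p ∈ S, ∃ K : ℝ, 0 ≤ K ∧ ∃ d : ℝ, 0 < d ∧ ∀ x, ‖x - p‖ ≤ d →
      ‖jf A x + ∑ q ∈ S.erase p, sr (s q) * jv q x‖ ≤ K := by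
    intro p hp
    have c0 (j : Fin 2) : ContinuousAt (fun x => (fderiv ℝ A x (ee j) / A x).im) p := by
      have h1 : ContinuousAt (fun x => fderiv ℝ A x (ee j)) p :=
        ((hAd p (hS p hp)).continuousAt_fderiv (by norm_num)).clm_apply continuousAt_const
      exact Complex.continuous_im.continuousAt.comp
        (h1.div (hAd p (hS p hp)).continuousAt (hA0 p (hS p hp)))
    have c1 : ContinuousAt (jf A) p := by
      have : jf A = fun x => (((fderiv ℝ A x (ee 0) / A x).im : ℝ) : ℂ) +
          (((fderiv ℝ A x (ee 1) / A x).im : ℝ) : ℂ) * Complex.I := by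
        ext x; exact Complex.mk_eq_add_mul_I _ _
      rw [this]
      exact ((Complex.continuous_ofReal.continuousAt).comp (c0 0)).add
        (((Complex.continuous_ofReal.continuousAt).comp (c0 1)).mul continuousAt_const)
    have c2 : ContinuousAt (fun x => jf A x + ∑ q ∈ S.erase p, sr (s q) * jv q x) p := by
      apply c1.add
      apply tendsto_finsetSum
      intro q hq
      apply ContinuousAt.mul continuousAt_const
      unfold jv
      apply ContinuousAt.div continuousAt_const
      · exact (Complex.continuous_conj.comp (cx.continuous.sub continuous_const)).continuousAt
      · rw [Ne, map_eq_zero, sub_eq_zero, cx.injective.eq_iff]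
        exact (Finset.ne_of_mem_erase hq).symm
    have c3 := c2.norm
    obtain ⟨d, hd, hd2⟩ := Metric.eventually_nhds_iff.1
      (c3.eventually (gt_mem_nhds (lt_add_one ‖jf A p + ∑ q ∈ S.erase p, sr (s q) * jv q p‖)))
    refine ⟨_, by positivity, d / 2, by positivity, fun x hx => (hd2 ?_).le⟩
    rw [dist_eq_norm]; linarith
  choose! K hK0 d hd0 hKd using hbd
  -- the small parameter
  set Kt : ℝ := ∑ p ∈ S, (2 * Real.pi * (1 + K p)) with hKt
  have hKt0 : 0 ≤ Kt := Finset.sum_nonneg fun p hp => by have := hK0 p hp; positivity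
  obtain ⟨δ, hδ, hδ1, hδ2, hδd⟩ : ∃ δ : ℝ, 0 < δ ∧ δ * Kt ≤ ε ∧
      (S.card : ℝ) * (Real.pi * δ ^ 2) ≤ ε ∧ ∀ p ∈ S, δ ≤ d p := by
    have t1 : ∀ᶠ δ : ℝ in 𝓝[>] 0, δ * Kt ≤ ε := by
      apply eventually_nhdsWithin_of_eventually_nhds
      have : Tendsto (fun δ : ℝ => δ * Kt) (𝓝 0) (𝓝 (0 * Kt)) :=
        (continuous_id.mul continuous_const).tendsto 0
      rw [zero_mul] at this
      exact (this.eventually (gt_mem_nhds hε)).mono fun _ h => h.le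
    have t2 : ∀ᶠ δ : ℝ in 𝓝[>] 0, (S.card : ℝ) * (Real.pi * δ ^ 2) ≤ ε := by
      apply eventually_nhdsWithin_of_eventually_nhds
      have : Tendsto (fun δ : ℝ => (S.card : ℝ) * (Real.pi * δ ^ 2)) (𝓝 0)
          (𝓝 ((S.card : ℝ) * (Real.pi * 0 ^ 2))) :=
        (by fun_prop : Continuous fun δ : ℝ => (S.card : ℝ) * (Real.pi * δ ^ 2)).tendsto 0
      have h2 : (S.card : ℝ) * (Real.pi * 0 ^ 2) = 0 := by ring
      rw [h2] at this
      exact (this.eventually (gt_mem_nhds hε)).mono fun _ h => h.le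
    have t3 : ∀ᶠ δ : ℝ in 𝓝[>] 0, ∀ p ∈ S, δ ≤ d p := by
      apply eventually_nhdsWithin_of_eventually_nhds
      rw [Filter.eventually_all_finset]
      intro p hp
      exact (gt_mem_nhds (hd0 p hp)).mono fun _ h => h.le
    obtain ⟨δ, h0, h1, h2, h3⟩ := ((eventually_mem_nhdsWithin (a := (0:ℝ)) (s := Ioi 0)).and (t1.and (t2.and t3))).exists
    exact ⟨δ, h0, h1, h2, h3⟩
  set m : R2 → ℝ := fun x => ∏ p ∈ S, mm δ p x with hmdef
  have mm0 (p x : R2) : 0 ≤ mm δ p x := Hh_nonneg _ _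
  have mm1 (p x : R2) : mm δ p x ≤ 1 := Hh_le_one _ _
  have m0 (x : R2) : 0 ≤ m x := Finset.prod_nonneg fun p _ => mm0 p x
  have m1 (x : R2) : m x ≤ 1 := Finset.prod_le_one (fun p _ => mm0 p x) fun p _ => mm1 p x
  have hmc : ContDiff ℝ 1 m := contDiff_prod fun p _ => contDiff_mm δ p
  have hBx : ∀ x ∈ U, x ∉ S → ContDiffAt ℝ 1 B x := by
    intro x hx hxS
    apply (hAd x hx).mul
    apply contDiffAt_prod
    intro p hp
    exact contDiffAt_uv (contDiff_vx _ _).contDiffAt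
      fun h => hxS (vx_eq_zero.1 h ▸ hp)
  have hnB : ∀ x ∈ U, x ∉ S → ‖B x‖ = 1 := by
    intro x hx hxS
    simp only [hBdef, norm_mul, hA1 x hx, norm_prod, one_mul]
    apply Finset.prod_eq_one
    intro p hp
    exact norm_uv fun h => hxS (vx_eq_zero.1 h ▸ hp)
  have hjB : ∀ x ∈ U, x ∉ S → jf B x = J x := by
    intro x hx hxS
    have gen : ∀ T : Finset R2, x ∉ T → DifferentiableAt ℝ (fun y => ∏ p ∈ T, uv (vx (s p) p y)) x ∧
        (∏ p ∈ T, uv (vx (s p) p x)) ≠ 0 ∧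
        jf (fun y => ∏ p ∈ T, uv (vx (s p) p y)) x = ∑ p ∈ T, sr (s p) * jv p x := by
      intro T
      induction T using Finset.induction_on with
      | empty =>
        intro _
        refine ⟨by simp, by simp, ?_⟩
        simp [jf]; rfl
      | insert p T hp ih =>
        intro hxT
        rw [Finset.mem_insert, not_or] at hxT
        obtain ⟨i1, i2, i3⟩ := ih hxT.2
        have hne : vx (s p) p x ≠ 0 := fun h => hxT.1 (vx_eq_zero.1 h)
        have d1 : DifferentiableAt ℝ (fun y => uv (vx (s p) p y)) x :=
          (contDiffAt_uv (n := 1) (contDiff_vx _ _).contDiffAt hne).differentiableAt (by norm_num)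
        have n1 : uv (vx (s p) p x) ≠ 0 := fun h => by
          have := norm_uv hne; rw [h] at this; simp at this
        simp only [Finset.prod_insert hp, Finset.sum_insert hp]
        refine ⟨d1.mul i1, mul_ne_zero n1 i2, ?_⟩
        rw [jf_mul d1 i1 n1 i2, i3, jf_uvvx _ hxT.1]
    obtain ⟨g1, g2, g3⟩ := gen S hxS
    simp only [hBdef, hJdef]
    rw [jf_mul ((hAd x hx).differentiableAt (by norm_num)) g1 (hA0 x hx) g2, g3]
  have hSc : IsClosed (S : Set R2) := S.finite_toSet.isClosed
  refine ⟨fun x => cx.symm ((m x : ℂ) * B x), ?_, ?_, ?_⟩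
  · intro x hx
    apply ContDiffAt.contDiffWithinAt
    apply cx.symm.contDiff.contDiffAt.comp x
    by_cases hxS : x ∈ S
    · have : (fun y => (m y : ℂ) * B y) =ᶠ[𝓝 x] fun _ => 0 := by
        filter_upwards [ball_mem_nhds x (half_pos hδ)] with y hy
        have : m y = 0 := by
          apply Finset.prod_eq_zero hxS
          apply Hh_eq_zero hδ (norm_nonneg _)
          rw [mem_ball, dist_eq_norm] at hy; exact hy.le
        rw [this]; simp
      exact contDiffAt_const.congr_of_eventuallyEq this
    · exact (Complex.ofRealCLM.contDiff.comp hmc).contDiffAt.mul (hBx x hx hxS)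
  · have hpt : ∀ x ∈ U, ‖cx (cx.symm ((m x : ℂ) * B x)) - B x‖ₑ ≤
        ∑ p ∈ S, (closedBall p δ).indicator 1 x := by
      intro x hx
      rw [LinearIsometryEquiv.apply_symm_apply]
      by_cases h : ∃ p ∈ S, x ∈ closedBall p δ
      · obtain ⟨p, hp, hxp⟩ := h
        have h1 : ‖(m x : ℂ) * B x - B x‖ ≤ 1 := by
          have : (m x : ℂ) * B x - B x = ((m x - 1 : ℝ) : ℂ) * B x := by push_cast; ring
          rw [this, norm_mul, Complex.norm_real, Real.norm_eq_abs]
          have hb : ‖B x‖ ≤ 1 := by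
            simp only [hBdef, norm_mul, hA1 x hx, norm_prod, one_mul]
            exact Finset.prod_le_one (fun _ _ => norm_nonneg _) fun _ _ => norm_uv_le _
          have ha : |m x - 1| ≤ 1 := by rw [abs_le]; constructor <;> linarith [m0 x, m1 x]
          exact mul_le_one₀ ha (norm_nonneg _) hb
        calc ‖(m x : ℂ) * B x - B x‖ₑ ≤ 1 := by
              rw [← ofReal_norm]; exact ENNReal.ofReal_le_one.2 h1
          _ = (closedBall p δ).indicator 1 x := by rw [indicator_of_mem hxp]; rfl
          _ ≤ _ := Finset.single_le_sum
                (f := fun p => (closedBall p δ).indicator (1 : R2 → ℝ≥0∞) x)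
                (fun _ _ => zero_le) hp
      · push Not at h
        have : m x = 1 := by
          apply Finset.prod_eq_one
          intro p hp
          apply Hh_eq_one hδ
          have := h p hp
          rw [mem_closedBall, not_le, dist_eq_norm] at this
          exact this.le
        rw [this]; simp
    calc _ ≤ ∫⁻ x in U, ∑ p ∈ S, (closedBall p δ).indicator 1 x :=
          setLIntegral_mono' hUo.measurableSet hpt
      _ ≤ ∫⁻ x, ∑ p ∈ S, (closedBall p δ).indicator 1 x := setLIntegral_le_lintegral _ _
      _ = ∑ p ∈ S, volume (closedBall p δ) := by
          rw [lintegral_finsetSum]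
          · exact Finset.sum_congr rfl fun p _ => lintegral_indicator_one measurableSet_closedBall
          · exact fun p _ => measurable_one.indicator measurableSet_closedBall
      _ = ∑ p ∈ S, ENNReal.ofReal (Real.pi * δ ^ 2) := by
          apply Finset.sum_congr rfl
          intro p _
          rw [EuclideanSpace.volume_closedBall_fin_two, ENNReal.ofReal_mul Real.pi_pos.le,
            ENNReal.ofReal_pow hδ.le, mul_comm]
      _ ≤ ENNReal.ofReal ε := by
          rw [Finset.sum_const, nsmul_eq_mul, ← ENNReal.ofReal_natCast, ← ENNReal.ofReal_mul (by positivity)]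
          exact ENNReal.ofReal_le_ofReal hδ2
  · -- the area
    have hpt : ∀ᵐ x ∂(volume.restrict U), ENNReal.ofReal (Real.sqrt (1 +
          (∑ i, ∑ j, (jacobianMatrix (fun y => cx.symm (m y * B y)) x i j) ^ 2) +
          (jacobianMatrix (fun y => cx.symm (m y * B y)) x).det ^ 2)) ≤
        ENNReal.ofReal (Real.sqrt (1 + ‖J x‖ ^ 2)) + ∑ p ∈ S,
          (ENNReal.ofReal (mm δ p x * kk δ ‖x - p‖) +
            ENNReal.ofReal (1 + K p) * ENNReal.ofReal (kk δ ‖x - p‖ * ‖x - p‖)) := by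
      have hn : ∀ᵐ x ∂(volume.restrict U), x ∉ (S : Set R2) :=
        measure_eq_zero_iff_ae_notMem.1
          (S.finite_toSet.measure_zero _)
      filter_upwards [ae_restrict_mem hUo.measurableSet, hn] with x hx hxS
      have hxS' : x ∉ S := hxS
      have hd := HasFDerivAt.finsetProd (u := S) (fun p _ => hasFDerivAt_mm δ p x)
      have hev : ∀ᶠ y in 𝓝 x, ‖B y‖ = 1 := by
        filter_upwards [hUo.mem_nhds hx, hSc.isOpen_compl.mem_nhds hxS] with y h1 h2
        exact hnB y h1 h2
      have key := area_pt ((hBx x hx hxS').differentiableAt (by norm_num)) hev hd (m0 x) (m1 x)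
      rw [hjB x hx hxS'] at key
      set c : R2 → ℝ := fun p => ∏ j ∈ S.erase p, mm δ j x with hc
      have c0 (p) : 0 ≤ c p := Finset.prod_nonneg fun p _ => mm0 p x
      have c1 (p) : c p ≤ 1 := Finset.prod_le_one (fun p _ => mm0 p x) fun p _ => mm1 p x
      have hmc' : ∀ p ∈ S, m x = mm δ p x * c p := fun p hp =>
        (Finset.mul_prod_erase S (fun p => mm δ p x) hp).symm
      set L : R2 →L[ℝ] ℝ := ∑ p ∈ S, c p • (kk δ ‖x - p‖ • innerSL ℝ (x - p)) with hL
      change Real.sqrt _ ≤ Real.sqrt (1 + ‖J x‖ ^ 2) + ‖(⟨L (ee 0), L (ee 1)⟩ : ℂ)‖ +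
        |m x * wd ⟨L (ee 0), L (ee 1)⟩ (J x)| at key
      have hg : (⟨L (ee 0), L (ee 1)⟩ : ℂ) =
          ∑ p ∈ S, ((c p * kk δ ‖x - p‖ : ℝ) : ℂ) * (cx x - cx p) := by
        apply Complex.ext
        · simp only [Complex.re_sum, Complex.re_ofReal_mul, Complex.sub_re, cx_re, hL,
            sum_apply, smul_apply, innerSL_apply_apply, smul_eq_mul]
          refine Finset.sum_congr rfl fun p _ => ?_
          rw [EuclideanSpace.inner_single_right]; simp [mul_assoc]
        · simp only [Complex.im_sum, Complex.im_ofReal_mul, Complex.sub_im, cx_im, hL,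
            sum_apply, smul_apply, innerSL_apply_apply, smul_eq_mul]
          refine Finset.sum_congr rfl fun p _ => ?_
          rw [EuclideanSpace.inner_single_right]; simp [mul_assoc]
      rw [hg] at key
      have hz (p : R2) : ‖cx x - cx p‖ = ‖x - p‖ := by rw [← map_sub, LinearIsometryEquiv.norm_map]
      have k0 (p : R2) : 0 ≤ kk δ ‖x - p‖ := kk_nonneg _ _
      have b1 : ‖∑ p ∈ S, ((c p * kk δ ‖x - p‖ : ℝ) : ℂ) * (cx x - cx p)‖ ≤
          ∑ p ∈ S, kk δ ‖x - p‖ * ‖x - p‖ := by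
        refine (norm_sum_le _ _).trans (Finset.sum_le_sum fun p _ => ?_)
        rw [norm_mul, Complex.norm_real, Real.norm_eq_abs, abs_of_nonneg (mul_nonneg (c0 p) (k0 p)), hz]
        apply mul_le_mul_of_nonneg_right _ (norm_nonneg _)
        exact mul_le_of_le_one_left (k0 p) (c1 p)
      have b2 : |m x * wd (∑ p ∈ S, ((c p * kk δ ‖x - p‖ : ℝ) : ℂ) * (cx x - cx p)) (J x)| ≤
          ∑ p ∈ S, (mm δ p x * kk δ ‖x - p‖ + K p * (kk δ ‖x - p‖ * ‖x - p‖)) := by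
        have e : m x * wd (∑ p ∈ S, ((c p * kk δ ‖x - p‖ : ℝ) : ℂ) * (cx x - cx p)) (J x) =
            ∑ p ∈ S, m x * c p * kk δ ‖x - p‖ * wd (cx x - cx p) (J x) := by
          unfold wd
          rw [Complex.re_sum, Complex.im_sum, Finset.sum_mul, Finset.sum_mul, ← Finset.sum_sub_distrib,
            Finset.mul_sum]
          refine Finset.sum_congr rfl fun p _ => ?_
          rw [Complex.re_ofReal_mul, Complex.im_ofReal_mul]
          ring
        rw [e]
        refine (Finset.abs_sum_le_sum_abs _ _).trans (Finset.sum_le_sum fun p hp => ?_)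
        have hxp : x ≠ p := fun h => hxS' (h ▸ hp)
        have hr : 0 < ‖x - p‖ := norm_pos_iff.2 (sub_ne_zero.2 hxp)
        set Jp : ℂ := jf A x + ∑ q ∈ S.erase p, sr (s q) * jv q x with hJp
        have hJ : J x = sr (s p) * jv p x + Jp := by
          simp only [hJdef, hJp]
          rw [← Finset.add_sum_erase S _ hp]; ring
        have hw : |wd (cx x - cx p) (J x)| ≤ 1 + ‖x - p‖ * ‖Jp‖ := by
          have e2 : wd (cx x - cx p) (J x) = wd (cx x - cx p) (sr (s p) * jv p x) +
              wd (cx x - cx p) Jp := by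
            rw [hJ]; unfold wd; rw [Complex.add_re, Complex.add_im]; ring
          rw [e2]
          refine (abs_add_le _ _).trans (add_le_add ?_ ?_)
          · refine (abs_wd_le _ _).trans ?_
            rw [hz, norm_mul, Complex.norm_real, Real.norm_eq_abs, abs_sr, norm_jv, one_mul,
              mul_inv_cancel₀ hr.ne']
          · refine (abs_wd_le _ _).trans ?_
            rw [hz]
        have hmc2 : m x * c p ≤ mm δ p x := by
          rw [hmc' p hp]
          have := mm0 p x
          have h3 := mul_le_one₀ (c1 p) (c0 p) (c1 p)
          nlinarith
        have hmc0 : 0 ≤ m x * c p := mul_nonneg (m0 x) (c0 p)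
        have hmc1 : m x * c p ≤ 1 := hmc2.trans (mm1 p x)
        rw [abs_mul, abs_of_nonneg (mul_nonneg hmc0 (k0 p))]
        by_cases hxd : δ < ‖x - p‖
        · rw [kk_eq_zero hδ hxd]; simp
        · have hKx := hKd p hp x ((not_lt.1 hxd).trans (hδd p hp))
          rw [← hJp] at hKx
          calc m x * c p * kk δ ‖x - p‖ * |wd (cx x - cx p) (J x)|
              ≤ m x * c p * kk δ ‖x - p‖ * (1 + ‖x - p‖ * K p) := by
                apply mul_le_mul_of_nonneg_left _ (mul_nonneg hmc0 (k0 p))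
                refine hw.trans ?_
                gcongr
            _ = (m x * c p) * kk δ ‖x - p‖ + (m x * c p) * (K p * (kk δ ‖x - p‖ * ‖x - p‖)) := by ring
            _ ≤ _ := by
                have q1 := mul_le_mul_of_nonneg_right hmc2 (k0 p)
                have q2 : (m x * c p) * (K p * (kk δ ‖x - p‖ * ‖x - p‖)) ≤
                    1 * (K p * (kk δ ‖x - p‖ * ‖x - p‖)) :=
                  mul_le_mul_of_nonneg_right hmc1
                    (mul_nonneg (hK0 p hp) (mul_nonneg (k0 p) hr.le))
                linarith
      have key2 := key.trans (add_le_add (add_le_add le_rfl b1) b2)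
      have e3 : ENNReal.ofReal (Real.sqrt (1 + ‖J x‖ ^ 2)) + ∑ p ∈ S,
          (ENNReal.ofReal (mm δ p x * kk δ ‖x - p‖) +
            ENNReal.ofReal (1 + K p) * ENNReal.ofReal (kk δ ‖x - p‖ * ‖x - p‖)) =
          ENNReal.ofReal (Real.sqrt (1 + ‖J x‖ ^ 2) + ∑ p ∈ S, (mm δ p x * kk δ ‖x - p‖ +
            (1 + K p) * (kk δ ‖x - p‖ * ‖x - p‖))) := by
        have nn : ∀ p ∈ S, 0 ≤ mm δ p x * kk δ ‖x - p‖ := fun p _ => mul_nonneg (mm0 p x) (k0 p)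
        have nn2 : ∀ p ∈ S, 0 ≤ (1 + K p) * (kk δ ‖x - p‖ * ‖x - p‖) := fun p hp =>
          mul_nonneg (by linarith [hK0 p hp]) (mul_nonneg (k0 p) (norm_nonneg _))
        rw [ENNReal.ofReal_add (Real.sqrt_nonneg _)
          (Finset.sum_nonneg fun p hp => add_nonneg (nn p hp) (nn2 p hp)),
          ENNReal.ofReal_sum_of_nonneg fun p hp => add_nonneg (nn p hp) (nn2 p hp)]
        congr 1
        refine Finset.sum_congr rfl fun p hp => ?_
        rw [ENNReal.ofReal_add (nn p hp) (nn2 p hp), ENNReal.ofReal_mul (p := 1 + K p) (by linarith [hK0 p hp])]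
      rw [e3]
      apply ENNReal.ofReal_le_ofReal
      refine key2.trans (le_of_eq ?_)
      rw [add_assoc, ← Finset.sum_add_distrib]
      congr 1
      refine Finset.sum_congr rfl fun p hp => ?_
      ring
    unfold classicalArea
    refine (lintegral_mono_ae hpt).trans ?_
    have ms (p : R2) : Measurable fun x : R2 => ENNReal.ofReal (mm δ p x * kk δ ‖x - p‖) :=
      ((contDiff_mm δ p).continuous.mul ((continuous_kk δ).comp (by fun_prop))).measurable.ennreal_ofReal
    have ms2 (p : R2) : Measurable fun x : R2 => ENNReal.ofReal (kk δ ‖x - p‖ * ‖x - p‖) :=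
      (((continuous_kk δ).comp (by fun_prop)).mul (by fun_prop)).measurable.ennreal_ofReal
    have ms3 (p : R2) : Measurable fun x : R2 => (ENNReal.ofReal (mm δ p x * kk δ ‖x - p‖) +
        ENNReal.ofReal (1 + K p) * ENNReal.ofReal (kk δ ‖x - p‖ * ‖x - p‖)) :=
      (ms p).add ((ms2 p).const_mul _)
    rw [lintegral_add_right _ (Finset.measurable_fun_sum _ fun p _ => ms3 p)]
    gcongr
    refine (setLIntegral_le_lintegral _ _).trans ?_
    rw [lintegral_finsetSum _ fun p _ => ms3 p]
    calc ∑ p ∈ S, ∫⁻ x, (ENNReal.ofReal (mm δ p x * kk δ ‖x - p‖) +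
            ENNReal.ofReal (1 + K p) * ENNReal.ofReal (kk δ ‖x - p‖ * ‖x - p‖))
        ≤ ∑ p ∈ S, ENNReal.ofReal (Real.pi + (1 + K p) * (2 * Real.pi * δ)) := by
          refine Finset.sum_le_sum fun p hp => ?_
          have := hK0 p hp
          rw [lintegral_add_left (ms p), lintegral_const_mul _ (ms2 p), lint_mm_kk hδ,
            ENNReal.ofReal_add Real.pi_pos.le (by positivity), ENNReal.ofReal_mul (by positivity)]
          gcongr
          exact lint_kk hδ p
      _ = ENNReal.ofReal (∑ p ∈ S, (Real.pi + (1 + K p) * (2 * Real.pi * δ))) := by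
          rw [ENNReal.ofReal_sum_of_nonneg]
          intro p hp
          have := hK0 p hp
          positivity
      _ ≤ _ := by
          apply ENNReal.ofReal_le_ofReal
          rw [Finset.sum_add_distrib, Finset.sum_const, nsmul_eq_mul, mul_comm]
          gcongr
          refine le_trans (le_of_eq ?_) hδ1
          rw [hKt, Finset.mul_sum]
          refine Finset.sum_congr rfl fun p hp => ?_
          ring

/-! ### Interior shifts near the boundary -/

lemma shift_local {Ω : Set R2} (hΩo : IsOpen Ω) (hΩl : HasLipschitzBoundary Ω) {p : R2}
    (hp : p ∈ closure Ω) : ∃ (e : R2) (r c d : ℝ), 0 < r ∧ 0 < c ∧ 0 < d ∧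
      ∀ δ, 0 < δ → δ < d → ∀ x ∈ Ω, x ∈ ball p r → closedBall (x + δ • e) (c * δ) ⊆ Ω := by
  by_cases hpo : p ∈ Ω
  · obtain ⟨r, hr, hb⟩ := Metric.isOpen_iff.1 hΩo p hpo
    refine ⟨0, r / 2, 1, r / 2, by positivity, one_pos, by positivity, ?_⟩
    intro δ hδ hd x _ hx y hy
    apply hb
    rw [smul_zero, add_zero, one_mul, mem_closedBall] at hy
    rw [mem_ball] at hx ⊢
    linarith [dist_triangle y x p]
  · have hpf : p ∈ frontier Ω := by rw [hΩo.frontier_eq]; exact ⟨hp, hpo⟩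
    obtain ⟨r, hr, f, γ, L, hγ, hf⟩ := hΩl p hpf
    set F := f.toRealAffineIsometryEquiv with hF
    have hFf (x : R2) : F x = f x := rfl
    set e : R2 := F.linearIsometryEquiv.symm (ee 1) with he
    have hene : ‖e‖ = 1 := by rw [he, LinearIsometryEquiv.norm_map]; simp [ee]
    have hadd (x : R2) (t : ℝ) : f (x + t • e) = f x + t • ee 1 := by
      have := F.map_vadd x (t • e)
      rw [vadd_eq_add, vadd_eq_add, hFf, hFf, map_smul, he,
        LinearIsometryEquiv.apply_symm_apply] at this
      rw [add_comm x, ← he] at *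
      rw [he, this, add_comm]
    set c : ℝ := 1 / (L + 1) with hc
    have hL : (0 : ℝ) ≤ L := L.2
    have hc0 : 0 < c := by positivity
    have hc1 : c * (L + 1) = 1 := by rw [hc]; field_simp
    have hcle : c ≤ 1 := by nlinarith
    refine ⟨e, r / 2, c, r / 4, by positivity, hc0, by positivity, ?_⟩
    intro δ hδ hd x hxΩ hx y hy
    rw [mem_closedBall] at hy
    rw [mem_ball] at hx
    have hxb : x ∈ ball p r := by rw [mem_ball]; linarith
    have h1 : dist (x + δ • e) x = δ := by
      rw [dist_eq_norm, add_sub_cancel_left, norm_smul, hene, mul_one, Real.norm_of_nonneg hδ.le]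
    have hyb : y ∈ ball p r := by
      rw [mem_ball]
      have := dist_triangle y (x + δ • e) x
      have := dist_triangle y x p
      nlinarith
    rw [hf y hyb]
    have hx2 := (hf x hxb).1 hxΩ
    have hdist : dist (f y) (f x + δ • ee 1) ≤ c * δ := by
      rw [← hadd, f.isometry.dist_eq]; exact hy
    have hcoord (i : Fin 2) : |f y i - (f x i + δ * (ee 1) i)| ≤ c * δ := by
      refine le_trans ?_ hdist
      rw [dist_eq_norm]
      have := EuclideanSpace.norm_eq (f y - (f x + δ • ee 1))
      have h3 := PiLp.norm_apply_le (f y - (f x + δ • ee 1)) i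
      simpa using h3
    have c0 := hcoord 0
    have c1 := hcoord 1
    simp [ee] at c0 c1
    rw [abs_le] at c1
    have hg := hγ.dist_le_mul (f y 0) (f x 0)
    rw [Real.dist_eq, Real.dist_eq] at hg
    have hg2 := (le_abs_self _).trans hg
    have : (L : ℝ) * |f y 0 - f x 0| ≤ L * (c * δ) := by gcongr
    have h5 : c * δ * (L + 1) = δ := by rw [mul_right_comm, hc1, one_mul]
    nlinarith [c1.1]

/-! ### Continuity of translations -/

lemma lint_translate_small {g : R2 → ℝ} (hg : Integrable g) {η : ℝ} (hη : 0 < η) :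
    ∃ d : ℝ, 0 < d ∧ ∀ y : R2, ‖y‖ ≤ d → ∫⁻ x, ‖g (x + y) - g x‖ₑ ≤ ENNReal.ofReal η := by
  obtain ⟨h, hcs, hgh, hcont, hIntg⟩ := hg.exists_hasCompactSupport_lintegral_sub_le
    (ε := ENNReal.ofReal (η / 3)) (by simpa using hη)
  obtain ⟨R, hR0, hR⟩ : ∃ R : ℝ, 0 < R ∧ tsupport h ⊆ closedBall 0 R := by
    obtain ⟨R, hR⟩ := hcs.isCompact.isBounded.subset_closedBall 0
    exact ⟨max R 1, by positivity, hR.trans (closedBall_subset_closedBall (le_max_left _ _))⟩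
  have hV : 0 < volume.real (closedBall (0 : R2) (R + 1)) + 1 := by positivity
  set V := volume.real (closedBall (0 : R2) (R + 1)) with hVd
  have huc := hcs.uniformContinuous_of_continuous hcont
  rw [Metric.uniformContinuous_iff] at huc
  obtain ⟨d, hd, hd2⟩ := huc (η / 3 / (V + 1)) (by positivity)
  refine ⟨min (d / 2) 1, by positivity, fun y hy => ?_⟩
  have hy1 : ‖y‖ ≤ 1 := hy.trans (min_le_right _ _)
  have hy2 : ‖y‖ < d := by linarith [hy.trans (min_le_left _ _)]
  have hmid : ∫⁻ x, ‖h (x + y) - h x‖ₑ ≤ ENNReal.ofReal (η / 3) := by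
    calc ∫⁻ x, ‖h (x + y) - h x‖ₑ
        ≤ ∫⁻ x, (closedBall (0 : R2) (R + 1)).indicator (fun _ => ENNReal.ofReal (η / 3 / (V + 1))) x := by
          apply lintegral_mono
          intro x
          beta_reduce
          by_cases hx : x ∈ closedBall (0 : R2) (R + 1)
          · rw [indicator_of_mem hx, ← ofReal_norm]
            apply ENNReal.ofReal_le_ofReal
            rw [← dist_eq_norm]
            apply (hd2 _).le
            rw [dist_eq_norm, add_sub_cancel_left]; exact hy2
          · rw [indicator_of_notMem hx]
            rw [mem_closedBall, dist_zero_right, not_le] at hx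
            have z (w : R2) (hw : R < ‖w‖) : h w = 0 := by
              apply image_eq_zero_of_notMem_tsupport
              intro hc
              have := hR hc
              rw [mem_closedBall, dist_zero_right] at this
              linarith
            have : ‖x‖ ≤ ‖x + y‖ + ‖y‖ := by simpa using norm_sub_le (x + y) y
            rw [z x (by linarith), z (x + y) (by linarith)]
            simp
      _ = ENNReal.ofReal (η / 3 / (V + 1)) * volume (closedBall (0 : R2) (R + 1)) := by
          rw [lintegral_indicator_const measurableSet_closedBall]
      _ = ENNReal.ofReal (η / 3 / (V + 1) * V) := by
          rw [ENNReal.ofReal_mul (by positivity), hVd, ofReal_measureReal measure_closedBall_lt_top.ne]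
      _ ≤ _ := by
          apply ENNReal.ofReal_le_ofReal
          rw [div_mul_eq_mul_div, div_le_iff₀ hV]
          nlinarith
  have hsh : ∫⁻ x, ‖g (x + y) - h (x + y)‖ₑ ≤ ENNReal.ofReal (η / 3) := by
    rw [lintegral_add_right_eq_self (fun x => ‖g x - h x‖ₑ) y]; exact hgh
  have m1 : AEMeasurable (fun x => ‖g (x + y) - h (x + y)‖ₑ) volume :=
    ((hg.comp_add_right y).sub (hIntg.comp_add_right y)).1.enorm
  have m2 : AEMeasurable (fun x => ‖h (x + y) - h x‖ₑ) volume :=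
    ((hIntg.comp_add_right y).sub hIntg).1.enorm
  have m12 : AEMeasurable (fun x => ‖g (x + y) - h (x + y)‖ₑ + ‖h (x + y) - h x‖ₑ) volume :=
    m1.add m2
  calc ∫⁻ x, ‖g (x + y) - g x‖ₑ
      ≤ ∫⁻ x, (‖g (x + y) - h (x + y)‖ₑ + ‖h (x + y) - h x‖ₑ + ‖g x - h x‖ₑ) := by
        apply lintegral_mono
        intro x
        have : g (x + y) - g x = (g (x + y) - h (x + y)) + (h (x + y) - h x) - (g x - h x) := by ring
        beta_reduce
        rw [this]
        exact (enorm_sub_le).trans (add_le_add (enorm_add_le _ _) le_rfl)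
    _ = (∫⁻ x, ‖g (x + y) - h (x + y)‖ₑ) + (∫⁻ x, ‖h (x + y) - h x‖ₑ) + (∫⁻ x, ‖g x - h x‖ₑ) := by
        rw [lintegral_add_left' m12, lintegral_add_left' m1]
    _ ≤ ENNReal.ofReal (η / 3) + ENNReal.ofReal (η / 3) + ENNReal.ofReal (η / 3) := by gcongr
    _ = ENNReal.ofReal η := by
        rw [← ENNReal.ofReal_add (by positivity) (by positivity),
          ← ENNReal.ofReal_add (by positivity) (by positivity)]
        congr 1; ring

/-! ### Mollification -/

/-- convolution of scalar functions -/
def cv (g ρ : R2 → ℝ) (x : R2) : ℝ :=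
  (convolution g ρ (ContinuousLinearMap.lsmul ℝ ℝ) volume) x

lemma cv_def (g ρ : R2 → ℝ) (x : R2) : cv g ρ x = ∫ t, g t * ρ (x - t) := rfl

lemma cv_swap (g ρ : R2 → ℝ) (x : R2) : cv g ρ x = ∫ t, g (x - t) * ρ t := by
  unfold cv; rw [convolution_lsmul_swap]; rfl

lemma cv_contDiff {g ρ : R2 → ℝ} (hg : Integrable g) (hρ : ContDiff ℝ (⊤ : ℕ∞) ρ)
    (hc : HasCompactSupport ρ) : ContDiff ℝ (⊤ : ℕ∞) (cv g ρ) :=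
  hc.contDiff_convolution_right _ hg.locallyIntegrable hρ

lemma cv_fderiv {g ρ : R2 → ℝ} (hg : Integrable g) (hρ : ContDiff ℝ (⊤ : ℕ∞) ρ)
    (hc : HasCompactSupport ρ) (x v : R2) :
    fderiv ℝ (cv g ρ) x v = ∫ t, g t * fderiv ℝ ρ (x - t) v := by
  have h1 : ContDiff ℝ 1 ρ := hρ.of_le (by exact_mod_cast le_top)
  have h := hc.hasFDerivAt_convolution_right (ContinuousLinearMap.lsmul ℝ ℝ)
    hg.locallyIntegrable h1 x
  have h2 : fderiv ℝ (cv g ρ) x = _ := h.fderiv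
  rw [h2, convolution_precompR_apply _ hg.locallyIntegrable (hc.fderiv ℝ)
    (h1.continuous_fderiv one_ne_zero)]
  rfl

lemma cv_weak {Ω : Set R2} (hΩo : IsOpen Ω) {u : R2 → R2} {G : R2 → Matrix (Fin 2) (Fin 2) ℝ}
    (hu : MemW11 Ω u G) {ρ : R2 → ℝ} (hρ : ContDiff ℝ (⊤ : ℕ∞) ρ) {a : ℝ}
    (hs : tsupport ρ ⊆ closedBall 0 a) {y : R2} (hy : closedBall y a ⊆ Ω) (i j : Fin 2) :
    fderiv ℝ (cv (Ω.indicator fun x => u x i) ρ) y (ee j) =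
      cv (Ω.indicator fun x => G x i j) ρ y := by
  have hc : HasCompactSupport ρ :=
    HasCompactSupport.of_support_subset_isCompact (isCompact_closedBall 0 a)
      ((subset_tsupport ρ).trans hs)
  have hui : Integrable (Ω.indicator fun x => u x i) := by
    rw [integrable_indicator_iff hΩo.measurableSet]
    exact (EuclideanSpace.proj (𝕜 := ℝ) i).integrable_comp hu.1
  rw [cv_fderiv hui hρ hc, cv_def]
  have hsup : tsupport (fun t => ρ (y - t)) ⊆ closedBall y a := by
    apply closure_minimal _ isClosed_closedBall
    intro t ht
    have := hs (subset_tsupport ρ (show ρ (y - t) ≠ 0 from ht))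
    rw [mem_closedBall, dist_zero_right] at this
    rw [mem_closedBall, dist_comm, dist_eq_norm]; exact this
  have hcy : HasCompactSupport (fun t => ρ (y - t)) :=
    HasCompactSupport.of_support_subset_isCompact (isCompact_closedBall y a)
      ((subset_tsupport _).trans hsup)
  have key := hu.2.2 (fun t => ρ (y - t)) (hρ.comp (contDiff_const.sub contDiff_id)) hcy
    (hsup.trans hy) i j
  have hd (t : R2) : fderiv ℝ (fun t => ρ (y - t)) t (ee j) = - fderiv ℝ ρ (y - t) (ee j) := by
    have h1 : HasFDerivAt ρ (fderiv ℝ ρ (y - t)) (y - t) :=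
      (hρ.differentiable (by simp)).differentiableAt.hasFDerivAt
    have h2 : HasFDerivAt (fun t : R2 => y - t) (-ContinuousLinearMap.id ℝ R2) t :=
      (hasFDerivAt_id t).const_sub y
    have h3 := (h1.comp t h2).fderiv
    rw [show (fun t => ρ (y - t)) = ρ ∘ (fun t => y - t) from rfl, h3]
    simp
  have ind (f g : R2 → ℝ) : ∫ t, Ω.indicator f t * g t = ∫ t in Ω, f t * g t := by
    rw [← integral_indicator hΩo.measurableSet]
    congr 1; ext t
    by_cases h : t ∈ Ω <;> simp [h]
  rw [ind, ind, eq_neg_iff_add_eq_zero.1 key |> fun _ => neg_eq_iff_eq_neg.2 key |>.symm]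
  rw [← integral_neg]
  congr 1; ext t
  have := hd t
  rw [show (EuclideanSpace.single j 1 : R2) = ee j from rfl, this]; ring

lemma cv_close {g : R2 → ℝ} (hg : Integrable g) {η d : ℝ}
    (hd : ∀ y : R2, ‖y‖ ≤ d → ∫⁻ x, ‖g (x + y) - g x‖ₑ ≤ ENNReal.ofReal η)
    {ρ : R2 → ℝ} (hρ : Continuous ρ) (h0 : ∀ x, 0 ≤ ρ x) (h1 : ∫ x, ρ x = 1) {a : ℝ}
    (hs : tsupport ρ ⊆ closedBall 0 a) {e : R2} (he : ‖e‖ + a ≤ d) :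
    ∫⁻ x, ‖cv g ρ (x + e) - g x‖ₑ ≤ ENNReal.ofReal η := by
  have hc : HasCompactSupport ρ :=
    HasCompactSupport.of_support_subset_isCompact (isCompact_closedBall 0 a)
      ((subset_tsupport ρ).trans hs)
  have hρi : Integrable ρ := hρ.integrable_of_hasCompactSupport hc
  -- measurable representative
  set g' := hg.1.mk g with hg'
  have hm : Measurable g' := hg.1.stronglyMeasurable_mk.measurable
  have hae : g =ᵐ[volume] g' := hg.1.ae_eq_mk
  have hcv : cv g ρ = cv g' ρ := by
    ext x; unfold cv; rw [convolution_congr _ hae (ae_eq_refl ρ)]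
  have hg'i : Integrable g' := hg.congr hae
  have hd' : ∀ y : R2, ‖y‖ ≤ d → ∫⁻ x, ‖g' (x + y) - g' x‖ₑ ≤ ENNReal.ofReal η := by
    intro y hy
    refine le_trans (le_of_eq ?_) (hd y hy)
    apply lintegral_congr_ae
    have h2 : (fun x => g (x + y)) =ᵐ[volume] fun x => g' (x + y) :=
      (measurePreserving_add_right volume y).quasiMeasurePreserving.ae_eq_comp hae
    filter_upwards [hae, h2] with x hx hx2
    rw [hx, hx2]
  have e1 : ∫⁻ x, ‖cv g ρ (x + e) - g x‖ₑ = ∫⁻ x, ‖cv g' ρ (x + e) - g' x‖ₑ := by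
    rw [hcv]
    apply lintegral_congr_ae
    filter_upwards [hae] with x hx
    rw [hx]
  rw [e1]
  have hpt : ∀ x, ‖cv g' ρ (x + e) - g' x‖ₑ ≤ ∫⁻ t, ‖(g' (x + (e - t)) - g' x) * ρ t‖ₑ := by
    intro x
    have hi1 : Integrable (fun t => g' (x + e - t) * ρ t) := by
      have h3 := hc.convolutionExists_right (ContinuousLinearMap.lsmul ℝ ℝ)
        (hg'i.locallyIntegrable) hρ (x + e)
      have h4 := h3.integrable_swap
      exact h4
    have e2 : cv g' ρ (x + e) - g' x = ∫ t, (g' (x + (e - t)) - g' x) * ρ t := by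
      rw [cv_swap]
      have : g' x = ∫ t, g' x * ρ t := by rw [integral_const_mul, h1, mul_one]
      conv_lhs => rw [this]
      rw [← integral_sub hi1 (hρi.const_mul _)]
      congr 1; ext t
      rw [add_sub_assoc]; ring
    rw [e2]
    exact enorm_integral_le_lintegral_enorm _
  calc ∫⁻ x, ‖cv g' ρ (x + e) - g' x‖ₑ
      ≤ ∫⁻ x, ∫⁻ t, ‖(g' (x + (e - t)) - g' x) * ρ t‖ₑ := lintegral_mono hpt
    _ = ∫⁻ t, ∫⁻ x, ‖(g' (x + (e - t)) - g' x) * ρ t‖ₑ := by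
        apply lintegral_lintegral_swap
        apply Measurable.aemeasurable
        apply Measurable.enorm
        have : Measurable ρ := hρ.measurable
        fun_prop
    _ ≤ ∫⁻ t, ENNReal.ofReal η * ENNReal.ofReal (ρ t) := by
        apply lintegral_mono
        intro t
        by_cases ht : ρ t = 0
        · simp [ht]
        · have : ‖t‖ ≤ a := by
            have := hs (subset_tsupport ρ (show ρ t ≠ 0 from ht))
            rwa [mem_closedBall, dist_zero_right] at this
          have h5 : ‖e - t‖ ≤ d := (norm_sub_le _ _).trans (by linarith)
          simp only [enorm_mul]
          rw [lintegral_mul_const _ (by fun_prop)]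
          rw [Real.enorm_of_nonneg (h0 t)]
          gcongr
          exact hd' _ h5
    _ = ENNReal.ofReal η := by
        rw [lintegral_const_mul _ hρ.measurable.ennreal_ofReal,
          ← ofReal_integral_eq_lintegral_ofReal hρi (Eventually.of_forall h0), h1]
        simp

/-! ### Density of smooth functions -/

lemma exists_pos_lb {ι : Type*} (t : Finset ι) (c : ι → ℝ) (h : ∀ p ∈ t, 0 < c p) :
    ∃ m : ℝ, 0 < m ∧ ∀ p ∈ t, m ≤ c p := by
  induction t using Finset.induction_on with
  | empty => exact ⟨1, one_pos, by simp⟩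
  | insert a t ha ih =>
    obtain ⟨m, hm, hm2⟩ := ih (fun p hp => h p (Finset.mem_insert_of_mem hp))
    refine ⟨min m (c a), lt_min hm (h a (Finset.mem_insert_self _ _)), ?_⟩
    intro p hp
    rcases Finset.mem_insert.1 hp with rfl | hp
    · exact min_le_right _ _
    · exact (min_le_left _ _).trans (hm2 p hp)

lemma exists_ub {ι : Type*} (t : Finset ι) (c : ι → ℝ) :
    ∃ m : ℝ, 0 < m ∧ ∀ p ∈ t, c p ≤ m := by
  induction t using Finset.induction_on with
  | empty => exact ⟨1, one_pos, by simp⟩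
  | insert a t ha ih =>
    obtain ⟨m, hm, hm2⟩ := ih
    refine ⟨max m (c a), lt_max_of_lt_left hm, ?_⟩
    intro p hp
    rcases Finset.mem_insert.1 hp with rfl | hp
    · exact le_max_right _ _
    · exact (hm2 p hp).trans (le_max_left _ _)

lemma exists_mollifier {a : ℝ} (ha : 0 < a) : ∃ ρ : R2 → ℝ, ContDiff ℝ (⊤ : ℕ∞) ρ ∧
    (∀ x, 0 ≤ ρ x) ∧ ∫ x, ρ x = 1 ∧ tsupport ρ ⊆ closedBall 0 a := by
  let b : ContDiffBump (0 : R2) := ⟨a / 2, a, by positivity, by linarith⟩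
  refine ⟨b.normed volume, b.contDiff_normed, b.nonneg_normed, b.integral_normed, ?_⟩
  rw [b.tsupport_normed_eq]

set_option maxHeartbeats 800000 in
lemma density_one {Ω : Set R2} (hΩo : IsOpen Ω) (hΩb : Bornology.IsBounded Ω)
    (hΩl : HasLipschitzBoundary Ω) {u : R2 → R2} {G : R2 → Matrix (Fin 2) (Fin 2) ℝ}
    (hu : MemW11 Ω u G) {η : ℝ} (hη : 0 < η) (i : Fin 2) : ∃ w : R2 → ℝ,
      ContDiff ℝ (⊤ : ℕ∞) w ∧ ∫⁻ x in Ω, ‖w x - u x i‖ₑ ≤ ENNReal.ofReal η ∧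
      ∀ j, ∫⁻ x in Ω, ‖fderiv ℝ w x (ee j) - G x i j‖ₑ ≤ ENNReal.ofReal η := by
  have hK : IsCompact (closure Ω) := hΩb.isCompact_closure
  choose! e r c d hr hc hd hsh using fun (p : R2) (hp : p ∈ closure Ω) => shift_local hΩo hΩl hp
  obtain ⟨t, htK, htc⟩ := hK.elim_nhds_subcover (fun p => ball p (r p))
    (fun p hp => ball_mem_nhds p (hr p hp))
  obtain ⟨f, hf⟩ := SmoothPartitionOfUnity.exists_isSubordinate
    (modelWithCornersSelf ℝ R2) (isClosed_closure (s := Ω))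
    (fun p : t => ball (p : R2) (r p)) (fun p => isOpen_ball) (by
      intro x hx
      have := htc hx
      simp only [mem_iUnion] at this ⊢
      obtain ⟨p, hp, h⟩ := this
      exact ⟨⟨p, hp⟩, h⟩)
  have hfC (p : t) : ContDiff ℝ (⊤ : ℕ∞) (f p) := contMDiff_iff_contDiff.1 (f p).contMDiff
  have hfd (p : t) (x : R2) : DifferentiableAt ℝ (f p) x :=
    ((hfC p).differentiable (by simp)).differentiableAt
  have hf0 (p : t) (x : R2) : 0 ≤ f p x := f.nonneg p x
  have hf1 (p : t) (x : R2) : f p x ≤ 1 := f.le_one p x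
  have hsum (x : R2) (hx : x ∈ closure Ω) : ∑ p, f p x = 1 := by
    rw [← finsum_eq_sum_of_fintype]; exact f.sum_eq_one hx
  have hdsum (x : R2) (hx : x ∈ Ω) (v : R2) : ∑ p, fderiv ℝ (f p) x v = 0 := by
    have h1 : HasFDerivAt (fun x => ∑ p, f p x) (∑ p, fderiv ℝ (f p) x) x :=
      HasFDerivAt.fun_sum fun p _ => (hfd p x).hasFDerivAt
    have h2 : HasFDerivAt (fun x => ∑ p, f p x) (0 : R2 →L[ℝ] ℝ) x := by
      apply (hasFDerivAt_const (1 : ℝ) x).congr_of_eventuallyEq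
      filter_upwards [hΩo.mem_nhds hx] with y hy
      exact hsum y (subset_closure hy)
    have := congrArg (fun L => L v) (h1.unique h2)
    simpa using this
  have hB (p : t) : ∃ B : ℝ, ∀ x ∈ closure Ω, ‖fderiv ℝ (f p) x‖ ≤ B :=
    hK.exists_bound_of_continuousOn ((hfC p).continuous_fderiv (by simp)).continuousOn
  choose B0 hB0 using hB
  obtain ⟨B, hBpos, hB⟩ := exists_ub Finset.univ B0
  obtain ⟨c0, hc0, hcl⟩ := exists_pos_lb t c (fun p hp => hc p (htK p hp))
  obtain ⟨d0, hd0, hdl⟩ := exists_pos_lb t d (fun p hp => hd p (htK p hp))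
  obtain ⟨E, hE0, hE⟩ := exists_ub t (fun p => ‖e p‖)
  set n : ℝ := (t.card : ℝ) with hn
  have hn0 : 0 ≤ n := by positivity
  set η' : ℝ := η / (n * (B + 1) + 1) with hη'
  have hη0 : 0 < η' := by positivity
  have hηn : n * (B + 1) * η' ≤ η := by
    rw [hη', mul_div_assoc', div_le_iff₀ (by positivity)]
    nlinarith [mul_nonneg hn0 (by positivity : 0 ≤ B + 1)]
  have hui : Integrable (Ω.indicator fun x => u x i) := by
    rw [integrable_indicator_iff hΩo.measurableSet]
    exact (EuclideanSpace.proj (𝕜 := ℝ) i).integrable_comp hu.1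
  have hGi (j : Fin 2) : Integrable (Ω.indicator fun x => G x i j) := by
    rw [integrable_indicator_iff hΩo.measurableSet]
    exact hu.2.1 i j
  obtain ⟨du, hdu, hdu2⟩ := lint_translate_small hui hη0
  choose dG hdG hdG2 using fun j => lint_translate_small (hGi j) hη0
  obtain ⟨dm, hdm, hdm2⟩ := exists_pos_lb Finset.univ dG (fun j _ => hdG j)
  set D := min du dm with hD
  have hDp : 0 < D := lt_min hdu hdm
  set δ : ℝ := min (d0 / 2) (D / (E + c0)) with hδ
  have hδp : 0 < δ := by positivity
  have hδd : δ < d0 := by linarith [min_le_left (d0 / 2) (D / (E + c0))]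
  have hδD : E * δ + c0 * δ ≤ D := by
    have : δ ≤ D / (E + c0) := min_le_right _ _
    rw [le_div_iff₀ (by positivity)] at this
    linarith
  obtain ⟨ρ, hρC, hρ0, hρ1, hρs⟩ := exists_mollifier (mul_pos hc0 hδp)
  have hρcs : HasCompactSupport ρ :=
    HasCompactSupport.of_support_subset_isCompact (isCompact_closedBall 0 (c0 * δ))
      ((subset_tsupport ρ).trans hρs)
  set w := cv (Ω.indicator fun x => u x i) ρ with hw
  have hwC : ContDiff ℝ (⊤ : ℕ∞) w := cv_contDiff hui hρC hρcs
  have hed (p : t) : ‖δ • e p‖ + c0 * δ ≤ D := by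
    rw [norm_smul, Real.norm_of_nonneg hδp.le]
    have := hE p p.2
    nlinarith
  have closeU (p : t) : ∫⁻ x in Ω, ‖w (x + δ • e p) - u x i‖ₑ ≤ ENNReal.ofReal η' := by
    calc ∫⁻ x in Ω, ‖w (x + δ • e p) - u x i‖ₑ
        = ∫⁻ x in Ω, ‖w (x + δ • e p) - Ω.indicator (fun x => u x i) x‖ₑ := by
          apply setLIntegral_congr_fun hΩo.measurableSet
          intro x hx
          simp [hx]
      _ ≤ ∫⁻ x, ‖w (x + δ • e p) - Ω.indicator (fun x => u x i) x‖ₑ := setLIntegral_le_lintegral _ _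
      _ ≤ _ := cv_close hui hdu2 hρC.continuous hρ0 hρ1 hρs ((hed p).trans (min_le_left _ _))
  have closeG (p : t) (j : Fin 2) :
      ∫⁻ x in Ω, ‖cv (Ω.indicator fun x => G x i j) ρ (x + δ • e p) - G x i j‖ₑ ≤
        ENNReal.ofReal η' := by
    calc ∫⁻ x in Ω, ‖cv (Ω.indicator fun x => G x i j) ρ (x + δ • e p) - G x i j‖ₑ
        = ∫⁻ x in Ω, ‖cv (Ω.indicator fun x => G x i j) ρ (x + δ • e p)
            - Ω.indicator (fun x => G x i j) x‖ₑ := by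
          apply setLIntegral_congr_fun hΩo.measurableSet
          intro x hx
          simp [hx]
      _ ≤ ∫⁻ x, ‖cv (Ω.indicator fun x => G x i j) ρ (x + δ • e p)
            - Ω.indicator (fun x => G x i j) x‖ₑ := setLIntegral_le_lintegral _ _
      _ ≤ _ := cv_close (hGi j) (hdG2 j) hρC.continuous hρ0 hρ1 hρs
          ((hed p).trans ((min_le_right _ _).trans (hdm2 j (Finset.mem_univ _))))
  have hui' : AEMeasurable (fun x => u x i) (volume.restrict Ω) :=
    ((EuclideanSpace.proj (𝕜 := ℝ) i).integrable_comp hu.1).1.aemeasurable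
  have mU (p : t) : AEMeasurable (fun x => ‖w (x + δ • e p) - u x i‖ₑ) (volume.restrict Ω) := by
    have : Measurable (fun x => w (x + δ • e p)) :=
      (hwC.continuous.comp (continuous_id.add continuous_const)).measurable
    exact (this.aemeasurable.sub hui').enorm
  have mG (p : t) (j : Fin 2) :
      AEMeasurable (fun x => ‖cv (Ω.indicator fun x => G x i j) ρ (x + δ • e p) - G x i j‖ₑ)
        (volume.restrict Ω) := by
    have : Measurable (fun x => cv (Ω.indicator fun x => G x i j) ρ (x + δ • e p)) :=
      ((cv_contDiff (hGi j) hρC hρcs).continuous.comp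
        (continuous_id.add continuous_const)).measurable
    exact (this.aemeasurable.sub (hu.2.1 i j).1.aemeasurable).enorm
  have hwd (p : t) (x : R2) : HasFDerivAt (fun x => w (x + δ • e p))
      (fderiv ℝ w (x + δ • e p)) x := by
    have h1 : HasFDerivAt w (fderiv ℝ w (x + δ • e p)) (x + δ • e p) :=
      (hwC.differentiable (by simp)).differentiableAt.hasFDerivAt
    exact h1.comp x ((hasFDerivAt_id x).add_const (δ • e p))
  refine ⟨fun x => ∑ p, f p x * w (x + δ • e p), ?_, ?_, ?_⟩
  · apply ContDiff.sum
    intro p _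
    exact (hfC p).mul (hwC.comp (contDiff_id.add contDiff_const))
  · calc ∫⁻ x in Ω, ‖(∑ p, f p x * w (x + δ • e p)) - u x i‖ₑ
        ≤ ∫⁻ x in Ω, ∑ p : t, ‖w (x + δ • e p) - u x i‖ₑ := by
          apply setLIntegral_mono' hΩo.measurableSet
          intro x hx
          have : (∑ p, f p x * w (x + δ • e p)) - u x i
              = ∑ p, f p x * (w (x + δ • e p) - u x i) := by
            simp only [mul_sub]
            rw [Finset.sum_sub_distrib, ← Finset.sum_mul, hsum x (subset_closure hx), one_mul]
          rw [this]
          refine (enorm_sum_le _ _).trans (Finset.sum_le_sum fun p _ => ?_)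
          rw [enorm_mul]
          refine mul_le_of_le_one_left (zero_le) ?_
          rw [Real.enorm_of_nonneg (hf0 p x)]
          simpa using hf1 p x
      _ = ∑ p : t, ∫⁻ x in Ω, ‖w (x + δ • e p) - u x i‖ₑ := lintegral_finsetSum' _ fun p _ => mU p
      _ ≤ ∑ p : t, ENNReal.ofReal η' := Finset.sum_le_sum fun p _ => closeU p
      _ = ENNReal.ofReal (n * η') := by
          rw [Finset.sum_const, Finset.card_univ, Fintype.card_coe, nsmul_eq_mul,
            ENNReal.ofReal_mul hn0, hn, ENNReal.ofReal_natCast]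
      _ ≤ _ := by
          apply ENNReal.ofReal_le_ofReal
          nlinarith [mul_nonneg hn0 (mul_pos hBpos hη0).le]
  · intro j
    calc ∫⁻ x in Ω, ‖fderiv ℝ (fun x => ∑ p, f p x * w (x + δ • e p)) x (ee j) - G x i j‖ₑ
        ≤ ∫⁻ x in Ω, ∑ p : t, (ENNReal.ofReal B * ‖w (x + δ • e p) - u x i‖ₑ +
            ‖cv (Ω.indicator fun x => G x i j) ρ (x + δ • e p) - G x i j‖ₑ) := by
          apply setLIntegral_mono' hΩo.measurableSet
          intro x hx
          have hder : HasFDerivAt (fun x => ∑ p, f p x * w (x + δ • e p))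
              (∑ p, (f p x • fderiv ℝ w (x + δ • e p) + w (x + δ • e p) • fderiv ℝ (f p) x)) x :=
            HasFDerivAt.fun_sum fun p _ => (hfd p x).hasFDerivAt.mul (hwd p x)
          have hweak (p : t) : f p x * fderiv ℝ w (x + δ • e p) (ee j) =
              f p x * cv (Ω.indicator fun x => G x i j) ρ (x + δ • e p) := by
            by_cases h0 : f p x = 0
            · rw [h0]; simp
            · congr 1
              have hxb : x ∈ ball (p : R2) (r p) := hf p (subset_tsupport _ h0)
              apply cv_weak hΩo hu hρC hρs
              refine (closedBall_subset_closedBall ?_).trans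
                (hsh p (htK p p.2) δ hδp (hδd.trans_le (hdl p p.2)) x hx hxb)
              exact mul_le_mul_of_nonneg_right (hcl p p.2) hδp.le
          have : fderiv ℝ (fun x => ∑ p, f p x * w (x + δ • e p)) x (ee j) - G x i j
              = ∑ p, (fderiv ℝ (f p) x (ee j) * (w (x + δ • e p) - u x i) +
                f p x * (cv (Ω.indicator fun x => G x i j) ρ (x + δ • e p) - G x i j)) := by
            rw [hder.fderiv]
            simp only [mul_sub, FunLike.coe_sum, Finset.sum_apply, ContinuousLinearMap.add_apply,
              ContinuousLinearMap.smul_apply, smul_eq_mul, hweak]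
            simp only [Finset.sum_add_distrib, Finset.sum_sub_distrib]
            rw [← Finset.sum_mul, hdsum x hx, ← Finset.sum_mul, hsum x (subset_closure hx)]
            simp only [mul_comm (w _)]
            ring
          rw [this]
          refine (enorm_sum_le _ _).trans (Finset.sum_le_sum fun p _ => ?_)
          refine (enorm_add_le _ _).trans (add_le_add ?_ ?_)
          · rw [enorm_mul]
            gcongr
            rw [← ofReal_norm]
            apply ENNReal.ofReal_le_ofReal
            refine (ContinuousLinearMap.le_opNorm _ _).trans ?_
            have : ‖ee j‖ = 1 := by simp [ee]
            rw [this, mul_one]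
            exact (hB0 p x (subset_closure hx)).trans (hB p (Finset.mem_univ _))
          · rw [enorm_mul]
            refine mul_le_of_le_one_left (zero_le) ?_
            rw [Real.enorm_of_nonneg (hf0 p x)]
            simpa using hf1 p x
      _ = ∑ p : t, ∫⁻ x in Ω, (ENNReal.ofReal B * ‖w (x + δ • e p) - u x i‖ₑ +
            ‖cv (Ω.indicator fun x => G x i j) ρ (x + δ • e p) - G x i j‖ₑ) :=
          lintegral_finsetSum' _ fun p _ => ((mU p).const_mul _).add (mG p j)
      _ ≤ ∑ p : t, (ENNReal.ofReal B * ENNReal.ofReal η' + ENNReal.ofReal η') := by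
          refine Finset.sum_le_sum fun p _ => ?_
          rw [lintegral_add_left' ((mU p).const_mul _), lintegral_const_mul'' _ (mU p)]
          gcongr
          · exact closeU p
          · exact closeG p j
      _ = ENNReal.ofReal (n * (B + 1) * η') := by
          rw [Finset.sum_const, Finset.card_univ, Fintype.card_coe, nsmul_eq_mul, mul_assoc,
            ENNReal.ofReal_mul hn0, hn, ENNReal.ofReal_natCast, ← ENNReal.ofReal_mul hBpos.le,
            ← ENNReal.ofReal_add (by positivity) hη0.le]
          congr 2; ring
      _ ≤ _ := ENNReal.ofReal_le_ofReal hηn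

/-! ### Averaging over small translations -/

lemma vol_ball (r : ℝ) (hr : 0 < r) : volume (ball (0 : R2) r) = ENNReal.ofReal (Real.pi * r ^ 2) := by
  rw [Measure.addHaar_ball volume 0 hr.le]
  have h := vol_ball_one
  have h2 : volume (ball (0 : R2) 1) = ENNReal.ofReal Real.pi := by
    rw [← h, ofReal_measureReal measure_ball_lt_top.ne]
  rw [h2, ← ENNReal.ofReal_mul (by positivity)]
  congr 1
  simp; ring

lemma avg_inv (y : ℂ) {r : ℝ} (hr : 0 < r) :
    ∫⁻ a in ball (0 : R2) r, ‖(y - cx a)⁻¹‖ₑ ≤ ENNReal.ofReal (3 * Real.pi * r) := by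
  set p := cx.symm y with hp
  have hn (a : R2) : ‖(y - cx a)⁻¹‖ₑ = ENNReal.ofReal (‖a - p‖⁻¹) := by
    rw [← ofReal_norm, norm_inv]
    congr 2
    rw [← cx.norm_map (a - p), map_sub, hp, LinearIsometryEquiv.apply_symm_apply, norm_sub_rev]
  simp only [hn]
  calc ∫⁻ a in ball (0 : R2) r, ENNReal.ofReal (‖a - p‖⁻¹)
      ≤ (∫⁻ a in ball (0 : R2) r ∩ ball p r, ENNReal.ofReal (‖a - p‖⁻¹))
        + ∫⁻ a in ball (0 : R2) r \ ball p r, ENNReal.ofReal (‖a - p‖⁻¹) := by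
        rw [lintegral_inter_add_sdiff _ _ measurableSet_ball]
    _ ≤ (∫⁻ a in ball p r, ENNReal.ofReal (‖a - p‖⁻¹))
        + ∫⁻ a in ball (0 : R2) r, ENNReal.ofReal (r⁻¹) := by
        apply add_le_add
        · exact lintegral_mono_set inter_subset_right
        · refine le_trans (setLIntegral_mono' (measurableSet_ball.diff measurableSet_ball) ?_)
            (lintegral_mono_set sdiff_subset)
          intro a ha
          apply ENNReal.ofReal_le_ofReal
          have := ha.2
          rw [mem_ball, dist_eq_norm, not_lt] at this
          exact inv_anti₀ hr this
    _ = ENNReal.ofReal (3 * Real.pi * r) := by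
        rw [lint_inv_ball p hr, lintegral_const, Measure.restrict_apply_univ, vol_ball r hr,
          ← ENNReal.ofReal_mul (by positivity), ← ENNReal.ofReal_add (by positivity) (by positivity)]
        congr 1
        field_simp; ring

lemma avg_far (y U : ℂ) (hU : ‖U‖ = 1) {r : ℝ} (hr : 0 < r) :
    ∫⁻ a in ball (0 : R2) r, ‖(y - cx a)⁻¹ - (starRingEnd ℂ) U‖ₑ ≤
      ENNReal.ofReal (3 * Real.pi * r + Real.pi * r ^ 2) := by
  have hcU : ‖(starRingEnd ℂ) U‖ₑ = 1 := by
    rw [← ofReal_norm, RCLike.norm_conj, hU, ENNReal.ofReal_one]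
  calc ∫⁻ a in ball (0 : R2) r, ‖(y - cx a)⁻¹ - (starRingEnd ℂ) U‖ₑ
      ≤ ∫⁻ a in ball (0 : R2) r, (‖(y - cx a)⁻¹‖ₑ + 1) := by
        apply lintegral_mono
        intro a
        beta_reduce
        rw [← hcU]; exact enorm_sub_le
    _ = (∫⁻ a in ball (0 : R2) r, ‖(y - cx a)⁻¹‖ₑ) + volume (ball (0 : R2) r) := by
        rw [lintegral_add_right _ measurable_const, lintegral_const, Measure.restrict_apply_univ,
          one_mul]
    _ ≤ _ := by
        rw [ENNReal.ofReal_add (by positivity) (by positivity), vol_ball r hr]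
        gcongr
        exact avg_inv y hr

lemma avg_near (y U : ℂ) (hU : ‖U‖ = 1) {r : ℝ} (hr : 0 < r) (hr4 : r ≤ 1 / 4) (hy : ‖y - U‖ ≤ r) :
    ∫⁻ a in ball (0 : R2) r, ‖(y - cx a)⁻¹ - (starRingEnd ℂ) U‖ₑ ≤
      ENNReal.ofReal (4 * r * (Real.pi * r ^ 2)) := by
  calc ∫⁻ a in ball (0 : R2) r, ‖(y - cx a)⁻¹ - (starRingEnd ℂ) U‖ₑ
      ≤ ∫⁻ a in ball (0 : R2) r, ENNReal.ofReal (4 * r) := by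
        apply setLIntegral_mono' measurableSet_ball
        intro a ha
        rw [← ofReal_norm]
        apply ENNReal.ofReal_le_ofReal
        rw [mem_ball, dist_zero_right] at ha
        have hca : ‖cx a‖ = ‖a‖ := cx.norm_map a
        have hd : ‖U - (y - cx a)‖ ≤ 2 * r := by
          have : U - (y - cx a) = -(y - U) + cx a := by ring
          rw [this]
          refine (norm_add_le _ _).trans ?_
          rw [norm_neg]; linarith
        have hlow : 1 / 2 ≤ ‖y - cx a‖ := by
          have := norm_sub_norm_le U (y - cx a)
          linarith
        have hne : y - cx a ≠ 0 := by
          intro h; rw [h, norm_zero] at hlow; linarith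
        have hUc : U * (starRingEnd ℂ) U = 1 := by
          rw [Complex.mul_conj, Complex.normSq_eq_norm_sq, hU]; simp
        have e : (y - cx a)⁻¹ - (starRingEnd ℂ) U =
            (U - (y - cx a)) * (starRingEnd ℂ) U * (y - cx a)⁻¹ := by
          rw [sub_mul, hUc]; field_simp
        rw [e, norm_mul, norm_mul, RCLike.norm_conj, hU, mul_one, norm_inv]
        have h3 : ‖y - cx a‖⁻¹ ≤ 2 := by
          rw [inv_le_comm₀ (by linarith) (by norm_num)]; linarith
        have := mul_le_mul hd h3 (by positivity) (by positivity)
        linarith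
    _ = _ := by
        rw [lintegral_const, Measure.restrict_apply_univ, vol_ball r hr,
          ← ENNReal.ofReal_mul (by positivity)]

lemma exists_good {α : Type*} [MeasurableSpace α] {μ : Measure α} {F : α → ℝ≥0∞} {N S : Set α}
    (hN : μ N = 0) (hS : MeasurableSet S) {B K : ℝ≥0∞} (h : ∫⁻ a in S, F a ∂μ ≤ B)
    (hK : B < K * μ S) : ∃ a ∈ S, a ∉ N ∧ F a ≤ K := by
  by_contra! hc
  have : ∫⁻ a in S, K ∂μ ≤ ∫⁻ a in S, F a ∂μ := by
    apply lintegral_mono_ae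
    have h1 : ∀ᵐ a ∂(μ.restrict S), a ∉ N := by
      apply ae_restrict_of_ae
      exact measure_eq_zero_iff_ae_notMem.1 hN
    filter_upwards [h1, ae_restrict_mem hS] with a ha haS
    exact (hc a haS ha).le
  rw [lintegral_const, Measure.restrict_apply_univ] at this
  exact absurd (hK.trans_le (this.trans h)) (lt_irrefl _)

lemma norm_uv_sub_le (w U : ℂ) (hU : ‖U‖ = 1) : ‖uv w - U‖ ≤ 2 * ‖w - U‖ := by
  have h1 : ‖uv w - w‖ ≤ ‖w - U‖ := by
    by_cases hw : w = 0
    · subst hw; simp [uv]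
    · have : uv w - w = (1 - ‖w‖ : ℝ) * uv w := by
        have hne : (‖w‖ : ℂ) ≠ 0 := by exact_mod_cast norm_ne_zero_iff.2 hw
        unfold uv; push_cast; field_simp
      rw [this, norm_mul, norm_uv hw, mul_one, Complex.norm_real, Real.norm_eq_abs, ← hU,
        abs_sub_comm]
      exact abs_norm_sub_norm_le _ _
  calc ‖uv w - U‖ = ‖(uv w - w) + (w - U)‖ := by ring_nf
    _ ≤ _ := (norm_add_le _ _).trans (by linarith)

/-- pointwise comparison of currents -/
lemma jf_sub_wf_le (v : R2 → ℂ) (u : R2 → R2) (G : R2 → Matrix (Fin 2) (Fin 2) ℝ) (b : ℂ) (x : R2) :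
    ‖jf (fun y => v y - b) x - wf u G x‖ₑ ≤
      ∑ j, (‖fderiv ℝ v x (ee j) - ⟨G x 0 j, G x 1 j⟩‖ₑ * ‖(v x - b)⁻¹‖ₑ +
        ‖(⟨G x 0 j, G x 1 j⟩ : ℂ)‖ₑ * ‖(v x - b)⁻¹ - (starRingEnd ℂ) (cx (u x))‖ₑ) := by
  have hfd : fderiv ℝ (fun y => v y - b) x = fderiv ℝ v x := fderiv_sub_const b
  set D := fun j => fderiv ℝ v x (ee j) with hD
  set g : Fin 2 → ℂ := fun j => ⟨G x 0 j, G x 1 j⟩ with hg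
  have key (j : Fin 2) : ‖((D j / (v x - b)).im - (g j * (starRingEnd ℂ) (cx (u x))).im : ℝ)‖ₑ ≤
      ‖D j - g j‖ₑ * ‖(v x - b)⁻¹‖ₑ + ‖g j‖ₑ * ‖(v x - b)⁻¹ - (starRingEnd ℂ) (cx (u x))‖ₑ := by
    rw [← Complex.sub_im]
    have : D j / (v x - b) - g j * (starRingEnd ℂ) (cx (u x)) =
      (D j - g j) * (v x - b)⁻¹ + g j * ((v x - b)⁻¹ - (starRingEnd ℂ) (cx (u x))) := by
      rw [div_eq_mul_inv]; ring
    rw [← enorm_mul, ← enorm_mul]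
    refine le_trans ?_ (enorm_add_le _ _)
    rw [← this, ← ofReal_norm, ← ofReal_norm]
    exact ENNReal.ofReal_le_ofReal (Complex.abs_im_le_norm _)
  have e : jf (fun y => v y - b) x - wf u G x =
      (((D 0 / (v x - b)).im - (g 0 * (starRingEnd ℂ) (cx (u x))).im : ℝ) : ℂ) +
      (((D 1 / (v x - b)).im - (g 1 * (starRingEnd ℂ) (cx (u x))).im : ℝ) : ℂ) * Complex.I := by
    unfold jf wf
    rw [hfd]
    apply Complex.ext
    · simp [hD, hg, cx_re, cx_im]; ring
    · simp [hD, hg, cx_re, cx_im]; ring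
  rw [e, Fin.sum_univ_two]
  refine (enorm_add_le _ _).trans (add_le_add ?_ ?_)
  · refine le_trans (le_of_eq ?_) (key 0)
    rw [← ofReal_norm, ← ofReal_norm, Complex.norm_real]
  · refine le_trans (le_of_eq ?_) (key 1)
    rw [← ofReal_norm, ← ofReal_norm, norm_mul, Complex.norm_I, mul_one, Complex.norm_real]

lemma sard_cx {v : R2 → ℂ} (hv : ContDiff ℝ (⊤ : ℕ∞) v) : ∃ N : Set R2, volume N = 0 ∧
    ∀ a ∉ N, ∀ x, v x = cx a → ∀ h, fderiv ℝ v x h = 0 → h = 0 := by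
  set V : R2 → R2 := fun x => cx.symm (v x) with hV
  set L : ℂ →L[ℝ] R2 := cx.symm.toContinuousLinearEquiv.toContinuousLinearMap with hL
  set V' : R2 → R2 →L[ℝ] R2 := fun x => L.comp (fderiv ℝ v x) with hV'
  have hd (x : R2) : HasFDerivAt V (V' x) x :=
    L.hasFDerivAt.comp x (hv.differentiable (by simp)).differentiableAt.hasFDerivAt
  set s := {x | (V' x).det = 0} with hs
  refine ⟨V '' s, addHaar_image_eq_zero_of_det_fderivWithin_eq_zero volume
    (fun x _ => (hd x).hasFDerivWithinAt) (fun x hx => hx), ?_⟩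
  intro a ha x hx h hh
  have hns : x ∉ s := by
    intro hxs
    apply ha
    refine ⟨x, hxs, ?_⟩
    rw [hV]; simp [hx]
  have hdet : LinearMap.det (V' x : R2 →ₗ[ℝ] R2) ≠ 0 := hns
  have h0 : (V' x : R2 →ₗ[ℝ] R2) h = 0 := by
    show L (fderiv ℝ v x h) = 0
    rw [hh, map_zero]
  exact (LinearMap.equivOfDetNeZero _ hdet).map_eq_zero_iff.1 h0

lemma avg_j {μ : Measure R2} [SFinite μ] {D g V U : R2 → ℂ} (hD : AEMeasurable D μ) (hg : AEMeasurable g μ)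
    (hV : AEMeasurable V μ) (hU : AEMeasurable U μ) (hU1 : ∀ᵐ x ∂μ, ‖U x‖ = 1) {r : ℝ} (hr : 0 < r)
    (hr4 : r ≤ 1 / 4) {E : Set R2} (hE : MeasurableSet E) (hE2 : ∀ x ∉ E, ‖V x - U x‖ ≤ r) :
    ∫⁻ a in ball (0 : R2) r, ∫⁻ x, (‖D x‖ₑ * ‖(V x - cx a)⁻¹‖ₑ +
      ‖g x‖ₑ * ‖(V x - cx a)⁻¹ - (starRingEnd ℂ) (U x)‖ₑ) ∂μ ≤
      ENNReal.ofReal (3 * Real.pi * r) * (∫⁻ x, ‖D x‖ₑ ∂μ) +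
      (ENNReal.ofReal (4 * r * (Real.pi * r ^ 2)) * (∫⁻ x, ‖g x‖ₑ ∂μ) +
      ENNReal.ofReal (3 * Real.pi * r + Real.pi * r ^ 2) * (∫⁻ x in E, ‖g x‖ₑ ∂μ)) := by
  have hcx : Measurable (fun a : R2 => cx a) := cx.continuous.measurable
  rw [lintegral_lintegral_swap]
  · calc ∫⁻ x, (∫⁻ a in ball (0 : R2) r, (‖D x‖ₑ * ‖(V x - cx a)⁻¹‖ₑ +
          ‖g x‖ₑ * ‖(V x - cx a)⁻¹ - (starRingEnd ℂ) (U x)‖ₑ)) ∂μ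
        ≤ ∫⁻ x, (ENNReal.ofReal (3 * Real.pi * r) * ‖D x‖ₑ +
            (ENNReal.ofReal (4 * r * (Real.pi * r ^ 2)) * ‖g x‖ₑ +
             E.indicator (fun x => ENNReal.ofReal (3 * Real.pi * r + Real.pi * r ^ 2) * ‖g x‖ₑ) x)) ∂μ := by
          apply lintegral_mono_ae
          filter_upwards [hU1] with x hx
          have m1 : Measurable (fun a : R2 => ‖(V x - cx a)⁻¹‖ₑ) :=
            (measurable_const.sub hcx).inv.enorm
          have m2 : Measurable (fun a : R2 => ‖(V x - cx a)⁻¹ - (starRingEnd ℂ) (U x)‖ₑ) :=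
            ((measurable_const.sub hcx).inv.sub measurable_const).enorm
          rw [lintegral_add_left (m1.const_mul _), lintegral_const_mul _ m1,
            lintegral_const_mul _ m2]
          apply add_le_add
          · rw [mul_comm]; gcongr; exact avg_inv _ hr
          · by_cases hxE : x ∈ E
            · rw [indicator_of_mem hxE, mul_comm]
              refine le_trans ?_ le_add_self
              gcongr
              exact avg_far _ _ hx hr
            · rw [indicator_of_notMem hxE, add_zero, mul_comm]
              gcongr
              exact avg_near _ _ hx hr hr4 (hE2 x hxE)
      _ = _ := by
          have m1 : AEMeasurable (fun x => ENNReal.ofReal (3 * Real.pi * r) * ‖D x‖ₑ) μ :=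
            hD.enorm.const_mul _
          have m2 : AEMeasurable (fun x => ENNReal.ofReal (4 * r * (Real.pi * r ^ 2)) * ‖g x‖ₑ) μ :=
            hg.enorm.const_mul _
          rw [lintegral_add_left' m1, lintegral_add_left' m2, lintegral_const_mul'' _ hD.enorm,
            lintegral_const_mul'' _ hg.enorm, lintegral_indicator hE,
            lintegral_const_mul'' _ hg.enorm.restrict]
  · have hc : AEMeasurable (fun z : R2 × R2 => (V z.2 - cx z.1)⁻¹)
        ((volume.restrict (ball (0 : R2) r)).prod μ) :=
      (hV.comp_snd.sub (hcx.comp measurable_fst).aemeasurable).inv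
    have hUc : AEMeasurable (fun z : R2 × R2 => (starRingEnd ℂ) (U z.2))
        ((volume.restrict (ball (0 : R2) r)).prod μ) :=
      Complex.continuous_conj.measurable.comp_aemeasurable hU.comp_snd
    exact (hD.comp_snd.enorm.mul hc.enorm).add (hg.comp_snd.enorm.mul (hc.sub hUc).enorm)

lemma enorm_mk_le (a b : ℝ) : ‖(⟨a, b⟩ : ℂ)‖ₑ ≤ ‖a‖ₑ + ‖b‖ₑ := by
  have e : (⟨a, b⟩ : ℂ) = (a : ℂ) + (b : ℂ) * Complex.I := by
    apply Complex.ext <;> simp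
  rw [e]
  refine (enorm_add_le _ _).trans (le_of_eq ?_)
  rw [← ofReal_norm, ← ofReal_norm, ← ofReal_norm, ← ofReal_norm, norm_mul, Complex.norm_I,
    mul_one, Complex.norm_real, Complex.norm_real]

lemma contDiff_cmk {f g : R2 → ℝ} {n : WithTop ℕ∞} (hf : ContDiff ℝ n f) (hg : ContDiff ℝ n g) :
    ContDiff ℝ n (fun x => (⟨f x, g x⟩ : ℂ)) := by
  have : (fun x => (⟨f x, g x⟩ : ℂ)) = fun x => Complex.equivRealProdCLM.symm (f x, g x) := by
    ext x; apply Complex.ext <;> simp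
  rw [this]
  exact Complex.equivRealProdCLM.symm.contDiff.comp (hf.prodMk hg)

lemma fderiv_cmk {f g : R2 → ℝ} {x : R2} (hf : DifferentiableAt ℝ f x)
    (hg : DifferentiableAt ℝ g x) (h : R2) :
    fderiv ℝ (fun x => (⟨f x, g x⟩ : ℂ)) x h = ⟨fderiv ℝ f x h, fderiv ℝ g x h⟩ := by
  have : (fun x => (⟨f x, g x⟩ : ℂ)) =
      Complex.equivRealProdCLM.symm ∘ (fun x => (f x, g x)) := by
    ext x; apply Complex.ext <;> simp
  rw [this]
  have h1 := (Complex.equivRealProdCLM.symm.hasFDerivAt (x := (f x, g x))).comp x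
    (hf.hasFDerivAt.prodMk hg.hasFDerivAt)
  rw [h1.fderiv]
  apply Complex.ext <;> simp

set_option maxHeartbeats 1600000 in
lemma generic {Ω : Set R2} (hΩo : IsOpen Ω) (hΩb : Bornology.IsBounded Ω)
    (hΩl : HasLipschitzBoundary Ω) {u : R2 → R2} {G : R2 → Matrix (Fin 2) (Fin 2) ℝ}
    (hu : MemW11 Ω u G) (hs : SphereValued Ω u) {η : ℝ} (hη : 0 < η) : ∃ v : R2 → ℂ,
      ContDiff ℝ (⊤ : ℕ∞) v ∧ (∀ x, v x = 0 → ∀ h, fderiv ℝ v x h = 0 → h = 0) ∧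
      ∫⁻ x in Ω, ‖uv (v x) - cx (u x)‖ₑ ≤ ENNReal.ofReal η ∧
      ∫⁻ x in Ω, ‖jf v x - wf u G x‖ₑ ≤ ENNReal.ofReal η := by
  set μ := (volume : Measure R2).restrict Ω with hμ
  have hvol : volume Ω ≠ ∞ := hΩb.measure_lt_top.ne
  set g : Fin 2 → R2 → ℂ := fun j x => ⟨G x 0 j, G x 1 j⟩ with hg
  have hGm (i j : Fin 2) : AEMeasurable (fun x => G x i j) μ := (hu.2.1 i j).1.aemeasurable
  have hgm (j : Fin 2) : AEMeasurable (g j) μ := aemeasurable_mk (hGm 0 j) (hGm 1 j)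
  have hUm : AEMeasurable (fun x => cx (u x)) μ :=
    cx.continuous.measurable.comp_aemeasurable hu.1.1.aemeasurable
  have hU1 : ∀ᵐ x ∂μ, ‖cx (u x)‖ = 1 := by
    filter_upwards [hs] with x hx
    rw [cx.norm_map, hx]
  have hgfin (j : Fin 2) : ∫⁻ x, ‖g j x‖ₑ ∂μ ≠ ∞ := by
    have h1 : ∫⁻ x, ‖g j x‖ₑ ∂μ ≤ (∫⁻ x, ‖G x 0 j‖ₑ ∂μ) + ∫⁻ x, ‖G x 1 j‖ₑ ∂μ := by
      rw [← lintegral_add_left' (hGm 0 j).enorm]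
      exact lintegral_mono fun x => enorm_mk_le _ _
    exact (h1.trans_lt (ENNReal.add_lt_top.2 ⟨(hu.2.1 0 j).2, (hu.2.1 1 j).2⟩)).ne
  set M : ℝ := (∫⁻ x, ‖g 0 x‖ₑ ∂μ).toReal + (∫⁻ x, ‖g 1 x‖ₑ ∂μ).toReal with hM
  have hM0 : 0 ≤ M := by positivity
  have hMj (j : Fin 2) : ∫⁻ x, ‖g j x‖ₑ ∂μ ≤ ENNReal.ofReal M := by
    rw [← ENNReal.ofReal_toReal (hgfin j)]
    apply ENNReal.ofReal_le_ofReal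
    have h0 : 0 ≤ (∫⁻ x, ‖g 0 x‖ₑ ∂μ).toReal := ENNReal.toReal_nonneg
    have h1 : 0 ≤ (∫⁻ x, ‖g 1 x‖ₑ ∂μ).toReal := ENNReal.toReal_nonneg
    rw [hM]
    fin_cases j
    · exact le_add_of_nonneg_right h1
    · exact le_add_of_nonneg_left h0
  set m : ℝ := (volume Ω).toReal with hm
  have hm0 : 0 ≤ m := ENNReal.toReal_nonneg
  obtain ⟨r, hr, hr4, hrM, hrm⟩ : ∃ r : ℝ, 0 < r ∧ r ≤ 1 / 4 ∧ 32 * r * M ≤ η ∧ 4 * r * m ≤ η := by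
    refine ⟨min (1 / 4) (min (η / (32 * (M + 1))) (η / (4 * (m + 1)))), by positivity,
      min_le_left _ _, ?_, ?_⟩
    · have := (min_le_right (1 / 4) (min (η / (32 * (M + 1))) (η / (4 * (m + 1))))).trans
        (min_le_left _ _)
      rw [le_div_iff₀ (by positivity)] at this
      have h0 : 0 < min (1 / 4) (min (η / (32 * (M + 1))) (η / (4 * (m + 1)))) := by positivity
      nlinarith
    · have := (min_le_right (1 / 4) (min (η / (32 * (M + 1))) (η / (4 * (m + 1))))).trans
        (min_le_right _ _)
      rw [le_div_iff₀ (by positivity)] at this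
      have h0 : 0 < min (1 / 4) (min (η / (32 * (M + 1))) (η / (4 * (m + 1)))) := by positivity
      nlinarith
  set ε' : ℝ := η * r / 32 with hε'
  have hε'0 : 0 < ε' := by positivity
  have hac (j : Fin 2) : ∃ δ : ℝ, 0 < δ ∧ ∀ s, μ s < ENNReal.ofReal δ →
      ∫⁻ x in s, ‖g j x‖ₑ ∂μ ≤ ENNReal.ofReal ε' := by
    obtain ⟨δ, hδ, h⟩ := exists_pos_setLIntegral_lt_of_measure_lt (hgfin j)
      (ε := ENNReal.ofReal ε') (by simpa using hε'0)
    have hmin : min δ 1 ≠ ∞ := (lt_of_le_of_lt (min_le_right _ _) ENNReal.one_lt_top).ne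
    refine ⟨(min δ 1).toReal, ENNReal.toReal_pos (by simp [hδ.ne']) hmin, fun s hs => (h s ?_).le⟩
    rw [ENNReal.ofReal_toReal hmin] at hs
    exact hs.trans_le (min_le_left _ _)
  choose δ hδ hδ2 using hac
  set δm := min (δ 0) (δ 1) with hδm
  have hδm0 : 0 < δm := lt_min (hδ 0) (hδ 1)
  obtain ⟨η', hη'0, he1, he2, he3⟩ : ∃ η' : ℝ, 0 < η' ∧ 48 * η' ≤ η * r ∧ 8 * η' ≤ η ∧
      4 * η' ≤ r * δm := by
    refine ⟨min (η * r / 48) (min (η / 8) (r * δm / 4)), by positivity, ?_, ?_, ?_⟩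
    · linarith [min_le_left (η * r / 48) (min (η / 8) (r * δm / 4))]
    · linarith [(min_le_right (η * r / 48) (min (η / 8) (r * δm / 4))).trans (min_le_left _ _)]
    · linarith [(min_le_right (η * r / 48) (min (η / 8) (r * δm / 4))).trans (min_le_right _ _)]
  choose w hwC hwu hwG using fun i => density_one hΩo hΩb hΩl hu hη'0 i
  set v : R2 → ℂ := fun x => ⟨w 0 x, w 1 x⟩ with hv
  have hvC : ContDiff ℝ (⊤ : ℕ∞) v := contDiff_cmk (hwC 0) (hwC 1)
  have hwd (i : Fin 2) (x : R2) : DifferentiableAt ℝ (w i) x :=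
    ((hwC i).differentiable (by simp)).differentiableAt
  have hvD (x : R2) (j : Fin 2) : fderiv ℝ v x (ee j) = ⟨fderiv ℝ (w 0) x (ee j), fderiv ℝ (w 1) x (ee j)⟩ :=
    fderiv_cmk (hwd 0 x) (hwd 1 x) _
  have hum (i : Fin 2) : AEMeasurable (fun x => u x i) μ :=
    ((EuclideanSpace.proj (𝕜 := ℝ) i).integrable_comp hu.1).1.aemeasurable
  have hvm : AEMeasurable v μ := hvC.continuous.measurable.aemeasurable
  have two : ENNReal.ofReal η' + ENNReal.ofReal η' = ENNReal.ofReal (2 * η') := by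
    rw [← ENNReal.ofReal_add hη'0.le hη'0.le, two_mul]
  have hvu : ∫⁻ x, ‖v x - cx (u x)‖ₑ ∂μ ≤ ENNReal.ofReal (2 * η') := by
    have m0 : AEMeasurable (fun x => ‖w 0 x - u x 0‖ₑ) μ :=
      ((hwC 0).continuous.measurable.aemeasurable.sub (hum 0)).enorm
    calc ∫⁻ x, ‖v x - cx (u x)‖ₑ ∂μ
        ≤ ∫⁻ x, (‖w 0 x - u x 0‖ₑ + ‖w 1 x - u x 1‖ₑ) ∂μ := by
          apply lintegral_mono
          intro x
          have : v x - cx (u x) = ⟨w 0 x - u x 0, w 1 x - u x 1⟩ := by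
            rw [cx_apply]; rfl
          beta_reduce
          rw [this]
          exact enorm_mk_le _ _
      _ ≤ _ := by
          rw [lintegral_add_left' m0, ← two]
          exact add_le_add (hwu 0) (hwu 1)
  have hDm (j : Fin 2) : AEMeasurable (fun x => fderiv ℝ v x (ee j) - g j x) μ := by
    have : Continuous (fun x => fderiv ℝ v x (ee j)) :=
      (hvC.continuous_fderiv (by simp)).clm_apply continuous_const
    exact this.measurable.aemeasurable.sub (hgm j)
  have hvG (j : Fin 2) : ∫⁻ x, ‖fderiv ℝ v x (ee j) - g j x‖ₑ ∂μ ≤ ENNReal.ofReal (2 * η') := by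
    have m0 : AEMeasurable (fun x => ‖fderiv ℝ (w 0) x (ee j) - G x 0 j‖ₑ) μ := by
      have : Continuous (fun x => fderiv ℝ (w 0) x (ee j)) :=
        ((hwC 0).continuous_fderiv (by simp)).clm_apply continuous_const
      exact (this.measurable.aemeasurable.sub (hGm 0 j)).enorm
    calc ∫⁻ x, ‖fderiv ℝ v x (ee j) - g j x‖ₑ ∂μ
        ≤ ∫⁻ x, (‖fderiv ℝ (w 0) x (ee j) - G x 0 j‖ₑ + ‖fderiv ℝ (w 1) x (ee j) - G x 1 j‖ₑ) ∂μ := by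
          apply lintegral_mono
          intro x
          have : fderiv ℝ v x (ee j) - g j x =
              ⟨fderiv ℝ (w 0) x (ee j) - G x 0 j, fderiv ℝ (w 1) x (ee j) - G x 1 j⟩ := by
            rw [hvD]; rfl
          beta_reduce
          rw [this]
          exact enorm_mk_le _ _
      _ ≤ _ := by
          rw [lintegral_add_left' m0, ← two]
          exact add_le_add (hwG 0 j) (hwG 1 j)
  set E := toMeasurable μ {x | ENNReal.ofReal r ≤ ‖v x - cx (u x)‖ₑ} with hE
  have hEm : MeasurableSet E := measurableSet_toMeasurable _ _
  have hE2 : ∀ x ∉ E, ‖v x - cx (u x)‖ ≤ r := by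
    intro x hx
    by_contra hc
    apply hx
    apply subset_toMeasurable
    show ENNReal.ofReal r ≤ ‖v x - cx (u x)‖ₑ
    rw [← ofReal_norm]
    exact ENNReal.ofReal_le_ofReal (not_le.1 hc).le
  have hμE : μ E < ENNReal.ofReal δm := by
    rw [hE, measure_toMeasurable]
    refine (meas_ge_le_lintegral_div (hvm.sub hUm).enorm (by simpa using hr)
      ENNReal.ofReal_ne_top).trans_lt ?_
    have h1 : ENNReal.ofReal (2 * η') / ENNReal.ofReal r < ENNReal.ofReal δm := by
      rw [← ENNReal.ofReal_div_of_pos hr]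
      rw [ENNReal.ofReal_lt_ofReal_iff hδm0, div_lt_iff₀ hr]
      nlinarith [mul_pos hr hδm0]
    refine lt_of_le_of_lt ?_ h1
    exact ENNReal.div_le_div_right hvu _
  have hgE (j : Fin 2) : ∫⁻ x in E, ‖g j x‖ₑ ∂μ ≤ ENNReal.ofReal ε' := by
    apply hδ2
    refine hμE.trans_le (ENNReal.ofReal_le_ofReal ?_)
    rw [hδm]
    fin_cases j
    · exact min_le_left _ _
    · exact min_le_right _ _
  obtain ⟨N, hN, hNr⟩ := sard_cx hvC
  set F : R2 → ℝ≥0∞ := fun a => ∫⁻ x, ‖jf (fun y => v y - cx a) x - wf u G x‖ₑ ∂μ with hF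
  set b : ℝ := 3 * Real.pi * r * (2 * η') + (4 * r * (Real.pi * r ^ 2) * M +
    (3 * Real.pi * r + Real.pi * r ^ 2) * ε') with hb
  have hb0 : 0 ≤ b := by positivity
  set H : Fin 2 → R2 → R2 → ℝ≥0∞ := fun j a x => (‖fderiv ℝ v x (ee j) - g j x‖ₑ * ‖(v x - cx a)⁻¹‖ₑ +
        ‖g j x‖ₑ * ‖(v x - cx a)⁻¹ - (starRingEnd ℂ) (cx (u x))‖ₑ) with hH
  have hHj (j : Fin 2) : ∫⁻ a in ball (0 : R2) r, ∫⁻ x, H j a x ∂μ ≤ ENNReal.ofReal b := by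
    refine (avg_j (hDm j) (hgm j) hvm hUm hU1 hr hr4 hEm hE2).trans ?_
    rw [hb, ENNReal.ofReal_add (p := 3 * Real.pi * r * (2 * η')) (by positivity) (by positivity),
      ENNReal.ofReal_add (p := 4 * r * (Real.pi * r ^ 2) * M) (by positivity) (by positivity),
      ENNReal.ofReal_mul (p := 3 * Real.pi * r) (by positivity),
      ENNReal.ofReal_mul (p := 4 * r * (Real.pi * r ^ 2)) (by positivity),
      ENNReal.ofReal_mul (p := 3 * Real.pi * r + Real.pi * r ^ 2) (by positivity)]
    gcongr
    · exact hvG j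
    · exact hMj j
    · exact hgE j
  have hcx : Measurable (fun a : R2 => cx a) := cx.continuous.measurable
  have hHm (j : Fin 2) : AEMeasurable (fun z : R2 × R2 => H j z.1 z.2)
      ((volume.restrict (ball (0 : R2) r)).prod μ) := by
    have hc : AEMeasurable (fun z : R2 × R2 => (v z.2 - cx z.1)⁻¹)
        ((volume.restrict (ball (0 : R2) r)).prod μ) :=
      (hvm.comp_snd.sub (hcx.comp measurable_fst).aemeasurable).inv
    have hUc : AEMeasurable (fun z : R2 × R2 => (starRingEnd ℂ) (cx (u z.2)))
        ((volume.restrict (ball (0 : R2) r)).prod μ) :=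
      Complex.continuous_conj.measurable.comp_aemeasurable hUm.comp_snd
    exact ((hDm j).comp_snd.enorm.mul hc.enorm).add ((hgm j).comp_snd.enorm.mul (hc.sub hUc).enorm)
  have hHx (a : R2) : AEMeasurable (fun x => H 0 a x) μ := by
    have hc : AEMeasurable (fun x => (v x - cx a)⁻¹) μ := (hvm.sub aemeasurable_const).inv
    have hUc : AEMeasurable (fun x => (starRingEnd ℂ) (cx (u x))) μ :=
      Complex.continuous_conj.measurable.comp_aemeasurable hUm
    exact ((hDm 0).enorm.mul hc.enorm).add ((hgm 0).enorm.mul (hc.sub hUc).enorm)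
  have hFb : ∫⁻ a in ball (0 : R2) r, F a ≤ ENNReal.ofReal (2 * b) := by
    calc ∫⁻ a in ball (0 : R2) r, F a
        ≤ ∫⁻ a in ball (0 : R2) r, ((∫⁻ x, H 0 a x ∂μ) + ∫⁻ x, H 1 a x ∂μ) := by
          apply lintegral_mono
          intro a
          beta_reduce
          rw [← lintegral_add_left' (hHx a)]
          apply lintegral_mono
          intro x
          have := jf_sub_wf_le v u G (cx a) x
          rw [Fin.sum_univ_two] at this
          exact this
      _ = (∫⁻ a in ball (0 : R2) r, ∫⁻ x, H 0 a x ∂μ) + ∫⁻ a in ball (0 : R2) r, ∫⁻ x, H 1 a x ∂μ :=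
          lintegral_add_left' (hHm 0).lintegral_prod_right' _
      _ ≤ ENNReal.ofReal b + ENNReal.ofReal b := add_le_add (hHj 0) (hHj 1)
      _ = _ := by rw [← ENNReal.ofReal_add hb0 hb0, two_mul]
  obtain ⟨a, haB, haN, haF⟩ := exists_good (K := ENNReal.ofReal η) hN measurableSet_ball hFb (by
    rw [vol_ball r hr, ← ENNReal.ofReal_mul hη.le, ENNReal.ofReal_lt_ofReal_iff (by positivity)]
    have hp := Real.pi_pos
    have e : 2 * b = Real.pi * (12 * r * η' + 8 * r ^ 3 * M + (6 * r + 2 * r ^ 2) * ε') := by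
      rw [hb]; ring
    rw [e, show η * (Real.pi * r ^ 2) = Real.pi * (η * r ^ 2) by ring]
    apply mul_lt_mul_of_pos_left _ hp
    have t1 : 12 * r * η' ≤ η * r ^ 2 / 4 := by nlinarith
    have t2 : 8 * r ^ 3 * M ≤ η * r ^ 2 / 4 := by
      have := mul_le_mul_of_nonneg_left hrM (sq_nonneg r)
      nlinarith
    have t3 : (6 * r + 2 * r ^ 2) * ε' ≤ η * r ^ 2 / 4 := by
      rw [hε']
      have h5 : 6 * r + 2 * r ^ 2 ≤ 8 * r := by nlinarith
      have := mul_le_mul_of_nonneg_right h5 hε'0.le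
      rw [hε'] at this
      nlinarith
    have : 0 < η * r ^ 2 := by positivity
    linarith)
  refine ⟨fun x => v x - cx a, hvC.sub contDiff_const, ?_, ?_, haF⟩
  · intro x hx h hh
    rw [fderiv_sub_const] at hh
    exact hNr a haN x (sub_eq_zero.1 hx) h hh
  · calc ∫⁻ x, ‖uv (v x - cx a) - cx (u x)‖ₑ ∂μ
        ≤ ∫⁻ x, (ENNReal.ofReal 2 * ‖v x - cx (u x)‖ₑ + ENNReal.ofReal (2 * r)) ∂μ := by
          apply lintegral_mono_ae
          filter_upwards [hU1] with x hx
          rw [← ofReal_norm, ← ofReal_norm]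
          rw [← ENNReal.ofReal_mul (by norm_num), ← ENNReal.ofReal_add (by positivity) (by positivity)]
          apply ENNReal.ofReal_le_ofReal
          refine (norm_uv_sub_le _ _ hx).trans ?_
          rw [mem_ball, dist_zero_right] at haB
          have h3 : v x - cx a - cx (u x) = (v x - cx (u x)) - cx a := by ring
          rw [h3]
          have h4 := norm_sub_le (v x - cx (u x)) (cx a)
          rw [cx.norm_map] at h4
          linarith
      _ = ENNReal.ofReal 2 * (∫⁻ x, ‖v x - cx (u x)‖ₑ ∂μ) + ENNReal.ofReal (2 * r) * volume Ω := by
          have m1 : AEMeasurable (fun x => ‖v x - cx (u x)‖ₑ) μ := (hvm.sub hUm).enorm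
          rw [lintegral_add_right _ measurable_const, lintegral_const_mul'' _ m1,
            lintegral_const, hμ, Measure.restrict_apply_univ]
      _ ≤ ENNReal.ofReal (2 * (2 * η')) + ENNReal.ofReal (2 * r * m) := by
          rw [ENNReal.ofReal_mul (p := 2) (q := 2 * η') (by norm_num : (0 : ℝ) ≤ 2),
            ENNReal.ofReal_mul (by positivity : 0 ≤ 2 * r), hm, ENNReal.ofReal_toReal hvol]
          gcongr
      _ ≤ _ := by
          rw [← ENNReal.ofReal_add (by positivity) (by positivity)]
          apply ENNReal.ofReal_le_ofReal
          linarith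

/-! ### Factorization of nondegenerate zeros -/

lemma lin_decomp (L : R2 →L[ℝ] ℂ) (hL : ∀ h, L h = 0 → h = 0) :
    ∃ (s : Bool) (a b : ℂ), ‖b‖ < ‖a‖ ∧
      ∀ h, L h = a * sg s (cx h) + b * sg (!s) (cx h) := by
  set α : ℂ := (L (ee 0) - Complex.I * L (ee 1)) / 2 with hα
  set β : ℂ := (L (ee 0) + Complex.I * L (ee 1)) / 2 with hβ
  have key : ∀ h : R2, L h = α * cx h + β * (starRingEnd ℂ) (cx h) := by
    intro h
    have e : h = h 0 • ee 0 + h 1 • ee 1 := by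
      ext i; fin_cases i <;> simp [ee]
    have h1 : L h = (h 0 : ℂ) * L (ee 0) + (h 1 : ℂ) * L (ee 1) := by
      conv_lhs => rw [e]
      rw [map_add, map_smul, map_smul, Complex.real_smul, Complex.real_smul]
    have h2 : cx h = (h 0 : ℂ) + (h 1 : ℂ) * Complex.I := by
      rw [cx_apply]; exact Complex.mk_eq_add_mul_I _ _
    rw [h1, h2, map_add, map_mul, Complex.conj_I, Complex.conj_ofReal, Complex.conj_ofReal, hα, hβ]
    linear_combination ((h 1 : ℂ) * L (ee 1)) * Complex.I_sq
  rcases lt_trichotomy ‖β‖ ‖α‖ with h | h | h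
  · exact ⟨true, α, β, h, fun x => by simpa [sg] using key x⟩
  · exfalso
    by_cases hb : β = 0
    · have ha : α = 0 := by rw [← norm_eq_zero, ← h, hb, norm_zero]
      have := hL (ee 0) (by rw [key, ha, hb]; simp)
      have h3 := congrArg (fun x : R2 => x 0) this
      simp [ee] at h3
    · have ha : α ≠ 0 := by rw [← norm_ne_zero_iff, ← h]; exact norm_ne_zero_iff.2 hb
      obtain ⟨z, hz⟩ := IsAlgClosed.exists_pow_nat_eq (-β / α) (n := 2) two_pos
      have hz1 : ‖z‖ = 1 := by
        have : ‖z‖ ^ 2 = 1 := by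
          rw [← norm_pow, hz, norm_div, norm_neg, h, div_self (norm_ne_zero_iff.2 ha)]
        exact (pow_eq_one_iff_of_nonneg (norm_nonneg _) two_ne_zero).1 this
      have hzz : z * (starRingEnd ℂ) z = 1 := by
        rw [Complex.mul_conj, Complex.normSq_eq_norm_sq, hz1]; simp
      have hz0 : z ≠ 0 := by rintro rfl; simp at hz1
      have hz2 : α * z ^ 2 = - β := by rw [hz]; field_simp
      have := hL (cx.symm z) (by
        rw [key, LinearIsometryEquiv.apply_symm_apply]
        apply mul_left_cancel₀ hz0
        linear_combination hz2 + β * hzz)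
      have h3 : z = 0 := by
        have := congrArg cx this
        simpa using this
      exact hz0 h3
  · exact ⟨false, β, α, h, fun x => by simp [sg, key x]; ring⟩

lemma norm_mk_le (a b : ℝ) : ‖(⟨a, b⟩ : ℂ)‖ ≤ |a| + |b| := by
  have := Complex.norm_le_abs_re_add_abs_im (⟨a, b⟩ : ℂ)
  simpa using this

lemma norm_jf_le (A : R2 → ℂ) (x : R2) : ‖jf A x‖ ≤ 2 * ‖fderiv ℝ A x‖ / ‖A x‖ := by
  have h (j : Fin 2) : |(fderiv ℝ A x (ee j) / A x).im| ≤ ‖fderiv ℝ A x‖ / ‖A x‖ := by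
    refine (Complex.abs_im_le_norm _).trans ?_
    rw [norm_div]
    gcongr
    refine (ContinuousLinearMap.le_opNorm _ _).trans ?_
    simp [ee]
  refine (norm_mk_le _ _).trans ?_
  have := h 0; have := h 1
  rw [mul_div_assoc]
  linarith

lemma norm_fderiv_vx_le (s : Bool) (p x : R2) : ‖fderiv ℝ (vx s p) x‖ ≤ 1 := by
  have : LipschitzWith 1 (vx s p) := by
    apply LipschitzWith.of_dist_le_mul
    intro y z
    have e : vx s p y - vx s p z = sg s (cx (y - z)) := by
      cases s <;> simp [vx, sg]
    rw [dist_eq_norm, e, norm_sg, LinearIsometryEquiv.norm_map, dist_eq_norm]; simp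
  simpa using norm_fderiv_le_of_lipschitz ℝ this (x₀ := x)

lemma exists_cutoff : ∃ B : ℝ, 0 ≤ B ∧ ∀ (p : R2) (ρ : ℝ), 0 < ρ → ∃ χ : R2 → ℝ,
    ContDiff ℝ (⊤ : ℕ∞) χ ∧ (∀ x, 0 ≤ χ x ∧ χ x ≤ 1) ∧ (∀ x, dist x p < ρ / 4 → χ x = 1) ∧
    (∀ x, ρ / 2 < dist x p → χ x = 0) ∧ ∀ x, ‖fderiv ℝ χ x‖ ≤ B / ρ := by
  let f : ContDiffBump (0 : R2) := ⟨1/4, 1/2, by norm_num, by norm_num⟩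
  obtain ⟨B, hB⟩ := (f.contDiff (n := (⊤ : ℕ∞))).lipschitzWith_of_hasCompactSupport
    f.hasCompactSupport (by simp)
  refine ⟨B, B.2, fun p ρ hρ => ⟨fun x => f (ρ⁻¹ • (x - p)), ?_, ?_, ?_, ?_, ?_⟩⟩
  · exact f.contDiff.comp ((contDiff_id.sub contDiff_const).const_smul ρ⁻¹)
  · intro x; exact ⟨f.nonneg, f.le_one⟩
  · intro x hx
    apply f.one_of_mem_closedBall
    rw [mem_closedBall, dist_zero_right, norm_smul, Real.norm_of_nonneg (by positivity),
      ← dist_eq_norm]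
    change _ ≤ (1/4 : ℝ)
    rw [inv_mul_le_iff₀ hρ]; linarith
  · intro x hx
    apply f.zero_of_le_dist
    rw [dist_zero_right, norm_smul, Real.norm_of_nonneg (by positivity), ← dist_eq_norm]
    change (1/2 : ℝ) ≤ _
    rw [le_inv_mul_iff₀ hρ]; linarith
  · intro x
    have : LipschitzWith (B * ⟨ρ⁻¹, by positivity⟩) (fun x : R2 => f (ρ⁻¹ • (x - p))) := by
      apply hB.comp
      apply LipschitzWith.of_dist_le_mul
      intro y z
      rw [dist_eq_norm, ← smul_sub, norm_smul, Real.norm_of_nonneg (by positivity),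
        sub_sub_sub_cancel_right, ← dist_eq_norm]
      rfl
    have h2 := norm_fderiv_le_of_lipschitz ℝ this (x₀ := x)
    rw [div_eq_mul_inv]; exact h2


lemma zero_step {v : R2 → ℂ} (hv : ContDiff ℝ (⊤ : ℕ∞) v) {p : R2} (hp : v p = 0)
    (hnd : ∀ h, fderiv ℝ v p h = 0 → h = 0) :
    ∃ s : Bool, ∃ ρ0 > 0, ∃ C : ℝ, 0 ≤ C ∧ ∀ ρ : ℝ, 0 < ρ → ρ < ρ0 → ∃ W : R2 → ℂ,
      ContDiff ℝ (⊤ : ℕ∞) W ∧ (∀ x ∈ ball p ρ, W x ≠ 0) ∧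
      (∀ x, ρ / 2 < dist x p → W x * vx s p x = v x) ∧
      ∀ x ∈ ball p ρ, x ≠ p → ‖jf W x + sr s * jv p x‖ ≤ C * ‖x - p‖⁻¹ ∧
        ‖jf v x‖ ≤ C * ‖x - p‖⁻¹ := by
  obtain ⟨s, a, b, hab, hL⟩ := lin_decomp (fderiv ℝ v p) hnd
  obtain ⟨B, hB0, hB⟩ := exists_cutoff
  set κ := (‖a‖ - ‖b‖) / 2 with hκ
  have hκ0 : 0 < κ := by rw [hκ]; linarith
  have ha0 : a ≠ 0 := by rw [← norm_pos_iff]; linarith [norm_nonneg b]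
  have hvd : Differentiable ℝ v := hv.differentiable (by simp)
  -- local estimates
  have h1 : ∀ᶠ x in 𝓝 p, ‖v x - v p - fderiv ℝ v p (x - p)‖ ≤ κ * ‖x - p‖ :=
    (hvd p).hasFDerivAt.isLittleO.def hκ0
  set M := ‖fderiv ℝ v p‖ + 1 with hM
  have h2 : ∀ᶠ x in 𝓝 p, ‖fderiv ℝ v x‖ < M := by
    have hc : Continuous (fun x => ‖fderiv ℝ v x‖) := (hv.continuous_fderiv (by simp)).norm
    exact hc.continuousAt.eventually_lt continuousAt_const (by linarith)
  obtain ⟨ρ0, hρ0, hloc⟩ := Metric.eventually_nhds_iff.1 (h1.and h2)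
  have hM0 : 0 ≤ M := by positivity
  have hζ : ∀ x, ‖vx s p x‖ = ‖x - p‖ := norm_vx s p
  have hR : ∀ x, dist x p < ρ0 → ‖v x - a * vx s p x‖ ≤ (‖b‖ + κ) * ‖x - p‖ := by
    intro x hx
    have := (hloc hx).1
    rw [hp, sub_zero, hL] at this
    have e : v x - a * vx s p x = (v x - (a * sg s (cx (x - p)) + b * sg (!s) (cx (x - p))))
        + b * sg (!s) (cx (x - p)) := by
      have : vx s p x = sg s (cx (x - p)) := by unfold vx; rw [map_sub]
      rw [this]; ring
    rw [e]
    refine (norm_add_le _ _).trans ?_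
    rw [norm_mul, norm_sg, LinearIsometryEquiv.norm_map]
    linarith
  set C := 2 * (2 * ‖a‖ + M + B * ‖a‖) / κ with hC
  have hC0 : 0 ≤ C := by positivity
  have hMC : 2 * M / κ ≤ C := by
    rw [hC]; gcongr; nlinarith [norm_nonneg a, mul_nonneg hB0 (norm_nonneg a)]
  refine ⟨s, ρ0, hρ0, C, hC0, fun ρ hρ hρρ => ?_⟩
  obtain ⟨χ, hχc, hχ01, hχ1, hχ0, hχd⟩ := hB p ρ hρ
  set V : R2 → ℂ := fun x => a * vx s p x + ((1 - χ x : ℝ) : ℂ) * (v x - a * vx s p x) with hV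
  set W : R2 → ℂ := fun x => a + ((1 - χ x : ℝ) : ℂ) * (v x - a * vx s p x) * (vx s p x)⁻¹ with hW
  have hvxc := contDiff_vx s p (n := (⊤ : ℕ∞))
  have hχC : ContDiff ℝ (⊤ : ℕ∞) (fun x => ((1 - χ x : ℝ) : ℂ)) :=
    Complex.ofRealCLM.contDiff.comp (contDiff_const.sub hχc)
  have hVc : ContDiff ℝ (⊤ : ℕ∞) V :=
    (contDiff_const.mul hvxc).add (hχC.mul (hv.sub (contDiff_const.mul hvxc)))
  have hWV : ∀ x, x ≠ p → W x * vx s p x = V x := by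
    intro x hx
    have : vx s p x ≠ 0 := by rwa [Ne, vx_eq_zero]
    simp only [hW, hV]; field_simp
  have hWnear : ∀ x, dist x p < ρ / 4 → W x = a := by
    intro x hx
    simp [hW, hχ1 x hx]
  have hWc : ContDiff ℝ (⊤ : ℕ∞) W := by
    rw [contDiff_iff_contDiffAt]
    intro x
    by_cases hx : x = p
    · have : W =ᶠ[𝓝 x] fun _ => a := by
        rw [hx]
        filter_upwards [Metric.ball_mem_nhds p (show 0 < ρ / 4 by positivity)] with y hy
        exact hWnear y hy
      exact contDiffAt_const.congr_of_eventuallyEq this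
    · have h0 : vx s p x ≠ 0 := by rwa [Ne, vx_eq_zero]
      exact contDiffAt_const.add ((hχC.contDiffAt.mul
        (hv.sub (contDiff_const.mul hvxc)).contDiffAt).mul (hvxc.contDiffAt.inv h0))
  have hVlow : ∀ x ∈ ball p ρ, κ * ‖x - p‖ ≤ ‖V x‖ := by
    intro x hx
    have h3 := hR x ((mem_ball.1 hx).trans hρρ)
    have h4 : ‖((1 - χ x : ℝ) : ℂ) * (v x - a * vx s p x)‖ ≤ (‖b‖ + κ) * ‖x - p‖ := by
      rw [norm_mul, Complex.norm_real, Real.norm_of_nonneg (by linarith [(hχ01 x).2])]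
      refine le_trans ?_ h3
      exact mul_le_of_le_one_left (norm_nonneg _) (by linarith [(hχ01 x).1])
    have h5 : ‖a * vx s p x‖ = ‖a‖ * ‖x - p‖ := by rw [norm_mul, hζ]
    have h6 := norm_sub_le_norm_add (a * vx s p x) (((1 - χ x : ℝ) : ℂ) * (v x - a * vx s p x))
    have h7 : κ * ‖x - p‖ = ‖a‖ * ‖x - p‖ - (‖b‖ + κ) * ‖x - p‖ := by rw [hκ]; ring
    simp only [hV]
    linarith
  have hvlow : ∀ x ∈ ball p ρ, κ * ‖x - p‖ ≤ ‖v x‖ := by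
    intro x hx
    have h3 := hR x ((mem_ball.1 hx).trans hρρ)
    have h5 : ‖a * vx s p x‖ = ‖a‖ * ‖x - p‖ := by rw [norm_mul, hζ]
    have h6 := norm_sub_norm_le (a * vx s p x) (v x)
    rw [norm_sub_rev] at h3
    have h7 : κ * ‖x - p‖ = ‖a‖ * ‖x - p‖ - (‖b‖ + κ) * ‖x - p‖ := by rw [hκ]; ring
    linarith
  have hdiv : ∀ (A : R2 → ℂ) (x : R2) (D : ℝ), x ≠ p → κ * ‖x - p‖ ≤ ‖A x‖ →
      ‖fderiv ℝ A x‖ ≤ D → ‖jf A x‖ ≤ 2 * D / κ * ‖x - p‖⁻¹ := by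
    intro A x D hx hA hD
    have hxp : 0 < ‖x - p‖ := norm_pos_iff.2 (sub_ne_zero.2 hx)
    refine (norm_jf_le A x).trans ?_
    rw [← div_eq_mul_inv, div_div]
    have : 0 ≤ D := (norm_nonneg _).trans hD
    gcongr
  refine ⟨W, hWc, ?_, ?_, ?_⟩
  · intro x hx
    by_cases hxp : x = p
    · rw [hxp, hWnear p (by simpa using (by positivity : 0 < ρ / 4))]; exact ha0
    · intro h0
      have h3 := hVlow x hx
      rw [← hWV x hxp, h0, zero_mul, norm_zero] at h3
      have : 0 < ‖x - p‖ := norm_pos_iff.2 (sub_ne_zero.2 hxp)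
      nlinarith
  · intro x hx
    have hxp : x ≠ p := by
      rintro rfl; rw [dist_self] at hx; linarith
    rw [hWV x hxp]
    simp [hV, hχ0 x hx]
  · intro x hx hxp
    have hx0 : dist x p < ρ0 := (mem_ball.1 hx).trans hρρ
    have hxp0 : 0 < ‖x - p‖ := norm_pos_iff.2 (sub_ne_zero.2 hxp)
    have hDv := (hloc hx0).2
    have hWd : DifferentiableAt ℝ W x := (hWc.differentiable (by simp)) x
    have hvxd : DifferentiableAt ℝ (vx s p) x := (hvxc.differentiable (by simp)) x
    constructor
    · have hW0 : W x ≠ 0 := by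
        intro h0
        have h3 := hVlow x hx
        rw [← hWV x hxp, h0, zero_mul, norm_zero] at h3
        nlinarith
      have e : jf W x + sr s * jv p x = jf V x := by
        rw [← jf_vx, ← jf_mul hWd hvxd hW0 (by rwa [Ne, vx_eq_zero])]
        apply jf_congr
        filter_upwards [isOpen_ne.mem_nhds hxp] with y hy
        exact hWV y hy
      rw [e, hC]
      apply hdiv V x _ hxp (hVlow x hx)
      -- derivative of V
      have hχd1 : HasFDerivAt χ (fderiv ℝ χ x) x :=
        ((hχc.differentiable (by simp)) x).hasFDerivAt
      have hg1 : HasFDerivAt (fun y => ((1 - χ y : ℝ) : ℂ))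
          (Complex.ofRealCLM.comp (-(fderiv ℝ χ x))) x :=
        Complex.ofRealCLM.hasFDerivAt.comp x (hχd1.const_sub 1)
      have hg2 : HasFDerivAt (fun y => a * vx s p y) (a • fderiv ℝ (vx s p) x) x :=
        hvxd.hasFDerivAt.const_mul a
      have hg3 := (hvd x).hasFDerivAt.sub hg2
      have hg4 := hg2.add (hg1.mul hg3)
      have e2 : fderiv ℝ V x = _ := hg4.fderiv
      rw [e2]
      have n1 : ‖a • fderiv ℝ (vx s p) x‖ ≤ ‖a‖ := by
        rw [norm_smul]; exact mul_le_of_le_one_right (norm_nonneg _) (norm_fderiv_vx_le s p x)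
      have n2 : ‖fderiv ℝ v x - a • fderiv ℝ (vx s p) x‖ ≤ M + ‖a‖ :=
        (norm_sub_le _ _).trans (by linarith)
      have n3 : ‖((1 - χ x : ℝ) : ℂ) • (fderiv ℝ v x - a • fderiv ℝ (vx s p) x)‖ ≤ M + ‖a‖ := by
        rw [norm_smul, Complex.norm_real, Real.norm_of_nonneg (by linarith [(hχ01 x).2])]
        refine (mul_le_of_le_one_left (norm_nonneg _) (by linarith [(hχ01 x).1])).trans n2
      have n4 : ‖(v - fun y => a * vx s p y) x • Complex.ofRealCLM.comp (-(fderiv ℝ χ x))‖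
          ≤ B * ‖a‖ := by
        rw [norm_smul]
        have m1 : ‖Complex.ofRealCLM.comp (-(fderiv ℝ χ x))‖ ≤ B / ρ := by
          refine (ContinuousLinearMap.opNorm_comp_le _ _).trans ?_
          rw [norm_neg]
          simpa using hχd x
        have m2 : ‖(v - fun y => a * vx s p y) x‖ ≤ ‖a‖ * ρ := by
          refine (hR x hx0).trans ?_
          have : ‖x - p‖ < ρ := by rw [← dist_eq_norm]; exact hx
          have h7 : ‖b‖ + κ ≤ ‖a‖ := by rw [hκ]; linarith
          have := norm_nonneg b
          gcongr
        calc _ ≤ (‖a‖ * ρ) * (B / ρ) := by gcongr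
          _ = B * ‖a‖ := by field_simp
      refine (norm_add_le _ _).trans ?_
      have n5 := norm_add_le
        (((1 - χ x : ℝ) : ℂ) • (fderiv ℝ v x - a • fderiv ℝ (vx s p) x))
        ((v - fun y => a * vx s p y) x • Complex.ofRealCLM.comp (-(fderiv ℝ χ x)))
      linarith
    · refine (hdiv v x M hxp (hvlow x hx) hDv.le).trans ?_
      gcongr


lemma finite_zeros {v : R2 → ℂ} (hv : ContDiff ℝ (⊤ : ℕ∞) v) {K : Set R2} (hK : IsCompact K)
    (hnd : ∀ x ∈ K, v x = 0 → ∀ h, fderiv ℝ v x h = 0 → h = 0) :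
    {x | x ∈ K ∧ v x = 0}.Finite := by
  have : ({x | x ∈ K ∧ v x = 0} : Set R2) = {x | x ∈ K ∧ (x ∈ K ∧ v x = 0)} := by
    ext x; simp
  rw [this]
  refine hK.induction_on (p := fun t => {x | x ∈ t ∧ (x ∈ K ∧ v x = 0)}.Finite) ?_ ?_ ?_ ?_
  · simp
  · intro s t hst ht
    exact ht.subset fun x hx => ⟨hst hx.1, hx.2⟩
  · intro s t hs ht
    refine (hs.union ht).subset ?_
    rintro x ⟨h1 | h1, h2⟩
    · exact Or.inl ⟨h1, h2⟩
    · exact Or.inr ⟨h1, h2⟩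
  · intro x hx
    by_cases h0 : v x = 0
    · have hd : HasFDerivAt v (fderiv ℝ v x) x := (hv.differentiable (by simp) x).hasFDerivAt
      have hanti : ∃ C, AntilipschitzWith C (fderiv ℝ v x) := by
        obtain ⟨C, _, hC⟩ := (fderiv ℝ v x : R2 →ₗ[ℝ] ℂ).exists_antilipschitzWith (by
          rw [LinearMap.ker_eq_bot']
          intro h hh
          exact hnd x hx h0 h hh)
        exact ⟨C, hC⟩
      have he := hd.eventually_ne (c := 0) hanti
      rw [eventually_nhdsWithin_iff] at he
      refine ⟨{y | y ∈ ({x}ᶜ : Set R2) → v y ≠ 0}, mem_nhdsWithin_of_mem_nhds he, ?_⟩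
      refine (finite_singleton x).subset ?_
      rintro y ⟨h1, h2, h3⟩
      by_contra hne
      exact h1 hne h3
    · refine ⟨{y | v y ≠ 0}, mem_nhdsWithin_of_mem_nhds
        (hv.continuous.continuousAt.eventually_ne h0), ?_⟩
      have : {y | y ∈ {y | v y ≠ 0} ∧ (y ∈ K ∧ v y = 0)} = ∅ := by
        ext y; simp; tauto
      rw [this]; exact finite_empty

lemma exists_small_radius (c1 c2 : ℝ) {ρ0 η : ℝ} (h0 : 0 < ρ0) (hη : 0 < η) :
    ∃ ρ, 0 < ρ ∧ ρ < ρ0 ∧ c1 * ρ ^ 2 ≤ η ∧ c2 * ρ ≤ η := by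
  have h1 : Tendsto (fun ρ : ℝ => c1 * ρ ^ 2) (𝓝[>] 0) (𝓝 0) := by
    have : Continuous (fun ρ : ℝ => c1 * ρ ^ 2) := by fun_prop
    have h := this.tendsto 0
    simp only [ne_eq, OfNat.ofNat_ne_zero, not_false_eq_true, zero_pow, mul_zero] at h
    exact h.mono_left nhdsWithin_le_nhds
  have h2 : Tendsto (fun ρ : ℝ => c2 * ρ) (𝓝[>] 0) (𝓝 0) := by
    have : Continuous (fun ρ : ℝ => c2 * ρ) := by fun_prop
    have h := this.tendsto 0
    simp only [mul_zero] at h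
    exact h.mono_left nhdsWithin_le_nhds
  have hI : ∀ᶠ ρ in 𝓝[>] (0:ℝ), ρ ∈ Ioo 0 ρ0 := Ioo_mem_nhdsGT h0
  obtain ⟨ρ, ⟨⟨h3, h4⟩, h5⟩, h6⟩ :=
    ((hI.and (h1.eventually_lt_const hη)).and (h2.eventually_lt_const hη)).exists
  exact ⟨ρ, h3, h4, h5.le, h6.le⟩

lemma factor {Ω : Set R2} (hΩb : Bornology.IsBounded Ω) : ∀ (n : ℕ) (v : R2 → ℂ),
    ContDiff ℝ (⊤ : ℕ∞) v → (∀ x ∈ closure Ω, v x = 0 → ∀ h, fderiv ℝ v x h = 0 → h = 0) →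
    {x | x ∈ closure Ω ∧ v x = 0}.ncard ≤ n → ∀ η : ℝ, 0 < η →
    ∃ (P : Finset R2) (s : R2 → Bool) (W : R2 → ℂ), ContDiff ℝ (⊤ : ℕ∞) W ∧
      (∀ x ∈ closure Ω, W x ≠ 0) ∧ (∀ p ∈ P, p ∈ closure Ω ∧ v p = 0) ∧
      ∫⁻ x in Ω, ‖uv (W x) * ∏ p ∈ P, uv (vx (s p) p x) - uv (v x)‖ₑ ≤ ENNReal.ofReal η ∧
      ∫⁻ x in Ω, ‖jf W x + ∑ p ∈ P, sr (s p) * jv p x - jf v x‖ₑ ≤ ENNReal.ofReal η := by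
  have hK : IsCompact (closure Ω) := hΩb.isCompact_closure
  intro n
  induction n with
  | zero =>
    intro v hv hnd hc η hη
    have hfin := finite_zeros hv hK hnd
    have h0 : {x | x ∈ closure Ω ∧ v x = 0} = ∅ := by
      rw [← Set.ncard_eq_zero hfin]; omega
    refine ⟨∅, fun _ => true, v, hv, ?_, by simp, by simp, by simp⟩
    intro x hx hx0
    have : x ∈ {x | x ∈ closure Ω ∧ v x = 0} := ⟨hx, hx0⟩
    rw [h0] at this; exact this
  | succ n ih =>
    intro v hv hnd hc η hη
    have hfin := finite_zeros hv hK hnd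
    by_cases hne : {x | x ∈ closure Ω ∧ v x = 0} = ∅
    · exact ih v hv hnd (by rw [hne]; simp) η hη
    obtain ⟨p, hpK, hp0⟩ := Set.nonempty_iff_ne_empty.2 hne
    obtain ⟨s0, ρ0, hρ0, C, hC, hstep⟩ := zero_step hv hp0 (hnd p hpK hp0)
    obtain ⟨ρ, hρ, hρρ, hη1, hη2⟩ := exists_small_radius (2 * Real.pi) (2 * C * (2 * Real.pi)) hρ0
      (half_pos hη)
    obtain ⟨W1, hW1c, hW1b, hW1v, hW1j⟩ := hstep ρ hρ hρρ
    have hout : ∀ x, W1 x = 0 → ρ / 2 < dist x p := by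
      intro x hx
      by_contra hcon
      exact hW1b x (mem_ball.2 (by linarith)) hx
    have hW1p : W1 p ≠ 0 := hW1b p (mem_ball_self hρ)
    have hvd : Differentiable ℝ v := hv.differentiable (by simp)
    have hW1d : Differentiable ℝ W1 := hW1c.differentiable (by simp)
    have hvxd : Differentiable ℝ (vx s0 p) := (contDiff_vx s0 p (n := 1)).differentiable (by simp)
    have hev : ∀ x, ρ / 2 < dist x p → (fun y => W1 y * vx s0 p y) =ᶠ[𝓝 x] v := by
      intro x hx
      have : IsOpen {y : R2 | ρ / 2 < dist y p} :=
        isOpen_lt continuous_const (continuous_id.dist continuous_const)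
      filter_upwards [this.mem_nhds hx] with y hy
      exact hW1v y hy
    obtain ⟨P, s, W, hWc, hW0, hP, hE1, hE2⟩ := ih W1 hW1c (by
      intro x hx hx0 h hh
      apply hnd x hx (by rw [← hW1v x (hout x hx0), hx0, zero_mul]) h
      rw [← (hev x (hout x hx0)).fderiv_eq, fderiv_fun_mul (hW1d x) (hvxd x)]
      simp [hx0, hh]) (by
      have hsub : {x | x ∈ closure Ω ∧ W1 x = 0} ⊆ {x | x ∈ closure Ω ∧ v x = 0} \ {p} := by
        rintro x ⟨hx, hx0⟩
        refine ⟨⟨hx, by rw [← hW1v x (hout x hx0), hx0, zero_mul]⟩, ?_⟩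
        rintro rfl
        exact hW1p hx0
      have h1 := Set.ncard_le_ncard hsub hfin.sdiff
      have h2 := Set.ncard_sdiff_singleton_add_one (a := p) (s := {x | x ∈ closure Ω ∧ v x = 0})
        ⟨hpK, hp0⟩ hfin
      omega) (η / 2) (half_pos hη)
    have hpP : p ∉ P := fun h => hW1p (hP p h).2
    have hne' : ∀ q ∈ P, q ≠ p := fun q hq h => hpP (h ▸ hq)
    refine ⟨insert p P, fun x => if x = p then s0 else s x, W, hWc, hW0, ?_, ?_, ?_⟩
    · intro q hq
      rcases Finset.mem_insert.1 hq with rfl | hq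
      · exact ⟨hpK, hp0⟩
      · obtain ⟨h1, h2⟩ := hP q hq
        exact ⟨h1, by rw [← hW1v q (hout q h2), h2, zero_mul]⟩
    · have hpt : ∀ x, ‖uv (W x) * ∏ q ∈ insert p P, uv (vx (if q = p then s0 else s q) q x)
          - uv (v x)‖ₑ ≤ ‖uv (W x) * ∏ q ∈ P, uv (vx (s q) q x) - uv (W1 x)‖ₑ +
            (ball p ρ).indicator (fun _ => ENNReal.ofReal 2) x := by
        intro x
        rw [Finset.prod_insert hpP]
        have e1 : ∏ q ∈ P, uv (vx (if q = p then s0 else s q) q x) = ∏ q ∈ P, uv (vx (s q) q x) :=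
          Finset.prod_congr rfl fun q hq => by rw [if_neg (hne' q hq)]
        rw [e1, if_pos rfl]
        set Q := ∏ q ∈ P, uv (vx (s q) q x)
        have e2 : uv (W x) * (uv (vx s0 p x) * Q) - uv (v x) =
            uv (vx s0 p x) * (uv (W x) * Q - uv (W1 x)) +
              (uv (W1 x) * uv (vx s0 p x) - uv (v x)) := by ring
        rw [e2]
        refine (enorm_add_le _ _).trans (add_le_add ?_ ?_)
        · rw [← ofReal_norm, ← ofReal_norm]
          apply ENNReal.ofReal_le_ofReal
          rw [norm_mul]
          exact mul_le_of_le_one_left (norm_nonneg _) (norm_uv_le _)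
        · by_cases hx : x ∈ ball p ρ
          · rw [Set.indicator_of_mem hx, ← ofReal_norm]
            apply ENNReal.ofReal_le_ofReal
            refine (norm_sub_le _ _).trans ?_
            rw [← uv_mul]
            linarith [norm_uv_le (W1 x * vx s0 p x), norm_uv_le (v x)]
          · rw [Set.indicator_of_notMem hx, ← uv_mul, hW1v x, sub_self]
            · simp
            · rw [mem_ball, not_lt] at hx; linarith
      refine (lintegral_mono hpt).trans ?_
      rw [lintegral_add_right _ (measurable_const.indicator measurableSet_ball)]
      have e3 : ENNReal.ofReal η = ENNReal.ofReal (η / 2) + ENNReal.ofReal (η / 2) := by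
        rw [← ENNReal.ofReal_add (by positivity) (by positivity)]; ring_nf
      rw [e3]
      refine add_le_add hE1 ?_
      refine (setLIntegral_le_lintegral _ _).trans ?_
      rw [lintegral_indicator measurableSet_ball, setLIntegral_const, Measure.addHaar_ball_center, vol_ball ρ hρ,
        ← ENNReal.ofReal_mul (by norm_num)]
      apply ENNReal.ofReal_le_ofReal
      linarith
    · have hae : ∀ᵐ x ∂volume.restrict Ω, x ≠ p ∧ (x ∈ closure Ω → v x ≠ 0) ∧ x ∈ closure Ω := by
        have h1 : ∀ᵐ x ∂volume.restrict Ω, x ∈ closure Ω :=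
          ae_restrict_of_ae_restrict_of_subset subset_closure
            (ae_restrict_mem isClosed_closure.measurableSet)
        have h2 : ∀ᵐ x ∂volume.restrict Ω, x ∉ {x | x ∈ closure Ω ∧ v x = 0} :=
          ae_restrict_of_ae (measure_eq_zero_iff_ae_notMem.1 (hfin.measure_zero _))
        filter_upwards [ae_ne p Ω, h1, h2] with x h3 h4 h5
        exact ⟨h3, fun h6 h7 => h5 ⟨h6, h7⟩, h4⟩
      have hpt : ∀ᵐ x ∂volume.restrict Ω,
          ‖jf W x + ∑ q ∈ insert p P, sr (if q = p then s0 else s q) * jv q x - jf v x‖ₑ ≤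
          ‖jf W x + ∑ q ∈ P, sr (s q) * jv q x - jf W1 x‖ₑ +
            (ball p ρ).indicator (fun x => ENNReal.ofReal (2 * C) * ENNReal.ofReal ‖x - p‖⁻¹) x := by
        filter_upwards [hae] with x ⟨hxp, hxv, hxΩ⟩
        rw [Finset.sum_insert hpP]
        have e1 : ∑ q ∈ P, ((sr (if q = p then s0 else s q) : ℝ) : ℂ) * jv q x =
            ∑ q ∈ P, ((sr (s q) : ℝ) : ℂ) * jv q x :=
          Finset.sum_congr rfl fun q hq => by rw [if_neg (hne' q hq)]
        rw [e1, if_pos rfl]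
        set Q := ∑ q ∈ P, ((sr (s q) : ℝ) : ℂ) * jv q x
        have e2 : jf W x + (sr s0 * jv p x + Q) - jf v x =
            (jf W x + Q - jf W1 x) + (jf W1 x + sr s0 * jv p x - jf v x) := by ring
        rw [e2]
        refine (enorm_add_le _ _).trans (add_le_add le_rfl ?_)
        by_cases hx : x ∈ ball p ρ
        · rw [Set.indicator_of_mem hx, ← ofReal_norm, ← ENNReal.ofReal_mul (by positivity)]
          apply ENNReal.ofReal_le_ofReal
          refine (norm_sub_le _ _).trans ?_
          obtain ⟨h1, h2⟩ := hW1j x hx hxp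
          linarith
        · have hx2 : ρ / 2 < dist x p := by rw [mem_ball, not_lt] at hx; linarith
          have hW10 : W1 x ≠ 0 := by
            intro h; apply hxv hxΩ; rw [← hW1v x hx2, h, zero_mul]
          rw [Set.indicator_of_notMem hx, ← jf_congr (hev x hx2),
            jf_mul (hW1d x) (hvxd x) hW10 (by rwa [Ne, vx_eq_zero]), jf_vx]
          simp
      refine (lintegral_mono_ae hpt).trans ?_
      have hm : Measurable (fun x : R2 => ENNReal.ofReal (2 * C) * ENNReal.ofReal ‖x - p‖⁻¹) := by
        fun_prop
      rw [lintegral_add_right _ (hm.indicator measurableSet_ball)]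
      have e3 : ENNReal.ofReal η = ENNReal.ofReal (η / 2) + ENNReal.ofReal (η / 2) := by
        rw [← ENNReal.ofReal_add (by positivity) (by positivity)]; ring_nf
      rw [e3]
      refine add_le_add hE2 ?_
      refine (setLIntegral_le_lintegral _ _).trans ?_
      rw [lintegral_indicator measurableSet_ball, lintegral_const_mul _ (by fun_prop),
        lint_inv_ball p hρ, ← ENNReal.ofReal_mul (by positivity)]
      apply ENNReal.ofReal_le_ofReal
      linarith

lemma generic_factor {Ω : Set R2} (hΩo : IsOpen Ω)
    (hΩb : Bornology.IsBounded Ω) (hΩl : HasLipschitzBoundary Ω)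
    {u : R2 → R2} {G : R2 → Matrix (Fin 2) (Fin 2) ℝ}
    (hu : MemW11 Ω u G) (hs : SphereValued Ω u) {η : ℝ} (hη : 0 < η) :
    ∃ (P : Finset R2) (s : R2 → Bool) (W : R2 → ℂ), ContDiff ℝ (⊤ : ℕ∞) W ∧
      (∀ x ∈ closure Ω, W x ≠ 0) ∧ (∀ p ∈ P, p ∈ closure Ω) ∧
      ∫⁻ x in Ω, ‖uv (W x) * ∏ p ∈ P, uv (vx (s p) p x) - cx (u x)‖ₑ ≤ ENNReal.ofReal η ∧
      ∫⁻ x in Ω, ‖jf W x + ∑ p ∈ P, sr (s p) * jv p x - wf u G x‖ₑ ≤ ENNReal.ofReal η := by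
  obtain ⟨v, hv, hnd, h1, h2⟩ := generic hΩo hΩb hΩl hu hs (half_pos hη)
  obtain ⟨P, s, W, hW, hW0, hP, h3, h4⟩ := factor hΩb _ v hv (fun x _ => hnd x) le_rfl (η / 2)
    (half_pos hη)
  have e3 : ENNReal.ofReal η = ENNReal.ofReal (η / 2) + ENNReal.ofReal (η / 2) := by
    rw [← ENNReal.ofReal_add (by positivity) (by positivity)]; ring_nf
  have hWm := hW.continuous.measurable
  have hvm := hv.continuous.measurable
  refine ⟨P, s, W, hW, hW0, fun p hp => (hP p hp).1, ?_, ?_⟩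
  · rw [e3]
    refine le_trans ?_ (add_le_add h3 h1)
    have hm : Measurable (fun x => ‖uv (W x) * ∏ p ∈ P, uv (vx (s p) p x) - uv (v x)‖ₑ) := by
      refine (Measurable.sub (Measurable.mul (measurable_uv.comp hWm) ?_)
        (measurable_uv.comp hvm)).enorm
      exact Finset.measurable_fun_prod _ fun p _ =>
        measurable_uv.comp (continuous_vx (s p) p).measurable
    rw [← lintegral_add_left hm]
    refine lintegral_mono fun x => ?_
    refine le_trans (le_of_eq ?_) (enorm_add_le _ _)
    congr 1; ring
  · rw [e3]
    refine le_trans ?_ (add_le_add h4 h2)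
    have hm : AEMeasurable (fun x => ‖jf W x + ∑ p ∈ P, sr (s p) * jv p x - jf v x‖ₑ)
        (volume.restrict Ω) := by
      refine (AEMeasurable.sub (AEMeasurable.add (aemeasurable_jf hWm.aemeasurable) ?_)
        (aemeasurable_jf hvm.aemeasurable)).enorm
      exact (Finset.measurable_fun_sum _ fun p _ =>
        (measurable_const.mul (measurable_jv p))).aemeasurable
    rw [← lintegral_add_left' hm]
    refine lintegral_mono fun x => ?_
    refine le_trans (le_of_eq ?_) (enorm_add_le _ _)
    congr 1; ring

/-! ### Pairing of currents with Lipschitz functions -/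

lemma ibp {N K : Set R2} (hN : IsOpen N) (hK : IsCompact K) (hKN : K ⊆ N) {f : R2 → ℝ}
    (hf : ContDiffOn ℝ 1 f N) {g : R2 → ℝ} {D : ℝ≥0} (hg : LipschitzWith D g)
    (hg0 : ∀ x, x ∉ K → g x = 0) (v : R2) :
    ∫ x, f x * fderiv ℝ g x v = - ∫ x, fderiv ℝ f x v * g x := by
  obtain ⟨K', hK'c, hKK', hK'N⟩ := exists_compact_between hK hN hKN
  obtain ⟨χ, hχ1, hχ0, -⟩ := exists_contMDiffMap_one_nhds_of_subset_interior (n := 1)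
    (modelWithCornersSelf ℝ R2) hK.isClosed hKK'
  have hχc : ContDiff ℝ 1 (fun x => χ x) := χ.contMDiff.contDiff
  set F : R2 → ℝ := fun x => χ x * f x with hF
  have hFc : ContDiff ℝ 1 F := by
    rw [contDiff_iff_contDiffAt]
    intro x
    by_cases hx : x ∈ N
    · exact hχc.contDiffAt.mul (hf.contDiffAt (hN.mem_nhds hx))
    · have hx' : x ∈ K'ᶜ := fun h => hx (hK'N h)
      have : F =ᶠ[𝓝 x] fun _ => 0 := by
        filter_upwards [hK'c.isClosed.isOpen_compl.mem_nhds hx'] with y hy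
        simp [hF, hχ0 y hy]
      exact contDiffAt_const.congr_of_eventuallyEq this
  have hFs : HasCompactSupport F := by
    apply HasCompactSupport.intro hK'c
    intro x hx; simp [hF, hχ0 x hx]
  obtain ⟨C, hC⟩ := hFc.lipschitzWith_of_hasCompactSupport hFs (by simp)
  have hgs : HasCompactSupport g := HasCompactSupport.intro hK hg0
  have hFK : ∀ x ∈ K, F =ᶠ[𝓝 x] f := by
    intro x hx
    filter_upwards [hχ1.filter_mono (nhds_le_nhdsSet hx)] with y hy
    simp [hF, hy]
  have main := hC.integral_lineDeriv_mul_eq (μ := volume) hg hgs v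
  have e1 : ∫ x, lineDeriv ℝ F x v * g x = ∫ x, fderiv ℝ f x v * g x := by
    congr 1; ext x
    by_cases hx : x ∈ K
    · rw [((hFc.differentiable (by simp)) x).lineDeriv_eq_fderiv, (hFK x hx).fderiv_eq]
    · simp [hg0 x hx]
  have e2 : ∫ x, lineDeriv ℝ g x (-v) * F x = - ∫ x, f x * fderiv ℝ g x v := by
    rw [← integral_neg]
    apply integral_congr_ae
    filter_upwards [hg.ae_differentiableAt (μ := volume)] with x hx
    rw [hx.lineDeriv_eq_fderiv, map_neg]
    by_cases hxK : x ∈ K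
    · rw [(hFK x hxK).eq_of_nhds]; ring
    · have : g =ᶠ[𝓝 x] fun _ => 0 := by
        filter_upwards [hK.isClosed.isOpen_compl.mem_nhds hxK] with y hy
        exact hg0 y hy
      rw [this.fderiv_eq]; simp
  rw [e1, e2] at main
  linarith

/-- integrand of the pairing -/
def pr (J : R2 → ℂ) (ψ : R2 → ℝ) (x : R2) : ℝ :=
  -((J x).im * fderiv ℝ ψ x (ee 0)) + (J x).re * fderiv ℝ ψ x (ee 1)

lemma abs_fderiv_ee_le {ψ : R2 → ℝ} {D : ℝ≥0} (hψ : LipschitzWith D ψ) (x : R2) (j : Fin 2) :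
    ‖fderiv ℝ ψ x (ee j)‖ ≤ D := by
  refine (ContinuousLinearMap.le_opNorm _ _).trans ?_
  have h1 := norm_fderiv_le_of_lipschitz ℝ hψ (x₀ := x)
  have h2 : ‖ee j‖ = 1 := by simp [ee]
  rw [h2, mul_one]; exact h1

lemma abs_pr_le {ψ : R2 → ℝ} {D : ℝ≥0} (hψ : LipschitzWith D ψ) (J : R2 → ℂ) (x : R2) :
    ‖pr J ψ x‖ ≤ 2 * D * ‖J x‖ := by
  unfold pr
  refine (norm_add_le _ _).trans ?_
  rw [norm_neg, norm_mul, norm_mul]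
  have h1 : ‖(J x).im‖ ≤ ‖J x‖ := Complex.abs_im_le_norm _
  have h2 : ‖(J x).re‖ ≤ ‖J x‖ := Complex.abs_re_le_norm _
  have h3 := mul_le_mul h1 (abs_fderiv_ee_le hψ x 0) (norm_nonneg _) (norm_nonneg _)
  have h4 := mul_le_mul h2 (abs_fderiv_ee_le hψ x 1) (norm_nonneg _) (norm_nonneg _)
  linarith

lemma integrable_pr {ψ : R2 → ℝ} {D : ℝ≥0} (hψ : LipschitzWith D ψ) {J : R2 → ℂ} {μ : Measure R2}
    (hJ : Integrable J μ) : Integrable (pr J ψ) μ := by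
  have hm (j : Fin 2) : Measurable (fun x => fderiv ℝ ψ x (ee j)) :=
    measurable_fderiv_apply_const ℝ ψ (ee j)
  refine Integrable.mono' (hJ.norm.const_mul (2 * D)) ?_
    (Filter.Eventually.of_forall fun x => abs_pr_le hψ J x)
  have hJm := hJ.aestronglyMeasurable.aemeasurable
  unfold pr
  refine AEMeasurable.aestronglyMeasurable ?_
  exact ((Complex.measurable_im.comp_aemeasurable hJm).mul (hm 0).aemeasurable).neg.add
    ((Complex.measurable_re.comp_aemeasurable hJm).mul (hm 1).aemeasurable)

/-- integration by parts for a field which is `C¹` near the support -/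
lemma integral_pr_smooth {N K : Set R2} (hN : IsOpen N) (hK : IsCompact K) (hKN : K ⊆ N)
    {J : R2 → ℂ} (hJ : ContDiffOn ℝ 1 J N) {ψ : R2 → ℝ} {D : ℝ≥0} (hψ : LipschitzWith D ψ)
    (hψ0 : ∀ x, x ∉ K → ψ x = 0) :
    ∫ x, pr J ψ x =
      ∫ x, (fderiv ℝ (fun y => (J y).im) x (ee 0) - fderiv ℝ (fun y => (J y).re) x (ee 1)) * ψ x := by
  have him : ContDiffOn ℝ 1 (fun y => (J y).im) N := Complex.imCLM.contDiff.comp_contDiffOn hJ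
  have hre : ContDiffOn ℝ 1 (fun y => (J y).re) N := Complex.reCLM.contDiff.comp_contDiffOn hJ
  have h0 := ibp hN hK hKN him hψ hψ0 (ee 0)
  have h1 := ibp hN hK hKN hre hψ hψ0 (ee 1)
  have hψs : HasCompactSupport ψ := HasCompactSupport.intro hK hψ0
  have hd0 : ∀ x ∉ K, ∀ j, fderiv ℝ ψ x (ee j) = 0 := by
    intro x hx j
    have : ψ =ᶠ[𝓝 x] fun _ => 0 := by
      filter_upwards [hK.isClosed.isOpen_compl.mem_nhds hx] with y hy
      exact hψ0 y hy
    rw [this.fderiv_eq]; simp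
  have hm (j : Fin 2) : Measurable (fun x => fderiv ℝ ψ x (ee j)) :=
    measurable_fderiv_apply_const ℝ ψ (ee j)
  have int1 : ∀ f : R2 → ℝ, ContDiffOn ℝ 1 f N → ∀ j,
      Integrable (fun x => f x * fderiv ℝ ψ x (ee j)) := by
    intro f hf j
    have h2 : IntegrableOn (fun x => f x * fderiv ℝ ψ x (ee j)) K := by
      have hfi : IntegrableOn f K := (hf.continuousOn.mono hKN).integrableOn_compact hK
      refine Integrable.mul_bdd (c := D) hfi (hm j).aestronglyMeasurable
        (Filter.Eventually.of_forall fun x => abs_fderiv_ee_le hψ x j)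
    rw [← integrableOn_univ]
    exact h2.of_forall_sdiff_eq_zero MeasurableSet.univ (fun x hx => by
      simp [hd0 x hx.2 j])
  have int2 : ∀ f : R2 → ℝ, ContDiffOn ℝ 1 f N → ∀ j : Fin 2,
      Integrable (fun x => fderiv ℝ f x (ee j) * ψ x) := by
    intro f hf j
    have h2 : IntegrableOn (fun x => fderiv ℝ f x (ee j) * ψ x) K := by
      refine ContinuousOn.integrableOn_compact hK ?_
      refine ContinuousOn.mul ?_ hψ.continuous.continuousOn
      exact ((hf.continuousOn_fderiv_of_isOpen hN (by simp)).mono hKN).clm_apply continuousOn_const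
    rw [← integrableOn_univ]
    exact h2.of_forall_sdiff_eq_zero MeasurableSet.univ (fun x hx => by
      simp [hψ0 x hx.2])
  unfold pr
  have hn : Integrable (fun x => -((J x).im * fderiv ℝ ψ x (ee 0))) := (int1 _ him 0).neg
  rw [integral_add hn (int1 _ hre 1), integral_neg, h0, h1]
  simp only [sub_mul]
  rw [integral_sub (int2 _ him 0) (int2 _ hre 1)]
  ring


lemma curl_aux {W : R2 → ℂ} (hW : ContDiff ℝ (⊤ : ℕ∞) W) {x : R2} (h0 : W x ≠ 0) (e e' : R2) :
    fderiv ℝ (fun y => (fderiv ℝ W y e / W y).im) x e' =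
      (fderiv ℝ (fderiv ℝ W) x e' e / W x - fderiv ℝ W x e * fderiv ℝ W x e' / W x ^ 2).im := by
  have h1 : HasFDerivAt (fderiv ℝ W) (fderiv ℝ (fderiv ℝ W) x) x :=
    ((hW.fderiv_right (m := 1) (by norm_cast)).differentiable (by simp) x).hasFDerivAt
  have h2 : HasFDerivAt W (fderiv ℝ W x) x := (hW.differentiable (by simp) x).hasFDerivAt
  have h3 := h1.clm_apply (hasFDerivAt_const e x)
  have h4 : HasFDerivAt (fun y => (W y)⁻¹) (-(W x ^ 2)⁻¹ • fderiv ℝ W x) x :=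
    HasDerivAt.comp_hasFDerivAt_of_eq x (hasDerivAt_inv h0) h2 rfl
  have h5 : HasFDerivAt (fun y => fderiv ℝ W y e * (W y)⁻¹) _ x := h3.mul h4
  have h6 := Complex.imCLM.hasFDerivAt.comp x h5
  have h7 : (fun y => (fderiv ℝ W y e / W y).im) =
      (Complex.imCLM ∘ fun y => fderiv ℝ W y e * (W y)⁻¹) := by
    ext y; simp [div_eq_mul_inv]
  rw [h7, h6.fderiv, ContinuousLinearMap.comp_apply, Complex.imCLM_apply]
  congr 1
  simp [div_eq_mul_inv]
  ring

lemma contDiffOn_jf {W : R2 → ℂ} (hW : ContDiff ℝ (⊤ : ℕ∞) W) :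
    ContDiffOn ℝ 1 (jf W) {x | W x ≠ 0} := by
  have h1 : ContDiff ℝ 1 (fderiv ℝ W) := hW.fderiv_right (m := 1) (by norm_cast)
  have hW1 : ContDiff ℝ 1 W := hW.of_le (by norm_cast)
  have h2 (e : R2) : ContDiffOn ℝ 1 (fun y => (fderiv ℝ W y e / W y).im) {x | W x ≠ 0} := by
    have : ContDiffOn ℝ 1 (fun y => fderiv ℝ W y e / W y) {x | W x ≠ 0} := by
      simp only [div_eq_mul_inv]
      exact (h1.clm_apply contDiff_const).contDiffOn.mul (hW1.contDiffOn.inv fun x hx => hx)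
    exact Complex.imCLM.contDiff.comp_contDiffOn this
  have h3 : jf W = fun x => Complex.ofRealCLM ((fderiv ℝ W x (ee 0) / W x).im) +
      Complex.ofRealCLM ((fderiv ℝ W x (ee 1) / W x).im) * Complex.I := by
    ext x; exact Complex.mk_eq_add_mul_I _ _
  rw [h3]
  exact (Complex.ofRealCLM.contDiff.comp_contDiffOn (h2 (ee 0))).add
    ((Complex.ofRealCLM.contDiff.comp_contDiffOn (h2 (ee 1))).mul contDiffOn_const)

lemma pair_W {W : R2 → ℂ} (hW : ContDiff ℝ (⊤ : ℕ∞) W) {K : Set R2} (hK : IsCompact K)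
    (hWK : ∀ x ∈ K, W x ≠ 0) {ψ : R2 → ℝ} {D : ℝ≥0} (hψ : LipschitzWith D ψ)
    (hψ0 : ∀ x, x ∉ K → ψ x = 0) : ∫ x, pr (jf W) ψ x = 0 := by
  have hN : IsOpen {x | W x ≠ 0} := isOpen_ne_fun hW.continuous continuous_const
  rw [integral_pr_smooth hN hK hWK (contDiffOn_jf hW) hψ hψ0]
  rw [← integral_zero R2 ℝ (μ := volume)]
  congr 1; ext x
  by_cases hx : x ∈ K
  · have e1 := curl_aux hW (hWK x hx) (ee 1) (ee 0)
    have e2 := curl_aux hW (hWK x hx) (ee 0) (ee 1)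
    have hs : fderiv ℝ (fderiv ℝ W) x (ee 0) (ee 1) = fderiv ℝ (fderiv ℝ W) x (ee 1) (ee 0) := by
      have : IsSymmSndFDerivAt ℝ W x :=
        (hW.contDiffAt (x := x)).isSymmSndFDerivAt (by rw [minSmoothness_of_isRCLikeNormedField]; exact WithTop.coe_le_coe.2 le_top)
      exact this _ _
    simp only [jf]
    rw [e1, e2, hs, mul_comm (fderiv ℝ W x (ee 1))]
    simp
  · simp [hψ0 x hx]

lemma kernel_mass : Integrable (fun y : R2 => 2 / (‖y‖ ^ 2 + 1) ^ 2) ∧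
    ∫ y : R2, 2 / (‖y‖ ^ 2 + 1) ^ 2 = 2 * Real.pi := by
  have hd : ∀ y ∈ Ici (0 : ℝ), HasDerivAt (fun y : ℝ => - (y ^ 2 + 1)⁻¹) (y * (2 / (y ^ 2 + 1) ^ 2)) y := by
    intro y _
    have h0 : y ^ 2 + 1 ≠ 0 := by positivity
    have := (((hasDerivAt_pow 2 y).add_const (1 : ℝ)).inv h0).neg
    refine this.congr_deriv ?_
    field_simp
    simp [mul_comm]
  have hlim : Tendsto (fun y : ℝ => - (y ^ 2 + 1)⁻¹) atTop (𝓝 0) := by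
    rw [← neg_zero]
    apply Tendsto.neg
    apply Tendsto.inv_tendsto_atTop
    exact tendsto_atTop_add_const_right _ _ (tendsto_pow_atTop two_ne_zero)
  have hpos : ∀ y ∈ Ioi (0 : ℝ), 0 ≤ y * (2 / (y ^ 2 + 1) ^ 2) := by
    intro y hy
    have : 0 < y := hy
    positivity
  have hi := integrableOn_Ioi_deriv_of_nonneg' hd hpos hlim
  have hv := integral_Ioi_of_hasDerivAt_of_nonneg' hd hpos hlim
  have hdim : Module.finrank ℝ R2 = 2 := by simp
  constructor
  · rw [integrable_fun_norm_addHaar volume (f := fun r : ℝ => 2 / (r ^ 2 + 1) ^ 2), hdim]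
    simpa using hi
  · rw [integral_fun_norm_addHaar volume (fun r : ℝ => 2 / (r ^ 2 + 1) ^ 2), hdim, vol_ball_one]
    simp at hv ⊢
    rw [hv]


/-- regularized vortex current -/
def jreg (δ : ℝ) (p x : R2) : ℂ :=
  ⟨-(x 1 - p 1) * (‖x - p‖ ^ 2 + δ ^ 2)⁻¹, (x 0 - p 0) * (‖x - p‖ ^ 2 + δ ^ 2)⁻¹⟩

lemma jv_eq (p x : R2) : jv p x = jreg 0 p x := by
  unfold jv jreg
  rw [I_div_conj]
  have : Complex.normSq (cx x - cx p) = ‖x - p‖ ^ 2 := by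
    rw [Complex.normSq_eq_norm_sq, ← map_sub, LinearIsometryEquiv.norm_map]
  rw [this]
  simp [cx_re, cx_im, div_eq_mul_inv]

lemma norm_jreg_le (δ : ℝ) (p x : R2) : ‖jreg δ p x‖ ≤ ‖x - p‖⁻¹ := by
  by_cases hx : ‖x - p‖ = 0
  · have : x = p := by rwa [norm_eq_zero, sub_eq_zero] at hx
    subst this
    have : jreg δ x x = 0 := by apply Complex.ext <;> simp [jreg]
    simp [this]
  · have h1 : jreg δ p x = ((‖x - p‖ ^ 2 / (‖x - p‖ ^ 2 + δ ^ 2) : ℝ) : ℂ) * jv p x := by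
      rw [jv_eq]
      have : ‖x - p‖ ^ 2 + δ ^ 2 ≠ 0 := by positivity
      apply Complex.ext
      · simp only [jreg, Complex.re_ofReal_mul]; field_simp; simp
      · simp only [jreg, Complex.im_ofReal_mul]; field_simp; simp
    rw [h1, norm_mul, norm_jv, Complex.norm_real]
    apply mul_le_of_le_one_left (by positivity)
    rw [Real.norm_of_nonneg (by positivity)]
    apply div_le_one_of_le₀ <;> nlinarith [sq_nonneg δ, sq_nonneg ‖x - p‖]

lemma contDiff_coord (p : R2) (i : Fin 2) {n : WithTop ℕ∞} : ContDiff ℝ n (fun x : R2 => x i - p i) :=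
  (EuclideanSpace.proj i : R2 →L[ℝ] ℝ).contDiff.sub contDiff_const

lemma contDiff_jreg {δ : ℝ} (hδ : 0 < δ) (p : R2) : ContDiff ℝ 1 (jreg δ p) := by
  have hq : ContDiff ℝ 1 (fun x : R2 => (‖x - p‖ ^ 2 + δ ^ 2)⁻¹) := by
    refine ContDiff.inv ?_ (fun x => by positivity)
    exact ((contDiff_id.sub contDiff_const).norm_sq ℝ).add contDiff_const
  have h1 : ContDiff ℝ 1 (fun x : R2 => -(x 1 - p 1) * (‖x - p‖ ^ 2 + δ ^ 2)⁻¹) :=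
    (contDiff_coord p 1).neg.mul hq
  have h2 : ContDiff ℝ 1 (fun x : R2 => (x 0 - p 0) * (‖x - p‖ ^ 2 + δ ^ 2)⁻¹) :=
    (contDiff_coord p 0).mul hq
  exact contDiff_cmk h1 h2

lemma hasFDerivAt_coord (p : R2) (i : Fin 2) (x : R2) :
    HasFDerivAt (fun x : R2 => x i - p i) (EuclideanSpace.proj i : R2 →L[ℝ] ℝ) x :=
  (EuclideanSpace.proj i : R2 →L[ℝ] ℝ).hasFDerivAt.sub_const _

lemma curl_jreg {δ : ℝ} (hδ : 0 < δ) (p x : R2) :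
    fderiv ℝ (fun y => (jreg δ p y).im) x (ee 0) - fderiv ℝ (fun y => (jreg δ p y).re) x (ee 1) =
      2 * δ ^ 2 / (‖x - p‖ ^ 2 + δ ^ 2) ^ 2 := by
  have hn : ∀ y : R2, ‖y - p‖ ^ 2 = (y 0 - p 0) ^ 2 + (y 1 - p 1) ^ 2 := by
    intro y
    rw [EuclideanSpace.norm_sq_eq]; simp
  have h0 := hasFDerivAt_coord p 0 x
  have h1 := hasFDerivAt_coord p 1 x
  have hq0 : (x 0 - p 0) ^ 2 + (x 1 - p 1) ^ 2 + δ ^ 2 ≠ 0 := by positivity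
  have hq := ((h0.pow 2).add (h1.pow 2)).add_const (δ ^ 2)
  have hi : HasFDerivAt (fun y : R2 => ((y 0 - p 0) ^ 2 + (y 1 - p 1) ^ 2 + δ ^ 2)⁻¹) _ x :=
    HasDerivAt.comp_hasFDerivAt_of_eq x (hasDerivAt_inv hq0) hq rfl
  have e1 : HasFDerivAt
      (fun y : R2 => (y 0 - p 0) * ((y 0 - p 0) ^ 2 + (y 1 - p 1) ^ 2 + δ ^ 2)⁻¹) _ x := h0.mul hi
  have e2 : HasFDerivAt
      (fun y : R2 => -(y 1 - p 1) * ((y 0 - p 0) ^ 2 + (y 1 - p 1) ^ 2 + δ ^ 2)⁻¹) _ x :=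
    h1.neg.mul hi
  simp only [jreg, hn]
  rw [e1.fderiv, e2.fderiv]
  simp
  field_simp
  ring

lemma integrableOn_inv_norm (p : R2) {K : Set R2} (hK : Bornology.IsBounded K) :
    IntegrableOn (fun x => ‖x - p‖⁻¹) K := by
  refine ⟨by fun_prop, ?_⟩
  rw [hasFiniteIntegral_iff_ofReal (Filter.Eventually.of_forall fun x => by positivity)]
  exact lint_inv_lt_top p hK

lemma integrableOn_jv (p : R2) {K : Set R2} (hK : Bornology.IsBounded K) :
    IntegrableOn (jv p) K := by
  refine Integrable.mono' (integrableOn_inv_norm p hK) (measurable_jv p).aestronglyMeasurable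
    (Filter.Eventually.of_forall fun x => (norm_jv p x).le)

lemma pr_zero_off {K : Set R2} (hK : IsClosed K) {ψ : R2 → ℝ}
    (hψ0 : ∀ x, x ∉ K → ψ x = 0) (J : R2 → ℂ) : ∀ x, x ∉ K → pr J ψ x = 0 := by
  intro x hx
  have : ψ =ᶠ[𝓝 x] fun _ => 0 := by
    filter_upwards [hK.isOpen_compl.mem_nhds hx] with y hy
    exact hψ0 y hy
  unfold pr
  rw [this.fderiv_eq]; simp

lemma jreg_lim (p x : R2) (hx : x ≠ p) {d : ℕ → ℝ} (hd : Tendsto d atTop (𝓝 0)) :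
    Tendsto (fun n => jreg (d n) p x) atTop (𝓝 (jv p x)) := by
  rw [jv_eq]
  have h0 : ‖x - p‖ ^ 2 + 0 ^ 2 ≠ 0 := by
    have : 0 < ‖x - p‖ := norm_pos_iff.2 (sub_ne_zero.2 hx)
    positivity
  have h1 : Tendsto (fun n => (‖x - p‖ ^ 2 + d n ^ 2)⁻¹) atTop (𝓝 (‖x - p‖ ^ 2 + 0 ^ 2)⁻¹) :=
    (tendsto_const_nhds.add (hd.pow 2)).inv₀ h0
  have e : ∀ δ, jreg δ p x = ((‖x - p‖ ^ 2 + δ ^ 2)⁻¹ : ℝ) * (⟨-(x 1 - p 1), x 0 - p 0⟩ : ℂ) := by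
    intro δ
    apply Complex.ext
    · simp only [jreg, Complex.re_ofReal_mul]; ring
    · simp only [jreg, Complex.im_ofReal_mul]; ring
  simp only [e]
  exact ((Complex.continuous_ofReal.tendsto _).comp h1).mul_const _

lemma pair_p (p : R2) {K : Set R2} (hK : IsCompact K)
    {ψ : R2 → ℝ} {D : ℝ≥0} (hψ : LipschitzWith D ψ) {M : ℝ} (hM : ∀ x, ‖ψ x‖ ≤ M)
    (hψ0 : ∀ x, x ∉ K → ψ x = 0) : ∫ x, pr (jv p) ψ x = 2 * Real.pi * ψ p := by
  set d : ℕ → ℝ := fun n => 1 / ((n : ℝ) + 1) with hd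
  have hdpos : ∀ n, 0 < d n := fun n => by simp only [hd]; positivity
  have hdlim : Tendsto d atTop (𝓝 0) := tendsto_one_div_add_atTop_nhds_zero_nat
  have hKset : ∀ J, ∫ x, pr J ψ x = ∫ x in K, pr J ψ x := fun J =>
    (setIntegral_eq_integral_of_forall_compl_eq_zero (pr_zero_off hK.isClosed hψ0 J)).symm
  have hm (j : Fin 2) : Measurable (fun x => fderiv ℝ ψ x (ee j)) :=
    measurable_fderiv_apply_const ℝ ψ (ee j)
  have lim1 : Tendsto (fun n => ∫ x, pr (jreg (d n) p) ψ x) atTop (𝓝 (∫ x, pr (jv p) ψ x)) := by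
    simp only [hKset]
    refine tendsto_integral_of_dominated_convergence (fun x => 2 * D * ‖x - p‖⁻¹) ?_
      ((integrableOn_inv_norm p hK.isBounded).const_mul _) ?_ ?_
    · intro n
      have hc : Measurable (jreg (d n) p) := (contDiff_jreg (hdpos n) p).continuous.measurable
      refine Measurable.aestronglyMeasurable ?_
      exact ((Complex.measurable_im.comp hc).mul (hm 0)).neg.add
        ((Complex.measurable_re.comp hc).mul (hm 1))
    · intro n
      refine Filter.Eventually.of_forall fun x => ?_
      refine (abs_pr_le hψ _ x).trans ?_
      have := norm_jreg_le (d n) p x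
      gcongr
    · filter_upwards [ae_ne p K] with x hx
      have h := jreg_lim p x hx hdlim
      have hi := (Complex.continuous_im.tendsto _).comp h
      have hr := (Complex.continuous_re.tendsto _).comp h
      exact (hi.mul_const _).neg.add (hr.mul_const _)
  have e2 : ∀ n, ∫ x, pr (jreg (d n) p) ψ x =
      ∫ y : R2, 2 / (‖y‖ ^ 2 + 1) ^ 2 * ψ (p + d n • y) := by
    intro n
    rw [integral_pr_smooth isOpen_univ hK (subset_univ _) (contDiff_jreg (hdpos n) p).contDiffOn
      hψ hψ0]
    simp only [curl_jreg (hdpos n)]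
    rw [← integral_add_left_eq_self _ p]
    have h3 := Measure.integral_comp_smul (volume : Measure R2)
      (fun x => 2 * d n ^ 2 / (‖p + x - p‖ ^ 2 + d n ^ 2) ^ 2 * ψ (p + x)) (d n)
    have hdim : Module.finrank ℝ R2 = 2 := by simp
    have hdn := hdpos n
    rw [hdim, abs_of_nonneg (by positivity), smul_eq_mul] at h3
    have h4 : ∫ x, 2 * d n ^ 2 / (‖p + x - p‖ ^ 2 + d n ^ 2) ^ 2 * ψ (p + x) =
        d n ^ 2 * ∫ x : R2, 2 * d n ^ 2 / (‖p + d n • x - p‖ ^ 2 + d n ^ 2) ^ 2 * ψ (p + d n • x) := by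
      rw [h3]; field_simp
    rw [h4, ← integral_const_mul]
    congr 1; ext y
    have e5 : ‖p + d n • y - p‖ = d n * ‖y‖ := by
      rw [add_sub_cancel_left, norm_smul, Real.norm_of_nonneg hdn.le]
    rw [e5]
    have h6 : ‖y‖ ^ 2 + 1 ≠ 0 := by positivity
    have h7 : (d n * ‖y‖) ^ 2 + d n ^ 2 = d n ^ 2 * (‖y‖ ^ 2 + 1) := by ring
    rw [h7]
    field_simp
  obtain ⟨hki, hkv⟩ := kernel_mass
  have lim2 : Tendsto (fun n => ∫ y : R2, 2 / (‖y‖ ^ 2 + 1) ^ 2 * ψ (p + d n • y)) atTop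
      (𝓝 (∫ y : R2, 2 / (‖y‖ ^ 2 + 1) ^ 2 * ψ p)) := by
    refine tendsto_integral_of_dominated_convergence (fun y : R2 => 2 / (‖y‖ ^ 2 + 1) ^ 2 * M) ?_
      (hki.mul_const _) ?_ ?_
    · intro n
      have : Continuous (fun y => ψ (p + d n • y)) := hψ.continuous.comp (by fun_prop)
      exact (hki.aestronglyMeasurable).mul this.aestronglyMeasurable
    · intro n
      refine Filter.Eventually.of_forall fun y => ?_
      rw [norm_mul, Real.norm_of_nonneg (by positivity)]
      have := hM (p + d n • y)
      gcongr
    · refine Filter.Eventually.of_forall fun y => ?_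
      refine Tendsto.const_mul _ ?_
      have h8 : Tendsto (fun n => p + d n • y) atTop (𝓝 p) := by
        have := (tendsto_const_nhds (x := p)).add (hdlim.smul_const y)
        simpa using this
      exact (hψ.continuous.tendsto p).comp h8
  rw [integral_mul_const, hkv] at lim2
  simp only [e2] at lim1
  exact tendsto_nhds_unique lim1 lim2


lemma integrableOn_wf {Ω : Set R2} {u : R2 → R2} {G : R2 → Matrix (Fin 2) (Fin 2) ℝ}
    (hu : MemW11 Ω u G) (hs : SphereValued Ω u) : IntegrableOn (wf u G) Ω := by
  obtain ⟨h1, h2, -⟩ := hu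
  have hum : ∀ i : Fin 2, AEStronglyMeasurable (fun x => u x i) (volume.restrict Ω) := fun i =>
    (EuclideanSpace.proj i : R2 →L[ℝ] ℝ).continuous.comp_aestronglyMeasurable h1.aestronglyMeasurable
  have hub : ∀ i : Fin 2, ∀ᵐ x ∂volume.restrict Ω, ‖u x i‖ ≤ 1 := fun i => by
    filter_upwards [hs] with x hx
    rw [← hx]; exact PiLp.norm_apply_le (u x) i
  have hprod : ∀ i k j : Fin 2, Integrable (fun x => u x i * G x k j) (volume.restrict Ω) :=
    fun i k j => (h2 k j).bdd_mul (hum i) (hub i)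
  have e : wf u G = fun x => ((u x 0 * G x 1 0 - u x 1 * G x 0 0 : ℝ) : ℂ) +
      ((u x 0 * G x 1 1 - u x 1 * G x 0 1 : ℝ) : ℂ) * Complex.I := by
    ext x; exact Complex.mk_eq_add_mul_I _ _
  rw [e]
  exact (((hprod 0 1 0).sub (hprod 1 0 0)).ofReal).add
    ((((hprod 0 1 1).sub (hprod 1 0 1)).ofReal).mul_const _)

lemma pairing_bound {Ω : Set R2} (hΩb : Bornology.IsBounded Ω)
    {u : R2 → R2} {G : R2 → Matrix (Fin 2) (Fin 2) ℝ}
    (hu : MemW11 Ω u G) (hs : SphereValued Ω u) {η : ℝ} (hη : 0 < η)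
    (P : Finset R2) (s : R2 → Bool) {W : R2 → ℂ} (hW : ContDiff ℝ (⊤ : ℕ∞) W)
    (hW0 : ∀ x ∈ closure Ω, W x ≠ 0)
    (hE : ∫⁻ x in Ω, ‖jf W x + ∑ p ∈ P, sr (s p) * jv p x - wf u G x‖ₑ ≤ ENNReal.ofReal η)
    {K : Set R2} (hK : IsCompact K) (hKΩ : K ⊆ Ω) {ψ : R2 → ℝ} (hψ : LipschitzWith 2 ψ)
    (hψ1 : ∀ x, ‖ψ x‖ ≤ 1) (hψ0 : ∀ x, x ∉ K → ψ x = 0) :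
    Real.pi * ∑ p ∈ P, sr (s p) * ψ p ≤ detPairing Ω u G ψ + 2 * η := by
  have hKset : ∀ J, ∫ x in Ω, pr J ψ x = ∫ x, pr J ψ x := fun J =>
    setIntegral_eq_integral_of_forall_compl_eq_zero
      fun x hx => pr_zero_off hK.isClosed hψ0 J x fun h => hx (hKΩ h)
  have hjW : IntegrableOn (jf W) Ω := by
    have : IntegrableOn (jf W) (closure Ω) :=
      ((contDiffOn_jf hW).continuousOn.mono hW0).integrableOn_compact hΩb.isCompact_closure
    exact this.mono_set subset_closure
  have hjv : ∀ p, IntegrableOn (jv p) Ω := fun p => integrableOn_jv p hΩb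
  have hwf := integrableOn_wf hu hs
  set J : R2 → ℂ := fun x => jf W x + ∑ p ∈ P, sr (s p) * jv p x with hJ
  have hJi : IntegrableOn J Ω :=
    hjW.add (integrable_finsetSum _ fun p _ => (hjv p).const_mul _)
  have h1 : ∫ x in Ω, pr J ψ x = 2 * Real.pi * ∑ p ∈ P, sr (s p) * ψ p := by
    have e : ∀ x, pr J ψ x = pr (jf W) ψ x + ∑ p ∈ P, sr (s p) * pr (jv p) ψ x := by
      intro x
      simp only [pr, hJ, Complex.add_re, Complex.add_im, Complex.re_sum, Complex.im_sum,
        Complex.re_ofReal_mul, Complex.im_ofReal_mul, mul_add, Finset.sum_add_distrib, add_mul,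
        Finset.sum_mul, mul_neg, Finset.sum_neg_distrib, neg_add]
      simp only [mul_assoc]
      ring
    simp only [e]
    rw [integral_add (integrable_pr hψ hjW)
      (integrable_finsetSum _ fun p _ => (integrable_pr hψ (hjv p)).const_mul _),
      integral_finsetSum _ fun p _ => (integrable_pr hψ (hjv p)).const_mul _, hKset,
      pair_W hW hK (fun x hx => hW0 x (subset_closure (hKΩ hx))) hψ hψ0, zero_add, Finset.mul_sum]
    refine Finset.sum_congr rfl fun p _ => ?_
    rw [integral_const_mul, hKset, pair_p p hK hψ hψ1 hψ0]
    ring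
  have h2 : detPairing Ω u G ψ = (1 / 2) * ∫ x in Ω, pr (wf u G) ψ x := by
    unfold detPairing
    rw [← integral_const_mul]
    congr 1; ext x
    simp [lambdaVec, pr, wf]
    ring
  have h3 : (∫ x in Ω, pr J ψ x) - ∫ x in Ω, pr (wf u G) ψ x ≤ 4 * η := by
    rw [← integral_sub (integrable_pr hψ hJi) (integrable_pr hψ hwf)]
    have e : ∀ x, pr J ψ x - pr (wf u G) ψ x = pr (fun x => J x - wf u G x) ψ x := by
      intro x; simp only [pr, Complex.sub_re, Complex.sub_im]; ring
    simp only [e]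
    have hi : Integrable (fun x => J x - wf u G x) (volume.restrict Ω) := hJi.sub hwf
    calc ∫ x in Ω, pr (fun x => J x - wf u G x) ψ x
        ≤ ∫ x in Ω, 4 * ‖J x - wf u G x‖ := by
          refine integral_mono (integrable_pr hψ hi) (hi.norm.const_mul 4) fun x => ?_
          refine (le_abs_self _).trans ((abs_pr_le hψ _ x).trans (le_of_eq ?_))
          push_cast; ring
      _ = 4 * ∫ x in Ω, ‖J x - wf u G x‖ := integral_const_mul _ _
      _ ≤ 4 * η := by
          have : ∫ x in Ω, ‖J x - wf u G x‖ ≤ η := by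
            rw [integral_norm_eq_lintegral_enorm hi.aestronglyMeasurable]
            exact ENNReal.toReal_le_of_le_ofReal hη.le hE
          linarith
  rw [h2]
  linarith


/-- soft threshold -/
def st (t y : ℝ) : ℝ := max (y - t) 0 + min (y + t) 0

lemma st_lip {t : ℝ} (ht : 0 < t) (x y : ℝ) : |st t x - st t y| ≤ |x - y| := by
  unfold st
  rcases max_cases (x - t) 0 with h1 | h1 <;> rcases min_cases (x + t) 0 with h2 | h2 <;>
  rcases max_cases (y - t) 0 with h3 | h3 <;> rcases min_cases (y + t) 0 with h4 | h4 <;>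
  rw [h1.1, h2.1, h3.1, h4.1, abs_le] <;>
  constructor <;> cases abs_cases (x - y) <;> linarith

lemma st_abs {t : ℝ} (ht : 0 < t) (y : ℝ) : |st t y| ≤ |y| := by
  have h := st_lip ht y 0
  have h0 : st t 0 = 0 := by
    unfold st
    rw [max_eq_right (by linarith), min_eq_right (by linarith)]; simp
  simpa [h0] using h

lemma st_sub {t : ℝ} (ht : 0 < t) (y : ℝ) : |st t y - y| ≤ t := by
  unfold st
  rcases max_cases (y - t) 0 with h3 | h3 <;> rcases min_cases (y + t) 0 with h4 | h4 <;>
  rw [h3.1, h4.1, abs_le] <;> constructor <;> linarith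

lemma st_zero {t y : ℝ} (h : |y| < t) : st t y = 0 := by
  unfold st
  rw [abs_lt] at h
  rw [max_eq_right (by linarith), min_eq_right (by linarith)]; simp

lemma flat_bound {Ω C : Set R2} (hΩo : IsOpen Ω) (hΩb : Bornology.IsBounded Ω)
    {u : R2 → R2} {G : R2 → Matrix (Fin 2) (Fin 2) ℝ}
    (hu : MemW11 Ω u G) (hs : SphereValued Ω u) {η : ℝ} (hη : 0 < η)
    (P : Finset R2) (s : R2 → Bool) {W : R2 → ℂ} (hW : ContDiff ℝ (⊤ : ℕ∞) W)
    (hW0 : ∀ x ∈ closure Ω, W x ≠ 0)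
    (hE : ∫⁻ x in Ω, ‖jf W x + ∑ p ∈ P, sr (s p) * jv p x - wf u G x‖ₑ ≤ ENNReal.ofReal η)
    {φ : R2 → ℝ} (hφ : ∀ x y, |φ x - φ y| ≤ 2 * dist x y) (hφ1 : ∀ x, |φ x| ≤ 1)
    (hφ0 : ∀ x ∈ Ωᶜ ∪ C, φ x = 0) :
    ENNReal.ofReal (Real.pi * ∑ p ∈ P, sr (s p) * φ p) ≤
      flatNormOn Ω (frontier Ω ∪ C) 2 (detPairing Ω u G) + ENNReal.ofReal (3 * η) := by
  set n : ℝ := (P.card : ℝ) with hn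
  have hn0 : 0 ≤ n := Nat.cast_nonneg _
  set t : ℝ := η / (Real.pi * (n + 1)) with ht
  have hpi := Real.pi_pos
  have ht0 : 0 < t := by positivity
  have hφc : Continuous φ := by
    refine (LipschitzWith.of_dist_le_mul (K := 2) fun x y => ?_).continuous
    rw [Real.dist_eq]; exact_mod_cast hφ x y
  set ψ : R2 → ℝ := fun x => st t (φ x) with hψ
  have hψl : LipschitzWith 2 ψ := by
    refine LipschitzWith.of_dist_le_mul fun x y => ?_
    rw [Real.dist_eq]; exact_mod_cast (st_lip ht0 _ _).trans (hφ x y)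
  have hψ1 : ∀ x, |ψ x| ≤ 1 := fun x => (st_abs ht0 _).trans (hφ1 x)
  set K : Set R2 := {x | t ≤ |φ x|} with hK
  have hKΩ : K ⊆ Ω := by
    intro x hx
    by_contra h
    have : φ x = 0 := hφ0 x (Or.inl h)
    simp only [hK, Set.mem_setOf_eq, this, abs_zero] at hx
    linarith
  have hKc : IsCompact K :=
    Metric.isCompact_of_isClosed_isBounded (isClosed_le continuous_const hφc.abs) (hΩb.subset hKΩ)
  have hψ0 : ∀ x, x ∉ K → ψ x = 0 := fun x hx => st_zero (not_le.1 hx)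
  have hpb := pairing_bound hΩb hu hs hη P s hW hW0 hE hKc hKΩ hψl hψ1 hψ0
  have hadm : FlatAdmissible Ω (frontier Ω ∪ C) 2 ψ := by
    refine ⟨hψl.lipschitzOnWith, ?_, fun p _ => hψ1 p⟩
    intro p hp
    have hp' : p ∈ Ωᶜ ∪ C := by
      rcases hp with hp | hp
      · left; rw [hΩo.frontier_eq] at hp; exact hp.2
      · exact Or.inr hp
    refine st_zero ?_
    rw [hφ0 p hp']; simpa using ht0
  have hle : ENNReal.ofReal (detPairing Ω u G ψ) ≤
      flatNormOn Ω (frontier Ω ∪ C) 2 (detPairing Ω u G) :=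
    le_iSup₂ (f := fun φ (_ : φ ∈ {φ : R2 → ℝ | FlatAdmissible Ω (frontier Ω ∪ C) 2 φ}) =>
      ENNReal.ofReal (detPairing Ω u G φ)) ψ hadm
  have hsum : ∑ p ∈ P, sr (s p) * φ p ≤ ∑ p ∈ P, sr (s p) * ψ p + n * t := by
    have : ∑ p ∈ P, (sr (s p) * φ p - sr (s p) * ψ p) ≤ ∑ p ∈ P, t := by
      refine Finset.sum_le_sum fun p _ => ?_
      have h1 := st_sub ht0 (φ p)
      rw [abs_le] at h1
      rcases h : s p <;> simp only [sr, h, if_true, hψ] <;> simp <;> linarith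
    rw [Finset.sum_sub_distrib, Finset.sum_const, nsmul_eq_mul] at this
    linarith
  have hnt : Real.pi * (n * t) ≤ η := by
    have e : Real.pi * (n * t) = η * (n / (n + 1)) := by rw [ht]; field_simp
    rw [e]
    have : n / (n + 1) ≤ 1 := by rw [div_le_one (by positivity)]; linarith
    nlinarith
  have hfin : Real.pi * ∑ p ∈ P, sr (s p) * φ p ≤ detPairing Ω u G ψ + 3 * η := by
    have := mul_le_mul_of_nonneg_left hsum hpi.le
    rw [mul_add] at this
    linarith
  calc _ ≤ ENNReal.ofReal (detPairing Ω u G ψ + 3 * η) := ENNReal.ofReal_le_ofReal hfin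
    _ ≤ ENNReal.ofReal (detPairing Ω u G ψ) + ENNReal.ofReal (3 * η) := ENNReal.ofReal_add_le
    _ ≤ _ := by gcongr

lemma sqrt_bound (a w : ℂ) : Real.sqrt (1 + ‖a‖ ^ 2) ≤ Real.sqrt (1 + ‖w‖ ^ 2) + ‖a - w‖ := by
  have h1 : ‖a‖ ≤ ‖w‖ + ‖a - w‖ := by
    have := norm_add_le w (a - w); simpa using this
  have h2 : ‖w‖ ≤ Real.sqrt (1 + ‖w‖ ^ 2) := Real.le_sqrt_of_sq_le (by linarith)
  refine Real.sqrt_le_iff.2 ⟨by positivity, ?_⟩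
  have h3 := Real.sq_sqrt (show (0:ℝ) ≤ 1 + ‖w‖ ^ 2 by positivity)
  have h0 := norm_nonneg (a - w)
  have h4 := norm_nonneg a
  nlinarith [mul_le_mul_of_nonneg_right h2 h0, pow_le_pow_left₀ h4 h1 2]

lemma wf_sq_le {u : R2 → R2} {G : R2 → Matrix (Fin 2) (Fin 2) ℝ} {x : R2} (h : ‖u x‖ = 1) :
    ‖wf u G x‖ ^ 2 ≤ ∑ i, ∑ j, (G x i j) ^ 2 := by
  have h1 : u x 0 ^ 2 + u x 1 ^ 2 = 1 := by
    have := EuclideanSpace.norm_sq_eq (u x)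
    rw [h] at this
    simp [Fin.sum_univ_two] at this
    linarith
  rw [Complex.sq_norm, Complex.normSq_apply]
  simp only [wf, Fin.sum_univ_two]
  have k : ∀ a b : ℝ, (u x 0 * a - u x 1 * b) * (u x 0 * a - u x 1 * b) ≤ a ^ 2 + b ^ 2 := by
    intro a b
    have : (u x 0 ^ 2 + u x 1 ^ 2) * (a ^ 2 + b ^ 2) =
      (u x 0 * a - u x 1 * b) ^ 2 + (u x 0 * b + u x 1 * a) ^ 2 := by ring
    rw [h1, one_mul] at this
    nlinarith [sq_nonneg (u x 0 * b + u x 1 * a)]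
  have a1 := k (G x 1 0) (G x 0 0)
  have a2 := k (G x 1 1) (G x 0 1)
  linarith

lemma area_main {Ω U : Set R2} (hUΩ : U ⊆ Ω) (hΩb : Bornology.IsBounded Ω)
    {u : R2 → R2} {G : R2 → Matrix (Fin 2) (Fin 2) ℝ}
    (hu : MemW11 Ω u G) (hs : SphereValued Ω u) :
    ∫⁻ x in U, ENNReal.ofReal (Real.sqrt (1 + ‖wf u G x‖ ^ 2)) ≤
      ENNReal.ofReal (∫ x in Ω, Real.sqrt (1 + ∑ i, ∑ j, (G x i j) ^ 2)) := by
  have hfin : volume Ω ≠ ∞ := hΩb.measure_lt_top.ne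
  have hIntg : IntegrableOn (fun x => Real.sqrt (1 + ∑ i, ∑ j, (G x i j) ^ 2)) Ω := by
    have hg : IntegrableOn (fun x => 1 + ∑ i, ∑ j, |G x i j|) Ω :=
      (integrableOn_const hfin).add
        (integrable_finsetSum _ fun i _ => integrable_finsetSum _ fun j _ => (hu.2.1 i j).abs)
    refine Integrable.mono' hg ?_ (ae_of_all _ fun x => ?_)
    · have hm : ∀ i j, AEMeasurable (fun x => G x i j) (volume.restrict Ω) := fun i j =>
        (hu.2.1 i j).aemeasurable
      have : AEMeasurable (fun x => Real.sqrt (1 + ∑ i, ∑ j, (G x i j) ^ 2))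
          (volume.restrict Ω) := by
        refine Real.continuous_sqrt.measurable.comp_aemeasurable (aemeasurable_const.add ?_)
        exact Finset.aemeasurable_fun_sum _ fun i _ => Finset.aemeasurable_fun_sum _ fun j _ =>
          (hm i j).pow_const 2
      exact this.aestronglyMeasurable
    · rw [Real.norm_of_nonneg (Real.sqrt_nonneg _)]
      refine Real.sqrt_le_iff.2 ⟨by positivity, ?_⟩
      simp only [Fin.sum_univ_two]
      rw [← sq_abs (G x 0 0), ← sq_abs (G x 0 1), ← sq_abs (G x 1 0), ← sq_abs (G x 1 1)]
      have a := abs_nonneg (G x 0 0)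
      have b := abs_nonneg (G x 0 1)
      have c := abs_nonneg (G x 1 0)
      have d := abs_nonneg (G x 1 1)
      nlinarith [mul_nonneg a b, mul_nonneg a c, mul_nonneg a d, mul_nonneg b c, mul_nonneg b d,
        mul_nonneg c d]
  rw [ofReal_integral_eq_lintegral_ofReal hIntg (ae_of_all _ fun x => Real.sqrt_nonneg _)]
  refine (lintegral_mono_set hUΩ).trans (lintegral_mono_ae ?_)
  filter_upwards [hs] with x hx
  exact ENNReal.ofReal_le_ofReal (Real.sqrt_le_sqrt (by have := wf_sq_le (G := G) hx; linarith))


lemma lint_add3 {μ : Measure R2} {a b c : R2 → ℝ≥0∞} (ha : AEMeasurable a μ)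
    (hb : AEMeasurable b μ) : ∫⁻ x, a x + b x + c x ∂μ =
      (∫⁻ x, a x ∂μ) + (∫⁻ x, b x ∂μ) + ∫⁻ x, c x ∂μ := by
  have hab : AEMeasurable (fun x => a x + b x) μ := ha.add hb
  rw [lintegral_add_left' hab, lintegral_add_left' ha]

lemma approx {Ω C : Set R2} (hΩo : IsOpen Ω) (hΩb : Bornology.IsBounded Ω)
    (hΩl : HasLipschitzBoundary Ω) (hCfin : C.Finite)
    {u : R2 → R2} {G : R2 → Matrix (Fin 2) (Fin 2) ℝ}
    (hu : MemW11 Ω u G) (hs : SphereValued Ω u) {η : ℝ} (hη : 0 < η) :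
    ∃ f : R2 → R2, ContDiffOn ℝ 1 f (Ω \ C) ∧
      ∫⁻ x in Ω \ C, ‖f x - u x‖ₑ ≤ ENNReal.ofReal (3 * η) ∧
      classicalArea (Ω \ C) f ≤
        ENNReal.ofReal (∫ x in Ω, Real.sqrt (1 + ∑ i, ∑ j, (G x i j) ^ 2)) +
        flatNormOn Ω (frontier Ω ∪ C) 2 (detPairing Ω u G) + ENNReal.ofReal (6 * η) := by
  set U : Set R2 := Ω \ C with hU
  have hCc : IsClosed C := hCfin.isClosed
  have hUo : IsOpen U := hΩo.sdiff hCc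
  have hUΩ : U ⊆ Ω := Set.diff_subset
  have hUb : Bornology.IsBounded U := hΩb.subset hUΩ
  set Z : Set R2 := Ωᶜ ∪ C with hZ
  have hZc : IsClosed Z := hΩo.isClosed_compl.union hCc
  have hZU : ∀ x, x ∈ Z ↔ x ∉ U := by
    intro x
    simp only [hZ, hU, Set.mem_union, Set.mem_compl_iff, Set.mem_diff, not_and_or, not_not]
  have hZne : Z.Nonempty := by
    by_contra h
    rw [Set.not_nonempty_iff_eq_empty] at h
    have hall : ∀ x, x ∈ Ω := fun x => by
      by_contra hx
      have : x ∈ Z := Or.inl hx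
      rw [h] at this; exact this
    have : Ω = Set.univ := Set.eq_univ_of_forall hall
    rw [this] at hΩb
    exact NormedSpace.unbounded_univ ℝ R2 hΩb
  -- the distance function
  set g : R2 → ℝ := fun x => min 1 (2 * infDist x Z) with hg
  have hg0 : ∀ x, 0 ≤ g x := fun x => le_min zero_le_one (by have := infDist_nonneg (x := x) (s := Z); linarith)
  have hgl : ∀ x y, g x ≤ g y + 2 * dist x y := by
    intro x y
    have h1 := infDist_le_infDist_add_dist (s := Z) (x := x) (y := y)
    have h2 : 0 ≤ dist x y := dist_nonneg
    simp only [hg]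
    rw [← min_add_add_right]
    refine le_min ((min_le_left _ _).trans (by linarith)) ((min_le_right _ _).trans (by linarith))
  have hgZ : ∀ x ∈ Z, g x = 0 := by
    intro x hx
    simp only [hg, infDist_zero_of_mem hx]; simp
  obtain ⟨P, s, W, hW, hW0, hP, h1, h2⟩ := generic_factor hΩo hΩb hΩl hu hs hη
  obtain ⟨φ, S, M, τ, hφ, hφg, hSP, hMP, hM, hdec, hcost⟩ := matching_aux P s g hg0 hgl
  have hflat := flat_bound (C := C) hΩo hΩb hu hs hη P s hW hW0 h2 hφ
    (fun x => (hφg x).trans (min_le_left _ _))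
    (fun x hx => abs_eq_zero.1 (le_antisymm ((hφg x).trans (hgZ x hx).le) (abs_nonneg _)))
  set S1 := S.filter (fun p => 1 ≤ 2 * infDist p Z) with hS1
  set T := S.filter (fun p => ¬ (1 ≤ 2 * infDist p Z)) with hT
  have hq : ∀ p, ∃ q ∈ Z, infDist p Z = dist p q := fun p => hZc.exists_infDist_eq_dist hZne p
  choose q hqZ hqd using hq
  have hS1U : ∀ p ∈ S1, p ∈ U := by
    intro p hp
    by_contra h
    have h3 := (Finset.mem_filter.1 hp).2
    rw [infDist_zero_of_mem ((hZU p).2 h)] at h3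
    linarith
  have hW1 : ContDiff ℝ 1 W := hW.of_le (by exact_mod_cast le_top)
  obtain ⟨A', hA', hA'1, h3, h4⟩ := costLE_all hUo hUb hW1
    (fun x hx => hW0 x (subset_closure (hUΩ hx))) s T M q τ (fun p _ => (hZU _).1 (hqZ p)) hM η hη
  obtain ⟨f, hf, h5, h6⟩ := drill hUo hUb hA' hA'1 S1 s hS1U hη
  set A0 : R2 → ℂ := fun x => uv (W x) * ((∏ p ∈ T, uv (vx (s p) p x)) *
        ∏ p ∈ M, (uv (vx (s p) p x) * uv (vx (s (τ p)) (τ p) x))) with hA0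
  set a0 : R2 → ℂ := fun x => jf W x + (∑ p ∈ T, sr (s p) * jv p x +
        ∑ p ∈ M, (sr (s p) * jv p x + sr (s (τ p)) * jv (τ p) x)) with ha0
  set B1 : R2 → ℂ := fun x => ∏ p ∈ S1, uv (vx (s p) p x) with hB1
  set b1 : R2 → ℂ := fun x => ∑ p ∈ S1, sr (s p) * jv p x with hb1
  have eA : ∀ x, A0 x * B1 x = uv (W x) * ∏ p ∈ P, uv (vx (s p) p x) := by
    intro x
    rw [hdec, ← Finset.prod_filter_mul_prod_filter_not S (fun p => 1 ≤ 2 * infDist p Z)]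
    simp only [hA0, hB1]
    ring
  have ea : ∀ x, a0 x + b1 x = jf W x + ∑ p ∈ P, sr (s p) * jv p x := by
    intro x
    rw [dec_add hdec, ← Finset.sum_filter_add_sum_filter_not S (fun p => 1 ≤ 2 * infDist p Z)]
    simp only [ha0, hb1]
    ring
  have ec : Real.pi * S1.card + (0 + (∑ p ∈ T, 2 * Real.pi * dist p (q p) +
      ∑ p ∈ M, 2 * Real.pi * dist p (τ p))) =
      Real.pi * (∑ p ∈ S, g p + ∑ p ∈ M, 2 * dist p (τ p)) := by
    rw [← Finset.sum_filter_add_sum_filter_not S (fun p => 1 ≤ 2 * infDist p Z)]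
    have k1 : ∑ p ∈ S1, g p = S1.card := by
      rw [Finset.sum_congr rfl (g := fun _ => (1 : ℝ))]
      · simp
      · intro p hp
        exact min_eq_left (Finset.mem_filter.1 hp).2
    have k2 : ∑ p ∈ T, g p = ∑ p ∈ T, 2 * dist p (q p) := by
      refine Finset.sum_congr rfl fun p hp => ?_
      rw [← hqd]
      exact min_eq_right (not_le.1 (Finset.mem_filter.1 hp).2).le
    rw [k1, k2, mul_add, mul_add, Finset.mul_sum, Finset.mul_sum, zero_add, add_assoc]
    congr 1
    congr 1 <;> exact Finset.sum_congr rfl fun p _ => by ring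
  -- measurability
  have hUm : MeasurableSet U := hUo.measurableSet
  have mf : AEMeasurable (fun x => cx (f x)) (volume.restrict U) :=
    (cx.continuous.comp_continuousOn hf.continuousOn).aemeasurable hUm
  have mA' : AEMeasurable A' (volume.restrict U) := hA'.continuousOn.aemeasurable hUm
  have muv : ∀ p, Measurable (fun x => uv (vx (s p) p x)) := fun p =>
    measurable_uv.comp (continuous_vx (s p) p).measurable
  have mB1 : Measurable B1 := Finset.measurable_fun_prod _ fun p _ => muv p
  have mA0 : Measurable A0 :=
    (measurable_uv.comp hW.continuous.measurable).mul
      ((Finset.measurable_fun_prod _ fun p _ => muv p).mul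
        (Finset.measurable_fun_prod _ fun p _ => (muv p).mul (muv (τ p))))
  have ma0 : AEMeasurable a0 (volume.restrict U) := by
    refine (aemeasurable_jf hW.continuous.measurable.aemeasurable).add ?_
    have mj : ∀ p, Measurable (fun x => (sr (s p) : ℂ) * jv p x) := fun p =>
      measurable_const.mul (measurable_jv p)
    exact ((Finset.measurable_fun_sum _ fun p _ => mj p).add
      (Finset.measurable_fun_sum _ fun p _ => (mj p).add (mj (τ p)))).aemeasurable
  have mw : AEMeasurable (wf u G) (volume.restrict U) :=
    ((integrableOn_wf hu hs).mono_set hUΩ).aemeasurable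
  refine ⟨f, hf, ?_, ?_⟩
  · have hpt : ∀ x, ‖f x - u x‖ₑ ≤ (‖cx (f x) - A' x * B1 x‖ₑ + ‖A' x - A0 x‖ₑ) +
        ‖uv (W x) * ∏ p ∈ P, uv (vx (s p) p x) - cx (u x)‖ₑ := by
      intro x
      have e : ‖f x - u x‖ₑ = ‖cx (f x) - cx (u x)‖ₑ := by
        rw [← map_sub, ← ofReal_norm, ← ofReal_norm, LinearIsometryEquiv.norm_map]
      rw [e, ← eA]
      have e2 : cx (f x) - cx (u x) = (cx (f x) - A' x * B1 x) + (A' x - A0 x) * B1 x +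
        (A0 x * B1 x - cx (u x)) := by ring
      rw [e2]
      refine (enorm_add_le _ _).trans (add_le_add_left ((enorm_add_le _ _).trans
        (add_le_add_right ?_ _)) _)
      rw [← ofReal_norm, ← ofReal_norm, norm_mul]
      refine ENNReal.ofReal_le_ofReal (mul_le_of_le_one_right (norm_nonneg _) ?_)
      simp only [hB1, norm_prod]
      exact Finset.prod_le_one (fun _ _ => norm_nonneg _) fun p _ => norm_uv_le _
    have m1 : AEMeasurable (fun x => ‖cx (f x) - A' x * B1 x‖ₑ) (volume.restrict U) :=
      (mf.sub (mA'.mul mB1.aemeasurable)).enorm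
    have m2 : AEMeasurable (fun x => ‖A' x - A0 x‖ₑ) (volume.restrict U) :=
      (mA'.sub mA0.aemeasurable).enorm
    refine (lintegral_mono hpt).trans ?_
    rw [lint_add3 m1 m2]
    have e3 : ENNReal.ofReal (3 * η) = ENNReal.ofReal η + ENNReal.ofReal η + ENNReal.ofReal η := by
      rw [← ENNReal.ofReal_add hη.le hη.le, ← ENNReal.ofReal_add (by positivity) hη.le]
      ring_nf
    rw [e3]
    exact add_le_add (add_le_add h5 h3) ((lintegral_mono_set hUΩ).trans h1)
  · have hpt : ∀ x, ENNReal.ofReal (Real.sqrt (1 + ‖jf A' x + b1 x‖ ^ 2)) ≤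
        (ENNReal.ofReal (Real.sqrt (1 + ‖wf u G x‖ ^ 2)) + ‖jf A' x - a0 x‖ₑ) +
        ‖jf W x + ∑ p ∈ P, sr (s p) * jv p x - wf u G x‖ₑ := by
      intro x
      rw [← ea, ← ofReal_norm, ← ofReal_norm, add_assoc,
        ← ENNReal.ofReal_add (norm_nonneg _) (norm_nonneg _),
        ← ENNReal.ofReal_add (Real.sqrt_nonneg _) (by positivity)]
      refine ENNReal.ofReal_le_ofReal ((sqrt_bound _ (wf u G x)).trans (add_le_add_right ?_ _))
      have e : jf A' x + b1 x - wf u G x = (jf A' x - a0 x) + (a0 x + b1 x - wf u G x) := by ring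
      rw [e]; exact norm_add_le _ _
    have m1 : AEMeasurable (fun x => ENNReal.ofReal (Real.sqrt (1 + ‖wf u G x‖ ^ 2)))
        (volume.restrict U) :=
      (Real.continuous_sqrt.measurable.comp_aemeasurable
        (aemeasurable_const.add (mw.norm.pow_const 2))).ennreal_ofReal
    have m2 : AEMeasurable (fun x => ‖jf A' x - a0 x‖ₑ) (volume.restrict U) :=
      ((aemeasurable_jf mA').sub ma0).enorm
    have hI : ∫⁻ x in U, ENNReal.ofReal (Real.sqrt (1 + ‖jf A' x + b1 x‖ ^ 2)) ≤
        (ENNReal.ofReal (∫ x in Ω, Real.sqrt (1 + ∑ i, ∑ j, (G x i j) ^ 2)) +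
        ENNReal.ofReal (0 + (∑ p ∈ T, 2 * Real.pi * dist p (q p) +
          ∑ p ∈ M, 2 * Real.pi * dist p (τ p)) + η)) + ENNReal.ofReal η := by
      refine (lintegral_mono hpt).trans ?_
      rw [lint_add3 m1 m2]
      exact add_le_add (add_le_add (area_main hUΩ hΩb hu hs) h4)
        ((lintegral_mono_set hUΩ).trans h2)
    refine h6.trans ((add_le_add_left hI _).trans ?_)
    set c : ℝ := 0 + (∑ p ∈ T, 2 * Real.pi * dist p (q p) +
          ∑ p ∈ M, 2 * Real.pi * dist p (τ p)) with hc
    have hpi := Real.pi_pos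
    have hc0 : 0 ≤ c := by
      rw [hc, zero_add]
      exact add_nonneg (Finset.sum_nonneg fun _ _ => by positivity)
        (Finset.sum_nonneg fun _ _ => by positivity)
    have hcard : (0 : ℝ) ≤ S1.card := Nat.cast_nonneg _
    have hpc : 0 ≤ Real.pi * S1.card := by positivity
    have e4 : ENNReal.ofReal (c + η) + ENNReal.ofReal η + ENNReal.ofReal (Real.pi * S1.card + η) =
        ENNReal.ofReal (Real.pi * S1.card + c) + ENNReal.ofReal (3 * η) := by
      rw [← ENNReal.ofReal_add (by positivity) hη.le,
        ← ENNReal.ofReal_add (by positivity) (by positivity),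
        ← ENNReal.ofReal_add (by positivity) (by positivity)]
      ring_nf
    rw [add_assoc, add_assoc, ← add_assoc (ENNReal.ofReal (c + η)), e4, ec, add_assoc]
    refine add_le_add_right ?_ _
    have h7 : ENNReal.ofReal (Real.pi * (∑ p ∈ S, g p + ∑ p ∈ M, 2 * dist p (τ p))) ≤
        flatNormOn Ω (frontier Ω ∪ C) 2 (detPairing Ω u G) + ENNReal.ofReal (3 * η) :=
      (ENNReal.ofReal_le_ofReal (mul_le_mul_of_nonneg_left hcost hpi.le)).trans hflat
    refine (add_le_add_left h7 _).trans ?_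
    rw [add_assoc, ← ENNReal.ofReal_add (by positivity) (by positivity)]
    ring_nf
    exact le_rfl

lemma final_bound {Ω C : Set R2} (hΩo : IsOpen Ω) (hΩb : Bornology.IsBounded Ω)
    (hΩl : HasLipschitzBoundary Ω) (hCfin : C.Finite)
    {u : R2 → R2} {G : R2 → Matrix (Fin 2) (Fin 2) ℝ}
    (hu : MemW11 Ω u G) (hs : SphereValued Ω u) :
    relaxedArea u (Ω \ C) ≤
      ENNReal.ofReal (∫ x in Ω, Real.sqrt (1 + ∑ i, ∑ j, (G x i j) ^ 2)) +
        flatNormOn Ω (frontier Ω ∪ C) 2 (detPairing Ω u G) := by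
  set c : ℝ≥0∞ := ENNReal.ofReal (∫ x in Ω, Real.sqrt (1 + ∑ i, ∑ j, (G x i j) ^ 2)) +
        flatNormOn Ω (frontier Ω ∪ C) 2 (detPairing Ω u G) with hc
  have key := fun n : ℕ => approx hΩo hΩb hΩl hCfin hu hs (η := 1 / ((n : ℝ) + 1)) (by positivity)
  choose f hf hf1 hf2 using key
  have hUm : MeasurableSet (Ω \ C) := (hΩo.sdiff hCfin.isClosed).measurableSet
  have ht : Tendsto (fun n : ℕ => 1 / ((n : ℝ) + 1)) atTop (𝓝 0) :=
    tendsto_one_div_add_atTop_nhds_zero_nat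
  have hm : ∀ k, AEStronglyMeasurable (fun x => f k x - u x) (volume.restrict (Ω \ C)) := fun k =>
    ((hf k).continuousOn.aestronglyMeasurable hUm).sub
      (hu.1.mono_set Set.diff_subset).aestronglyMeasurable
  have hi : ∀ k, IntegrableOn (fun x => f k x - u x) (Ω \ C) := fun k =>
    ⟨hm k, (hf1 k).trans_lt ENNReal.ofReal_lt_top⟩
  have hlim : Filter.liminf (fun k => classicalArea (Ω \ C) (f k)) atTop ≤ c := by
    have h1 : Filter.liminf (fun k => classicalArea (Ω \ C) (f k)) atTop ≤
        Filter.liminf (fun n : ℕ => c + ENNReal.ofReal (6 * (1 / ((n : ℝ) + 1)))) atTop :=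
      liminf_le_liminf (Eventually.of_forall hf2)
    have h2 : Tendsto (fun n : ℕ => c + ENNReal.ofReal (6 * (1 / ((n : ℝ) + 1)))) atTop
        (𝓝 (c + ENNReal.ofReal (6 * 0))) :=
      tendsto_const_nhds.add (ENNReal.tendsto_ofReal (ht.const_mul 6))
    rw [h2.liminf_eq] at h1
    simpa using h1
  refine le_trans (sInf_le ⟨f, hf, hi, ?_, rfl⟩) hlim
  have h3 : Tendsto (fun n : ℕ => 3 * (1 / ((n : ℝ) + 1))) atTop (𝓝 0) := by
    simpa using ht.const_mul 3
  refine squeeze_zero (fun k => integral_nonneg fun x => norm_nonneg _) (fun k => ?_) h3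
  rw [integral_norm_eq_lintegral_enorm (hm k)]
  exact ENNReal.toReal_le_of_le_ofReal (by positivity) (hf1 k)

/-- **Theorem (upper bound on `Ω ∖ C`).** For `u ∈ W^{1,1}(Ω;S¹)` and a finite set
`C ⊂ Ω`, `𝒜(u,Ω∖C) ≤ ∫_Ω √(1+|∇u|²) dx + ‖Det(∇u)‖_{flat,α,Ω∖C}`, where the flat
norm is taken over Lipschitz test functions vanishing on `∂Ω ∪ C`. -/
theorem relaxedArea_diff_finite_le (Ω : Set R2) (hΩo : IsOpen Ω)
    (hΩb : Bornology.IsBounded Ω) (hΩc : IsConnected Ω) (hΩl : HasLipschitzBoundary Ω)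
    (C : Set R2) (hC : C ⊆ Ω) (hCfin : C.Finite)
    (u : R2 → R2) (G : R2 → Matrix (Fin 2) (Fin 2) ℝ)
    (hu : MemW11 Ω u G) (hS : SphereValued Ω u) :
    relaxedArea u (Ω \ C) ≤
      ENNReal.ofReal (∫ x in Ω, Real.sqrt (1 + ∑ i, ∑ j, (G x i j) ^ 2)) +
        flatNormOn Ω (frontier Ω ∪ C) 2 (detPairing Ω u G) := final_bound hΩo hΩb hΩl hCfin hu hS
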